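/- arXiv:2604.00047 — 3 statements merged into one kernel-verified Lean document; each statement's English description precedes it below -/
import Mathlib

section
/- Fix a base b ≥ 2 and a lag ℓ ≥ 1, set m = b^(ℓ+1), and let S : (ℤ/mℤ)ˣ → ℝ satisfy S(a) + S(−a) = −1 for all units a. Then the centered prime harmonic sum at s = 1 converges: there exists L ∈ ℝ such that Σ_{p ≤ x, p prime, p ∤ b} S°(p mod m)/p tends to L as x → ∞ (for p ∤ b, the residue p mod m is a unit of ℤ/mℤ). -/
/-- The spectral class of a unit `a` of `ℤ/mℤ`: `R(a) = (a₀ − 1) mod b`, where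
`a₀ ∈ {1, …, m−1}` is the canonical representative of `a`. -/
def spectralClass (b m : ℕ) (a : (ZMod m)ˣ) : ℕ :=
  ((a : ZMod m).val - 1) % b

open Finset in
/-- The centered collision deviation: `S°(a) = S(a) − (mean of S over the units in the
spectral class of a)`. -/
noncomputable def centered (b m : ℕ) [NeZero m] (S : (ZMod m)ˣ → ℝ) (a : (ZMod m)ˣ) : ℝ :=
  S a - (∑ x ∈ univ.filter (fun x : (ZMod m)ˣ => spectralClass b m x = spectralClass b m a),
      S x) /
    ((univ.filter (fun x : (ZMod m)ˣ => spectralClass b m x = spectralClass b m a)).card : ℝ)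

/-- Extension of the centered collision deviation to all of `ℤ/mℤ`, vanishing off the
units.  For a prime `p ∤ b`, the residue `p mod m` is a unit, and this extension takes
the value `S°(p mod m)` there. -/
noncomputable def centeredZ (b m : ℕ) [NeZero m] (S : (ZMod m)ˣ → ℝ) (x : ZMod m) : ℝ :=
  if h : IsUnit x then centered b m S h.unit else 0

section

open Filter Finset Topology

/-- Summation by parts over `Ico M N`, in terms of the partial sums of `a`. -/
theorem sum_Ico_smul_by_parts {E : Type*} [AddCommGroup E] [Module ℝ E] (f : ℕ → ℝ) (a : ℕ → E)
    {M N : ℕ} (hMN : M ≤ N) :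
    ∑ n ∈ Ico M N, f n • a n = f N • ∑ n ∈ range N, a n - f M • ∑ n ∈ range M, a n
      + ∑ n ∈ Ico M N, (f n - f (n + 1)) • ∑ i ∈ range (n + 1), a i := by
  induction N, hMN using Nat.le_induction with
  | base => simp
  | succ N hN ih =>
    rw [sum_Ico_succ_top hN, sum_Ico_succ_top hN, ih, sum_range_succ]
    module

/-- If the partial sums of `a` are bounded by `C` and `f` is nonnegative and antitone from `M` on,
then the sums of `f n • a n` over `Ico M N` are bounded by `2 * C * f M`. -/
theorem norm_sum_Ico_smul_le {E : Type*} [NormedAddCommGroup E] [NormedSpace ℝ E] {f : ℕ → ℝ}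
    {a : ℕ → E} {C : ℝ} (ha : ∀ n, ‖∑ i ∈ range n, a i‖ ≤ C) {M : ℕ}
    (hf : AntitoneOn f (Set.Ici M)) (hf0 : ∀ n, M ≤ n → 0 ≤ f n) (N : ℕ) :
    ‖∑ n ∈ Ico M N, f n • a n‖ ≤ 2 * C * f M := by
  have hC : 0 ≤ C := (norm_nonneg _).trans (ha 0)
  rcases lt_or_ge N M with h | hMN
  · rw [Ico_eq_empty_of_le h.le, sum_empty, norm_zero]
    have := hf0 M le_rfl
    positivity
  have hsmul (c : ℝ) (hc : 0 ≤ c) (n : ℕ) : ‖c • ∑ i ∈ range n, a i‖ ≤ c * C := by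
    rw [norm_smul, Real.norm_of_nonneg hc]
    exact mul_le_mul_of_nonneg_left (ha n) hc
  have htail : ‖∑ n ∈ Ico M N, (f n - f (n + 1)) • ∑ i ∈ range (n + 1), a i‖
      ≤ (f M - f N) * C := by
    calc _ ≤ ∑ n ∈ Ico M N, (f n - f (n + 1)) * C := by
          refine norm_sum_le_of_le _ fun n hn ↦ hsmul _ ?_ _
          have hMn := (mem_Ico.mp hn).1
          exact sub_nonneg.mpr (hf hMn (Set.mem_Ici.mpr (hMn.trans n.le_succ)) n.le_succ)
      _ = (f M - f N) * C := by
          rw [← sum_mul]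
          congr 1
          rw [← neg_inj, ← sum_neg_distrib, neg_sub, ← sum_Ico_sub f hMN]
          exact sum_congr rfl fun _ _ ↦ neg_sub _ _
  rw [sum_Ico_smul_by_parts f a hMN]
  refine (norm_add_le _ _).trans ?_
  have h1 := norm_sub_le (f N • ∑ n ∈ range N, a n) (f M • ∑ n ∈ range M, a n)
  have h2 := hsmul _ (hf0 N hMN) N
  have h3 := hsmul _ (hf0 M le_rfl) M
  linarith

theorem sum_Ioc_zero_eq_sum_range_succ {E : Type*} [AddCommMonoid E] {f : ℕ → E} (hf : f 0 = 0)
    (N : ℕ) : ∑ n ∈ Ioc 0 N, f n = ∑ n ∈ range (N + 1), f n := by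
  rw [range_eq_Ico, sum_eq_sum_Ico_succ_bot N.succ_pos, hf, zero_add]
  rfl

namespace DirichletCharacter

theorem norm_sum_range_le {m : ℕ} [NeZero m] {χ : DirichletCharacter ℂ m} (hχ : χ ≠ 1) (N : ℕ) :
    ‖∑ n ∈ range N, χ (n : ZMod m)‖ ≤ m := by
  have hperiod : ∑ n ∈ range m, χ (n : ZMod m) = 0 := by
    rw [← MulChar.sum_eq_zero_of_ne_one hχ]
    refine sum_bij (fun n _ ↦ (n : ZMod m)) (fun _ _ ↦ mem_univ _) (fun i hi j hj h ↦ ?_)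
      (fun x _ ↦ ⟨x.val, mem_range.mpr x.val_lt, ZMod.natCast_zmod_val x⟩) (fun _ _ ↦ rfl)
    rw [← ZMod.val_cast_of_lt (mem_range.mp hi), h, ZMod.val_cast_of_lt (mem_range.mp hj)]
  induction N using Nat.strong_induction_on with
  | _ N ih =>
    rcases lt_or_ge N m with h | h
    · calc _ ≤ ∑ n ∈ range N, (1 : ℝ) := norm_sum_le_of_le _ fun n _ ↦ χ.norm_le_one _
        _ ≤ m := by simpa using h.le
    · obtain ⟨k, rfl⟩ := Nat.exists_eq_add_of_le h
      rw [sum_range_add, hperiod, zero_add]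
      simpa using ih k (by have := NeZero.pos m; omega)

theorem norm_LFunction_sub_sum_term_le {m : ℕ} [NeZero m] {χ : DirichletCharacter ℂ m}
    (hχ : χ ≠ 1) {s : ℝ} (hs : 1 < s) {N : ℕ} (hN : 1 ≤ N) :
    ‖LFunction χ s - ∑ n ∈ range N, LSeries.term (χ ·) s n‖ ≤ 2 * m / N := by
  have hs' : 1 < (s : ℂ).re := by simpa
  have hlim := (LSeriesSummable_of_one_lt_re χ hs').LSeriesHasSum.tendsto_sum_nat
  rw [← LFunction_eq_LSeries χ hs'] at hlim
  refine le_of_tendsto ((hlim.sub_const _).norm) ?_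
  filter_upwards [eventually_ge_atTop N] with M hM
  rw [← sum_Ico_eq_sub _ hM]
  have hterm : ∑ n ∈ Ico N M, LSeries.term (χ ·) s n
      = ∑ n ∈ Ico N M, ((n : ℝ) ^ (-s)) • χ (n : ZMod m) := by
    refine sum_congr rfl fun n hn ↦ ?_
    have hn0 : n ≠ 0 := by have := (mem_Ico.mp hn).1; omega
    rw [LSeries.term_of_ne_zero hn0, Complex.real_smul, Complex.ofReal_cpow n.cast_nonneg,
      Complex.ofReal_neg, Complex.cpow_neg, Complex.ofReal_natCast, div_eq_inv_mul]
  rw [hterm]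
  have hN0 : (1 : ℝ) ≤ N := by exact_mod_cast hN
  refine (norm_sum_Ico_smul_le (norm_sum_range_le hχ) ?_ (fun n _ ↦ by positivity) M).trans ?_
  · intro i hi j hj hij
    have : (0 : ℝ) < i := by exact_mod_cast hN.trans hi
    exact Real.rpow_le_rpow_of_nonpos this (by exact_mod_cast hij) (by linarith)
  · rw [div_eq_mul_inv, ← Real.rpow_neg_one]
    gcongr

/-- The series `∑ χ n / n` converges to `L(1, χ)`, with an explicit rate. -/
theorem norm_LFunction_one_sub_sum_le {m : ℕ} [NeZero m] {χ : DirichletCharacter ℂ m}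
    (hχ : χ ≠ 1) {N : ℕ} (hN : 1 ≤ N) :
    ‖LFunction χ 1 - ∑ n ∈ range N, χ (n : ZMod m) / n‖ ≤ 2 * m / N := by
  have hcont : Continuous fun s : ℝ ↦ LFunction χ s - ∑ n ∈ range N, LSeries.term (χ ·) s n := by
    refine ((differentiable_LFunction hχ).continuous.comp Complex.continuous_ofReal).sub
      (continuous_finsetSum _ fun n _ ↦ ?_)
    exact (continuous_iff_continuousAt.mpr fun s ↦
      (LSeries.hasDerivAt_term (χ ·) n s).continuousAt).comp Complex.continuous_ofReal
  have hterm (n : ℕ) : LSeries.term (χ ·) ((1 : ℝ) : ℂ) n = χ (n : ZMod m) / n := by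
    rcases eq_or_ne n 0 with rfl | hn
    · simp
    · simp [LSeries.term_of_ne_zero hn]
  have hlim := (hcont.norm.tendsto 1).mono_left (nhdsWithin_le_nhds (s := Set.Ioi 1))
  simp only [hterm] at hlim
  rw [Complex.ofReal_one] at hlim
  refine le_of_tendsto hlim ?_
  filter_upwards [self_mem_nhdsWithin] with s hs
  exact norm_LFunction_sub_sum_term_le hχ hs hN

theorem exists_norm_sum_log_div_le {m : ℕ} [NeZero m] {χ : DirichletCharacter ℂ m} (hχ : χ ≠ 1) :
    ∃ C, ∀ N : ℕ, ‖∑ n ∈ range N, χ (n : ZMod m) * Real.log n / n‖ ≤ C := by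
  have hanti : AntitoneOn (fun n : ℕ ↦ Real.log n / n) (Set.Ici 3) := by
    intro i hi j hj hij
    have h3 {k : ℕ} (hk : k ∈ Set.Ici 3) : Real.exp 1 ≤ (k : ℝ) := by
      have : (3 : ℝ) ≤ k := by exact_mod_cast hk
      linarith [Real.exp_one_lt_d9]
    exact Real.log_div_self_antitoneOn (h3 hi) (h3 hj) (by exact_mod_cast hij)
  refine ⟨‖∑ n ∈ range 3, χ (n : ZMod m) * Real.log n / n‖ + 2 * m * (Real.log (3 : ℕ) / (3 : ℕ))
    + ∑ n ∈ range 3, ‖χ (n : ZMod m) * Real.log n / n‖, fun N ↦ ?_⟩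
  rcases lt_or_ge N 3 with h | h
  · have h1 : ‖∑ n ∈ range N, χ (n : ZMod m) * Real.log n / n‖
        ≤ ∑ n ∈ range 3, ‖χ (n : ZMod m) * Real.log n / n‖ :=
      (norm_sum_le _ _).trans <| sum_le_sum_of_subset_of_nonneg
        (range_subset_range.mpr h.le) fun _ _ _ ↦ norm_nonneg _
    have : 0 ≤ Real.log (3 : ℕ) := Real.log_natCast_nonneg 3
    exact h1.trans (le_add_of_nonneg_left (by positivity))
  · have h1 := norm_sum_Ico_smul_le (norm_sum_range_le hχ) hanti
      (fun n _ ↦ div_nonneg (Real.log_natCast_nonneg n) n.cast_nonneg) N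
    have h2 : ∑ n ∈ Ico 3 N, (Real.log n / n) • χ (n : ZMod m)
        = ∑ n ∈ Ico 3 N, χ (n : ZMod m) * Real.log n / n := by
      refine sum_congr rfl fun n _ ↦ ?_
      rw [Complex.real_smul]
      push_cast
      ring
    rw [h2] at h1
    rw [← sum_range_add_sum_Ico _ h]
    refine (norm_add_le _ _).trans ((add_le_add_right h1 _).trans (le_add_of_nonneg_right ?_))
    positivity

open ArithmeticFunction in
theorem sum_log_div_eq_sum_vonMangoldt {m : ℕ} (χ : DirichletCharacter ℂ m) (N : ℕ) :
    ∑ n ∈ Ioc 0 N, χ (n : ZMod m) * Real.log n / n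
      = ∑ d ∈ Ioc 0 N, χ (d : ZMod m) * vonMangoldt d / d
          * ∑ k ∈ Ioc 0 (N / d), χ (k : ZMod m) / k := by
  let f : ArithmeticFunction ℂ := ⟨fun d ↦ χ (d : ZMod m) * vonMangoldt d / d, by simp⟩
  let g : ArithmeticFunction ℂ := ⟨fun k ↦ χ (k : ZMod m) / k, by simp⟩
  refine Eq.trans ?_ (sum_Ioc_mul_eq_sum_sum f g N)
  refine sum_congr rfl fun n hn ↦ ?_
  rw [mul_apply, ← vonMangoldt_sum, ← Nat.sum_divisorsAntidiagonal (fun i _ ↦ vonMangoldt i),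
    Complex.ofReal_sum, mul_sum, sum_div]
  refine sum_congr rfl fun x hx ↦ ?_
  rw [← (Nat.mem_divisorsAntidiagonal.mp hx).1, Nat.cast_mul, map_mul, Nat.cast_mul]
  change _ = χ (x.1 : ZMod m) * vonMangoldt x.1 / x.1 * (χ (x.2 : ZMod m) / x.2)
  ring

open ArithmeticFunction in
/-- Mertens estimate: the partial sums of `∑ χ n Λ n / n` are bounded for nontrivial `χ`. -/
theorem exists_norm_sum_vonMangoldt_div_le {m : ℕ} [NeZero m] {χ : DirichletCharacter ℂ m}
    (hχ : χ ≠ 1) :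
    ∃ C, ∀ N : ℕ, ‖∑ n ∈ Ioc 0 N, χ (n : ZMod m) * vonMangoldt n / n‖ ≤ C := by
  obtain ⟨C, hC⟩ := exists_norm_sum_log_div_le hχ
  set L := LFunction χ 1
  have hL0 : L ≠ 0 := LFunction_apply_one_ne_zero hχ
  refine ⟨(C + 2 * m * (Real.log 4 + 4)) / ‖L‖, fun N ↦ ?_⟩
  rw [le_div_iff₀ (norm_pos_iff.mpr hL0), ← norm_mul, sum_mul]
  have hsplit : ∑ d ∈ Ioc 0 N, χ (d : ZMod m) * vonMangoldt d / d * L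
      = ∑ n ∈ range (N + 1), χ (n : ZMod m) * Real.log n / n
        + ∑ d ∈ Ioc 0 N, χ (d : ZMod m) * vonMangoldt d / d
          * (L - ∑ k ∈ range (N / d + 1), χ (k : ZMod m) / k) := by
    rw [← sum_Ioc_zero_eq_sum_range_succ (by simp), sum_log_div_eq_sum_vonMangoldt,
      ← sum_add_distrib]
    refine sum_congr rfl fun d _ ↦ ?_
    rw [sum_Ioc_zero_eq_sum_range_succ (by simp)]
    ring
  have herr : ‖∑ d ∈ Ioc 0 N, χ (d : ZMod m) * vonMangoldt d / d
          * (L - ∑ k ∈ range (N / d + 1), χ (k : ZMod m) / k)‖ ≤ 2 * m * (Real.log 4 + 4) := by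
    rcases Nat.eq_zero_or_pos N with rfl | hN
    · simp; positivity
    have hN' : (0 : ℝ) < N := by exact_mod_cast hN
    calc _ ≤ ∑ d ∈ Ioc 0 N, 2 * m / N * vonMangoldt d := by
          refine norm_sum_le_of_le _ fun d hd ↦ ?_
          have hd0 : 0 < d := (mem_Ioc.mp hd).1
          have hd' : (0 : ℝ) < d := by exact_mod_cast hd0
          have h1 := norm_LFunction_one_sub_sum_le hχ (N := N / d + 1) (Nat.succ_pos _)
          have h2 : (2 * m / (N / d + 1 : ℕ) : ℝ) ≤ 2 * m / (N / d) := by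
            have : (N / d : ℝ) ≤ (N / d + 1 : ℕ) := by
              rw [div_le_iff₀ hd']
              exact_mod_cast (Nat.div_lt_iff_lt_mul hd0).mp (Nat.lt_succ_self (N / d)) |>.le
            gcongr
          have h3 : ‖χ (d : ZMod m) * vonMangoldt d / d‖ ≤ vonMangoldt d / d := by
            rw [norm_div, norm_mul, Complex.norm_natCast, Complex.norm_real,
              Real.norm_of_nonneg vonMangoldt_nonneg]
            gcongr
            exact mul_le_of_le_one_left vonMangoldt_nonneg (χ.norm_le_one _)
          rw [norm_mul]
          refine (mul_le_mul h3 (h1.trans h2) (norm_nonneg _)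
            (div_nonneg vonMangoldt_nonneg hd'.le)).trans_eq ?_
          field_simp
      _ = 2 * m / N * Chebyshev.psi N := by rw [Chebyshev.psi, Nat.floor_natCast, mul_sum]
      _ ≤ 2 * m / N * ((Real.log 4 + 4) * N) := by
          gcongr
          exact Chebyshev.psi_le_const_mul_self hN'.le
      _ = 2 * m * (Real.log 4 + 4) := by field_simp
  rw [hsplit]
  exact (norm_add_le _ _).trans (add_le_add (hC _) herr)

open ArithmeticFunction in
theorem exists_norm_sum_prime_log_div_le {m : ℕ} [NeZero m] {χ : DirichletCharacter ℂ m}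
    (hχ : χ ≠ 1) :
    ∃ C, ∀ N : ℕ, ‖∑ n ∈ range N, if n.Prime then χ (n : ZMod m) * Real.log n / n else 0‖ ≤ C := by
  obtain ⟨C, hC⟩ := exists_norm_sum_vonMangoldt_div_le hχ
  let F (n : ℕ) : ℝ := (if n.Prime then 0 else vonMangoldt n) / n
  have hF0 (n : ℕ) : 0 ≤ F n :=
    div_nonneg (by split_ifs; exacts [le_rfl, vonMangoldt_nonneg]) n.cast_nonneg
  have hF : Summable F := by
    refine (vonMangoldt.summable_residueClass_non_primes_div (q := 1) 0).congr fun n ↦ ?_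
    simp [F, vonMangoldt.residueClass, Subsingleton.elim (n : ZMod 1) 0]
  have hsplit (n : ℕ) : (if n.Prime then χ (n : ZMod m) * Real.log n / n else 0)
      = χ (n : ZMod m) * vonMangoldt n / n - χ (n : ZMod m) * F n := by
    by_cases hn : n.Prime
    · simp [F, hn, vonMangoldt_apply_prime hn]
    · simp [F, hn, mul_div_assoc]
  refine ⟨C + ∑' n, F n, fun N ↦ ?_⟩
  simp only [hsplit]
  rw [sum_sub_distrib]
  refine (norm_sub_le _ _).trans (add_le_add ?_ ?_)
  · rcases N with _ | N
    · simpa using (norm_nonneg _).trans (hC 0)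
    · rw [← sum_Ioc_zero_eq_sum_range_succ (by simp)]
      exact hC N
  · refine le_trans (norm_sum_le_of_le _ fun n _ ↦ ?_) (hF.sum_le_tsum _ fun n _ ↦ hF0 n)
    rw [norm_mul, Complex.norm_real, Real.norm_of_nonneg (hF0 n)]
    exact mul_le_of_le_one_left (hF0 n) (χ.norm_le_one _)

/-- The series `∑ χ p / p` over the primes converges for nontrivial `χ`. -/
theorem exists_tendsto_sum_prime_div {m : ℕ} [NeZero m] {χ : DirichletCharacter ℂ m} (hχ : χ ≠ 1) :
    ∃ L : ℂ, Tendsto (fun N : ℕ ↦ ∑ p ∈ range N with p.Prime, χ (p : ZMod m) / p) atTop (𝓝 L) := by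
  obtain ⟨C, hC⟩ := exists_norm_sum_prime_log_div_le hχ
  have hanti : Antitone fun n : ℕ ↦ (Real.log (max n 2 : ℕ))⁻¹ := by
    intro i j hij
    have : (1 : ℝ) < (max i 2 : ℕ) := by exact_mod_cast (by omega)
    have h0 := Real.log_pos this
    dsimp only
    gcongr
  have hzero : Tendsto (fun n : ℕ ↦ (Real.log (max n 2 : ℕ))⁻¹) atTop (𝓝 0) := by
    refine (Real.tendsto_log_atTop.comp tendsto_natCast_atTop_atTop).inv_tendsto_atTop.congr' ?_
    filter_upwards [eventually_ge_atTop 2] with n hn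
    simp [max_eq_left hn]
  obtain ⟨L, hL⟩ := cauchySeq_tendsto_of_complete
    (hanti.cauchySeq_series_mul_of_tendsto_zero_of_bounded hzero hC)
  refine ⟨L, hL.congr fun N ↦ ?_⟩
  rw [sum_filter]
  refine sum_congr rfl fun n _ ↦ ?_
  split_ifs with hn
  · have hlog : (Real.log n : ℂ) ≠ 0 := by
      exact_mod_cast (Real.log_pos (by exact_mod_cast hn.one_lt)).ne'
    rw [max_eq_left hn.two_le, Complex.real_smul, Complex.ofReal_inv]
    field_simp
  · simp

end DirichletCharacter

/-- If `f` is supported on the units of `ℤ/mℤ` and has mean zero, then the series `∑ f p / p` over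
the primes converges. -/
theorem exists_tendsto_sum_prime_div_of_sum_eq_zero {m : ℕ} [NeZero m] {f : ZMod m → ℂ}
    (hf : ∀ x, ¬ IsUnit x → f x = 0) (hsum : ∑ x, f x = 0) :
    ∃ L : ℂ, Tendsto (fun N : ℕ ↦ ∑ p ∈ range N with p.Prime, f p / p) atTop (𝓝 L) := by
  have htot : (m.totient : ℂ) ≠ 0 := by
    exact_mod_cast (Nat.totient_pos.mpr (NeZero.pos m)).ne'
  let c (χ : DirichletCharacter ℂ m) : ℂ := (∑ u, f u * χ u⁻¹) / m.totient
  have hc : c 1 = 0 := by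
    simp only [c]
    rw [div_eq_zero_iff, ← hsum]
    refine Or.inl (sum_congr rfl fun u _ ↦ ?_)
    by_cases hu : IsUnit u
    · obtain ⟨v, rfl⟩ := hu
      rw [ZMod.inv_coe_unit, MulChar.one_apply_coe, mul_one]
    · simp [hf u hu]
  have hexp (x : ZMod m) : f x = ∑ χ, c χ * χ x := by
    simp only [c, div_mul_eq_mul_div, ← sum_div, sum_mul]
    rw [eq_div_iff htot, sum_comm]
    have h (u : ZMod m) : ∑ χ : DirichletCharacter ℂ m, f u * χ u⁻¹ * χ x
        = if u = x then f u * m.totient else 0 := by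
      by_cases hu : IsUnit u
      · simp only [mul_assoc, ← mul_sum, DirichletCharacter.sum_char_inv_mul_char_eq ℂ hu]
        split_ifs <;> simp
      · simp [hf u hu]
    simp [h]
  have hlim (χ : DirichletCharacter ℂ m) : ∃ L : ℂ, Tendsto
      (fun N : ℕ ↦ c χ * ∑ p ∈ range N with p.Prime, χ (p : ZMod m) / p) atTop (𝓝 L) := by
    rcases eq_or_ne χ 1 with rfl | hχ
    · exact ⟨0, by simp [hc]⟩
    · obtain ⟨L, hL⟩ := DirichletCharacter.exists_tendsto_sum_prime_div hχ
      exact ⟨_, hL.const_mul _⟩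
  choose L hL using hlim
  refine ⟨∑ χ, L χ, (tendsto_finsetSum univ fun χ _ ↦ hL χ).congr fun N ↦ ?_⟩
  simp only [mul_sum]
  rw [sum_comm]
  refine sum_congr rfl fun p _ ↦ ?_
  rw [hexp, sum_div]
  exact sum_congr rfl fun _ _ ↦ mul_div_assoc' _ _ _

theorem sum_centered_eq_zero (b m : ℕ) [NeZero m] (S : (ZMod m)ˣ → ℝ) :
    ∑ a, centered b m S a = 0 := by
  simp only [centered]
  rw [sum_sub_distrib, sub_eq_zero]
  rw [← sum_fiberwise_of_maps_to (fun a _ ↦ mem_image_of_mem (spectralClass b m) (mem_univ a)),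
    ← sum_fiberwise_of_maps_to (fun a _ ↦ mem_image_of_mem (spectralClass b m) (mem_univ a))
      (fun a ↦ _ / _)]
  refine sum_congr rfl fun r hr ↦ ?_
  obtain ⟨a, -, rfl⟩ := mem_image.mp hr
  have hconst : ∀ x ∈ univ.filter (fun x ↦ spectralClass b m x = spectralClass b m a),
      (∑ y ∈ univ.filter (fun y ↦ spectralClass b m y = spectralClass b m x), S y) /
        ((univ.filter (fun y ↦ spectralClass b m y = spectralClass b m x)).card : ℝ)
      = (∑ y ∈ univ.filter (fun y ↦ spectralClass b m y = spectralClass b m a), S y) /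
        ((univ.filter (fun y ↦ spectralClass b m y = spectralClass b m a)).card : ℝ) := by
    intro x hx
    rw [(mem_filter.mp hx).2]
  rw [sum_congr rfl hconst, sum_const, nsmul_eq_mul, mul_div_cancel₀]
  exact_mod_cast (card_pos.mpr ⟨a, by simp⟩).ne'

theorem sum_centeredZ_eq_zero (b m : ℕ) [NeZero m] (S : (ZMod m)ˣ → ℝ) :
    ∑ x, centeredZ b m S x = 0 := by
  rw [← sum_centered_eq_zero b m S]
  refine (sum_of_injOn (fun u : (ZMod m)ˣ ↦ (u : ZMod m)) Units.val_injective.injOn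
    (fun _ _ ↦ mem_coe.mpr (mem_univ _)) (fun x _ hx ↦ ?_) (fun u _ ↦ ?_)).symm
  · refine dif_neg fun h ↦ hx ⟨h.unit, by simp⟩
  · rw [centeredZ, dif_pos u.isUnit, IsUnit.unit_of_val_units]

end

open Filter Finset in
/-- Centered convergence at `s = 1`: for base `b ≥ 2`, lag `ℓ ≥ 1`, `m = b^(ℓ+1)` and `S`
satisfying the reflection identity, the centered prime harmonic sum
`Σ_{p ≤ x, p prime, p ∤ b} S°(p mod m)/p` converges as `x → ∞`. -/
theorem centered_prime_harmonic_sum_converges (b ℓ m : ℕ) (hb : 2 ≤ b) (hℓ : 1 ≤ ℓ)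
    (hm : m = b ^ (ℓ + 1)) [NeZero m]
    (S : (ZMod m)ˣ → ℝ) (hS : ∀ a : (ZMod m)ˣ, S a + S (-a) = -1) :
    ∃ L : ℝ, Tendsto
      (fun x : ℕ => ∑ p ∈ (range (x + 1)).filter (fun p => p.Prime ∧ ¬ p ∣ b),
        centeredZ b m S (p : ZMod m) / (p : ℝ))
      atTop (nhds L) := by
  obtain ⟨L, hL⟩ := exists_tendsto_sum_prime_div_of_sum_eq_zero
    (f := fun x : ZMod m ↦ (centeredZ b m S x : ℂ))
    (fun x hx ↦ by simp [centeredZ, hx])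
    (by rw [← Complex.ofReal_sum, sum_centeredZ_eq_zero, Complex.ofReal_zero])
  refine ⟨L.re, (((Complex.continuous_re.tendsto L).comp hL).comp (tendsto_add_atTop_nat 1)).congr
    fun x ↦ ?_⟩
  have hcast (p : ℕ) : (centeredZ b m S (p : ZMod m) : ℂ) / p
      = ((centeredZ b m S (p : ZMod m) / (p : ℝ) : ℝ) : ℂ) := by
    push_cast
    rfl
  simp only [Function.comp_apply, hcast]
  rw [← Complex.ofReal_sum, Complex.ofReal_re, ← filter_filter]
  symm
  refine sum_filter_of_ne fun p hp hne hdvd ↦ hne ?_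
  have hnu : ¬ IsUnit (p : ZMod m) := by
    rw [ZMod.isUnit_iff_coprime, (mem_filter.mp hp).2.coprime_iff_not_dvd, not_not, hm]
    exact dvd_pow hdvd ℓ.succ_ne_zero
  rw [centeredZ, dif_neg hnu, zero_div]
end

section
/- Fix a base b ≥ 2 and a lag ℓ ≥ 1, set m = b^(ℓ+1), and let S : (ℤ/mℤ)ˣ → ℝ satisfy S(a) + S(−a) = −1 for all units a. Let σ₀ ∈ (1/2, 1) and suppose that for every odd Dirichlet character χ mod m, the L-function L(s, χ) has no zeros with Re(s) > σ₀. Then for every real s > σ₀ there exists L ∈ ℝ such that Σ_{p ≤ x, p prime, p ∤ b} S°(p mod m)/p^s tends to L as x → ∞. -/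
section PrimeSums

open Complex Filter Set MeasureTheory Asymptotics Metric
open scoped Topology

namespace DirichletCharacter

variable {m : ℕ} [NeZero m]

lemma norm_sum_Icc_le {χ : DirichletCharacter ℂ m} (hχ : χ ≠ 1) (n : ℕ) :
    ‖∑ k ∈ Finset.Icc 1 n, χ k‖ ≤ m := by
  have hper : ∀ j : ℕ, ∑ k ∈ Finset.range m, χ ((j + k : ℕ) : ZMod m) = 0 := by
    intro j
    rw [← MulChar.sum_eq_zero_of_ne_one hχ, ← Equiv.sum_comp (Equiv.addLeft (j : ZMod m)) χ]
    refine Finset.sum_bij (fun k _ ↦ (k : ZMod m)) (fun _ _ ↦ Finset.mem_univ _) ?_ ?_ ?_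
    · intro a ha b hb hab
      rw [ZMod.natCast_eq_natCast_iff'] at hab
      rwa [Nat.mod_eq_of_lt (Finset.mem_range.mp ha),
        Nat.mod_eq_of_lt (Finset.mem_range.mp hb)] at hab
    · intro b _
      exact ⟨b.val, Finset.mem_range.mpr b.val_lt, by simp⟩
    · intro a _
      simp
  have hq : ∀ q r : ℕ, ∑ k ∈ Finset.range (r + m * q), χ ((1 + k : ℕ) : ZMod m) =
      ∑ k ∈ Finset.range r, χ ((1 + k : ℕ) : ZMod m) := by
    intro q r
    induction q with
    | zero => simp
    | succ q ih =>
      rw [Nat.mul_succ, ← add_assoc, Finset.sum_range_add, ih]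
      simpa [add_assoc] using hper (1 + (r + m * q))
  have h1 : ∑ k ∈ Finset.Icc 1 n, χ k = ∑ k ∈ Finset.range n, χ ((1 + k : ℕ) : ZMod m) := by
    rw [← Finset.Ico_add_one_right_eq_Icc, Finset.sum_Ico_eq_sum_range]
    simp
  rw [h1, ← Nat.mod_add_div n m, hq]
  calc _ ≤ ∑ k ∈ Finset.range (n % m), (1 : ℝ) :=
        norm_sum_le_of_le _ fun k _ ↦ χ.norm_le_one _
    _ ≤ m := by
        simpa using (Nat.mod_lt n (NeZero.pos m)).le

lemma norm_LFunction_le {χ : DirichletCharacter ℂ m} (hχ : χ ≠ 1) {δ : ℝ} (hδ : 0 < δ)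
    {s : ℂ} (hs : δ ≤ s.re) : ‖χ.LFunction s‖ ≤ m / δ * ‖s‖ := by
  set A : ℝ → ℂ := fun t ↦ ∑ k ∈ Finset.Icc 1 ⌊t⌋₊, χ k with hA
  set g : ℝ → ℂ := (Ioi 1).indicator A with hg
  have hAb : ∀ t, ‖A t‖ ≤ m := fun t ↦ norm_sum_Icc_le hχ _
  have hmel : ∀ z : ℂ, mellin g (-z) = ∫ t in Ioi (1 : ℝ), A t * (t : ℂ) ^ (-(z + 1)) := by
    intro z
    have : (fun t : ℝ ↦ (t : ℂ) ^ (-z - 1) • g t) =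
        (Ioi 1).indicator (fun t : ℝ ↦ A t * (t : ℂ) ^ (-(z + 1))) := by
      ext t
      by_cases ht : t ∈ Ioi (1 : ℝ)
      · simp only [hg, indicator_of_mem ht, smul_eq_mul, mul_comm]
        ring_nf
      · simp [hg, indicator_of_notMem ht]
    rw [mellin, this, setIntegral_indicator measurableSet_Ioi,
      inter_eq_right.mpr (Ioi_subset_Ioi zero_le_one)]
  have hAmeas : Measurable A :=
    (measurable_from_nat (f := fun n : ℕ ↦ ∑ k ∈ Finset.Icc 1 n, χ k)).comp Nat.measurable_floor
  have hgb : ∀ t, ‖g t‖ ≤ m := fun t ↦ (norm_indicator_le_norm_self _ _).trans (hAb t)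
  have hgloc : LocallyIntegrableOn g (Ioi 0) := by
    refine LocallyIntegrable.locallyIntegrableOn ?_ _
    refine (locallyIntegrable_const (m : ℝ)).mono
      (hAmeas.indicator measurableSet_Ioi).aestronglyMeasurable (.of_forall fun t ↦ ?_)
    simpa using hgb t
  have hdiff : ∀ z : ℂ, 0 < z.re → DifferentiableAt ℂ (fun z ↦ z * mellin g (-z)) z := by
    intro z hz
    have h1 : DifferentiableAt ℂ (mellin g) (-z) := by
      refine mellin_differentiableAt_of_isBigO_rpow (a := 0) (b := -z.re - 1) hgloc ?_ (by simpa)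
        ?_ (by simp)
      · refine IsBigO.of_bound m (.of_forall fun t ↦ ?_)
        simpa using hgb t
      · refine (isBigO_zero _ _).congr' ?_ .rfl
        filter_upwards [nhdsWithin_le_nhds (Iio_mem_nhds (zero_lt_one' ℝ))] with t ht
        exact (indicator_of_notMem (by simpa using (mem_Iio.mp ht).le) _).symm
    exact differentiableAt_id.mul (h1.comp z differentiableAt_id.neg)
  have hopen : IsOpen {z : ℂ | 0 < z.re} := isOpen_lt continuous_const continuous_re
  have heq : EqOn χ.LFunction (fun z ↦ z * mellin g (-z)) {z : ℂ | 0 < z.re} := by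
    refine AnalyticOnNhd.eqOn_of_preconnected_of_eventuallyEq (z₀ := 2)
      ((differentiable_LFunction hχ).differentiableOn.analyticOnNhd hopen)
      (DifferentiableOn.analyticOnNhd
        (fun z hz ↦ (hdiff z hz).differentiableWithinAt) hopen)
      (convex_halfSpace_re_gt 0).isPreconnected (by simp) ?_
    filter_upwards [(isOpen_lt continuous_const continuous_re).mem_nhds
      (show (2 : ℂ) ∈ {z : ℂ | 1 < z.re} by simp)] with z hz
    have hz' : 1 < z.re := hz
    rw [LFunction_eq_LSeries χ hz', LSeries_eq_mul_integral _ le_rfl (by linarith)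
      (LSeriesSummable_of_one_lt_re χ hz'), hmel]
    refine IsBigO.of_bound m (.of_forall fun n ↦ ?_)
    simpa using norm_sum_Icc_le hχ n
  have hs0 : 0 < s.re := hδ.trans_le hs
  rw [heq hs0, norm_mul, mul_comm]
  gcongr
  rw [hmel]
  calc _ ≤ ∫ t in Ioi (1 : ℝ), m * t ^ (-(s.re + 1)) := by
        refine norm_integral_le_of_norm_le ((integrableOn_Ioi_rpow_of_lt (by linarith)
          zero_lt_one).const_mul _) ?_
        refine (ae_restrict_mem measurableSet_Ioi).mono fun t ht ↦ ?_
        have ht0 : (0 : ℝ) < t := zero_lt_one.trans ht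
        rw [norm_mul, norm_cpow_eq_rpow_re_of_pos ht0]
        simp only [neg_re, add_re, one_re]
        gcongr
        exact hAb t
    _ = m / s.re := by
        rw [integral_const_mul, integral_Ioi_rpow_of_lt (by linarith) zero_lt_one]
        simp [div_eq_mul_inv, neg_add_rev]
    _ ≤ m / δ := by gcongr

end DirichletCharacter

/-- A holomorphic function without zeros on a disc, whose modulus there is at most `exp M` times
its modulus at the centre, has logarithmic derivative bounded by a multiple of `M`. -/
lemma norm_logDeriv_le_of_norm_le {f : ℂ → ℂ} {c z : ℂ} {r R M : ℝ} (hr : 0 ≤ r) (hrR : r < R)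
    (hM : 0 < M) (hf : DifferentiableOn ℂ f (ball c R)) (h0 : ∀ w ∈ ball c R, f w ≠ 0)
    (hle : ∀ w ∈ ball c R, ‖f w‖ ≤ Real.exp M * ‖f c‖) (hz : z ∈ closedBall c r) :
    ‖deriv f z / f z‖ ≤ 8 * R / (R - r) ^ 2 * M := by
  have hR : 0 < R := hr.trans_lt hrR
  have hcR : c ∈ ball c R := mem_ball_self hR
  have hd : ∀ w ∈ ball c R, DifferentiableAt ℂ f w := fun w hw ↦
    hf.differentiableAt (isOpen_ball.mem_nhds hw)
  have hdf : DifferentiableOn ℂ (fun w ↦ deriv f w / f w) (ball c R) :=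
    (hf.deriv isOpen_ball).div hf h0
  obtain ⟨g, hgc, hg⟩ := hdf.isExactOn_ball.with_val_at c 0
  have hgd : DifferentiableOn ℂ g (ball c R) := fun w hw ↦
    (hg w hw).differentiableAt.differentiableWithinAt
  have hexp : ∀ w ∈ ball c R, f w = f c * exp (g w) := by
    have hder : ∀ w ∈ ball c R, HasDerivAt (fun w ↦ f w * exp (-g w)) 0 w := by
      intro w hw
      refine ((hd w hw).hasDerivAt.mul (hg w hw).neg.cexp).congr_deriv ?_
      have := h0 w hw
      field_simp
      ring
    intro w hw
    have hconst := isOpen_ball.is_const_of_deriv_eq_zero (convex_ball c R).isPreconnected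
      (fun w hw ↦ (hder w hw).differentiableAt.differentiableWithinAt)
      (fun w hw ↦ (hder w hw).deriv) hw hcR
    simp only [hgc, neg_zero, Complex.exp_zero, mul_one] at hconst
    rw [← hconst, mul_assoc, ← Complex.exp_add]
    simp
  have hre : ∀ w ∈ ball c R, (g w).re ≤ M := by
    intro w hw
    have h := hle w hw
    rw [hexp w hw, norm_mul, norm_exp, mul_comm] at h
    exact Real.exp_le_exp.mp (le_of_mul_le_mul_right h (norm_pos_iff.mpr (h0 c hcR)))
  have hshift : ∀ w ∈ ball (0 : ℂ) R, c + w ∈ ball c R := fun w hw ↦ by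
    simpa using hw
  have hbound : ∀ w, dist w c ≤ (r + R) / 2 → ‖g w‖ ≤ 4 * R / (R - r) * M := by
    intro w hw
    have hw' : ‖w - c‖ ≤ (r + R) / 2 := by rwa [← dist_eq_norm]
    have hwR : ‖w - c‖ < R := by linarith
    have h := borelCaratheodory_zero (f := fun u ↦ g (c + u)) (z := w - c) hM
      (hgd.comp ((differentiable_id.const_add c).differentiableOn) hshift)
      (fun u hu ↦ hre _ (hshift u hu)) hR (by simpa using hwR) (by simpa using hgc)
    simp only [add_sub_cancel] at h
    refine h.trans ?_
    have h1 : 0 < R - ‖w - c‖ := by linarith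
    have h2 : 0 < R - r := by linarith
    calc _ ≤ 2 * M * R / ((R - r) / 2) := by
          gcongr
          linarith
      _ = _ := by field_simp; ring
  have hzc : dist z c ≤ r := hz
  have hρ : 0 < (R - r) / 2 := by linarith
  have hsub : ∀ w ∈ closedBall z ((R - r) / 2), dist w c ≤ (r + R) / 2 := by
    intro w hw
    linarith [dist_triangle w z c, mem_closedBall.mp hw]
  have hcauchy := norm_deriv_le_of_forall_mem_sphere_norm_le (f := g) (c := z) hρ
    (DifferentiableOn.diffContOnCl (by
      rw [closure_ball _ hρ.ne']
      exact hgd.mono fun w hw ↦ mem_ball.mpr (by linarith [hsub w hw])))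
    (fun w hw ↦ hbound w (hsub w (sphere_subset_closedBall hw)))
  rw [(hg z (mem_ball.mpr (by linarith))).deriv] at hcauchy
  refine hcauchy.trans_eq ?_
  have h2 : R - r ≠ 0 := by linarith
  field_simp
  ring

/-- A function holomorphic on a vertical strip with enough decay has the same integral along both
edges of the strip. -/
lemma integral_vertical_eq_of_norm_le {G : ℂ → ℂ} {σ₁ σ₂ B p : ℝ} (hσ : σ₁ ≤ σ₂) (hp : 1 < p)
    (hG : DifferentiableOn ℂ G (re ⁻¹' Icc σ₁ σ₂))
    (hB : ∀ z ∈ re ⁻¹' Icc σ₁ σ₂, ‖G z‖ ≤ B * (1 + |z.im|) ^ (-p)) :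
    ∫ t : ℝ, G (σ₁ + t * I) = ∫ t : ℝ, G (σ₂ + t * I) := by
  have hmem : ∀ σ ∈ Icc σ₁ σ₂, ∀ t : ℝ, (σ + t * I : ℂ) ∈ re ⁻¹' Icc σ₁ σ₂ := by
    intro σ hσ t
    simpa using hσ
  have hint : ∀ σ ∈ Icc σ₁ σ₂, Integrable (fun t : ℝ ↦ G (σ + t * I)) := by
    intro σ hσ
    have hdom : Integrable (fun t : ℝ ↦ B * (1 + ‖t‖) ^ (-p)) :=
      (integrable_one_add_norm (by simpa using hp)).const_mul B
    refine hdom.mono' ?_ (.of_forall fun t ↦ by simpa using hB _ (hmem σ hσ t))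
    refine Continuous.aestronglyMeasurable ?_
    exact hG.continuousOn.comp_continuous (by fun_prop) (hmem σ hσ)
  have hlim : ∀ σ ∈ Icc σ₁ σ₂, Tendsto (fun T : ℝ ↦ ∫ t in (-T)..T, G (σ + t * I)) atTop
      (𝓝 (∫ t : ℝ, G (σ + t * I))) := fun σ hσ ↦
    intervalIntegral_tendsto_integral (hint σ hσ) tendsto_neg_atTop_atBot tendsto_id
  have hdecay : Tendsto (fun T : ℝ ↦ B * (1 + |T|) ^ (-p) * |σ₂ - σ₁|) atTop (𝓝 0) := by
    have h1 : Tendsto (fun T : ℝ ↦ 1 + |T|) atTop atTop :=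
      tendsto_atTop_add_const_left _ _ tendsto_abs_atTop_atTop
    simpa using (((tendsto_rpow_neg_atTop (by linarith : 0 < p)).comp h1).const_mul B).mul_const
      |σ₂ - σ₁|
  have hhor : ∀ ε : ℝ, |ε| = 1 → Tendsto (fun T : ℝ ↦
      ∫ x in σ₁..σ₂, G (x + (ε * T : ℝ) * I)) atTop (𝓝 0) := by
    intro ε hε
    refine squeeze_zero_norm (fun T ↦ ?_) hdecay
    refine intervalIntegral.norm_integral_le_of_norm_le_const fun x hx ↦ ?_
    rw [uIoc_of_le hσ] at hx
    simpa [abs_mul, hε] using hB _ (hmem x ⟨hx.1.le, hx.2⟩ (ε * T))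
  have hrect : ∀ T : ℝ, (∫ x in σ₁..σ₂, G (x + ((-1) * T : ℝ) * I)) -
      (∫ x in σ₁..σ₂, G (x + (1 * T : ℝ) * I)) +
      I • (∫ t in (-T)..T, G (σ₂ + t * I)) - I • (∫ t in (-T)..T, G (σ₁ + t * I)) = 0 := by
    intro T
    have := integral_boundary_rect_eq_zero_of_differentiableOn G (σ₁ + (-T : ℝ) * I)
      (σ₂ + T * I) (hG.mono fun z hz ↦ by
        have := (mem_reProdIm.mp hz).1
        simpa [uIcc_of_le hσ] using this)
    simpa using this
  have htot := (((hhor (-1) (by simp)).sub (hhor 1 (by simp))).add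
    ((hlim σ₂ (right_mem_Icc.mpr hσ)).const_smul I)).sub
      ((hlim σ₁ (left_mem_Icc.mpr hσ)).const_smul I)
  simp only [hrect] at htot
  have h0 := tendsto_nhds_unique htot tendsto_const_nhds
  simp only [sub_self, zero_add, smul_eq_mul, ← mul_sub, mul_eq_zero, I_ne_zero, false_or] at h0
  exact (sub_eq_zero.mp h0).symm

namespace DirichletCharacter

variable {m : ℕ} [NeZero m]

lemma exists_le_norm_LFunction_two (χ : DirichletCharacter ℂ m) :
    ∃ c > 0, ∀ t : ℝ, c ≤ ‖χ.LFunction (2 + t * I)‖ := by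
  set Q : ℝ := ∑' n, ‖LSeries.term 1 2 n‖ with hQ
  have hQs : Summable fun n ↦ ‖LSeries.term 1 2 n‖ :=
    (LSeriesSummable_one_iff.mpr (by simp : 1 < (2 : ℂ).re)).norm
  have hQ0 : 0 ≤ Q := tsum_nonneg fun _ ↦ norm_nonneg _
  refine ⟨1 / (Q + 1), by positivity, fun t ↦ ?_⟩
  have hre : 1 < (2 + t * I : ℂ).re := by simp
  rw [LFunction_eq_LSeries χ hre, div_le_iff₀ (by positivity)]
  have h1 := congrArg norm (LSeries.mul_mu_eq_one χ hre)
  rw [norm_mul, norm_one] at h1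
  refine h1.symm.le.trans ?_
  gcongr
  have hle : ∀ n, ‖LSeries.term ((fun n : ℕ ↦ χ n) * fun n ↦ (ArithmeticFunction.moebius n : ℂ))
      (2 + t * I) n‖ ≤ ‖LSeries.term 1 2 n‖ := by
    intro n
    rw [LSeries.norm_term_eq, LSeries.norm_term_eq]
    split_ifs with hn
    · rfl
    · have h2 : ‖(ArithmeticFunction.moebius n : ℂ)‖ ≤ 1 := by
        rw [norm_intCast]
        exact_mod_cast ArithmeticFunction.abs_moebius_le_one
      have h3 := mul_le_one₀ (χ.norm_le_one n) (norm_nonneg _) h2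
      simp only [Pi.mul_apply, norm_mul, Pi.one_apply, norm_one, add_re, re_ofNat, mul_re,
        ofReal_re, I_re, mul_zero, ofReal_im, I_im, mul_one, sub_self, add_zero]
      gcongr
  calc _ ≤ Q := tsum_of_norm_bounded hQs.hasSum hle
    _ ≤ Q + 1 := by linarith

lemma exists_norm_logDeriv_LFunction_le {χ : DirichletCharacter ℂ m} (hχ : χ ≠ 1)
    {σ₀ σ₁ η : ℝ} (hσ₀ : 0 < σ₀) (hσ₁ : σ₀ < σ₁) (hσ₂ : σ₁ ≤ 2) (hη : 0 < η)
    (hzero : ∀ z : ℂ, σ₀ < z.re → χ.LFunction z ≠ 0) :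
    ∃ C, 0 ≤ C ∧ ∀ z : ℂ, σ₁ ≤ z.re → z.re ≤ 2 →
      ‖deriv χ.LFunction z / χ.LFunction z‖ ≤ C * (1 + |z.im|) ^ η := by
  obtain ⟨c, hc, hcL⟩ := exists_le_norm_LFunction_two χ
  set K : ℝ := 4 * (m / σ₀) / c + 1 with hK
  have hK1 : 1 ≤ K := by
    rw [hK]
    have : 0 ≤ 4 * (m / σ₀) / c := by positivity
    linarith
  have hlogK : 0 ≤ Real.log K := Real.log_nonneg hK1
  have hR : 0 < 2 - σ₀ := by linarith
  refine ⟨8 * (2 - σ₀) / ((2 - σ₀) - (2 - σ₁)) ^ 2 * (Real.log K + 1 / η), by positivity,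
    fun z hz₁ hz₂ ↦ ?_⟩
  set t := z.im with ht
  have ht1 : 1 ≤ 1 + |t| := by linarith [abs_nonneg t]
  have htη : 1 ≤ (1 + |t|) ^ η := Real.one_le_rpow ht1 hη.le
  rw [mul_assoc]
  have hball : ∀ w ∈ ball (2 + t * I : ℂ) (2 - σ₀), σ₀ < w.re := by
    intro w hw
    have h1 := (abs_re_le_norm (w - (2 + t * I))).trans_lt (mem_ball_iff_norm.mp hw)
    have h2 := (abs_lt.mp h1).1
    simp at h2
    linarith
  refine norm_logDeriv_le_of_norm_le (c := 2 + t * I) (by linarith) (by linarith) (by positivity)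
    (differentiable_LFunction hχ).differentiableOn (fun w hw ↦ hzero w (hball w hw))
    (fun w hw ↦ ?_) ?_
  · have hw1 : ‖w‖ ≤ 4 * (1 + |t|) := by
      have h1 : ‖w‖ ≤ ‖w - (2 + t * I)‖ + ‖(2 + t * I : ℂ)‖ := by
        simpa using norm_add_le (w - (2 + t * I)) (2 + t * I)
      have h2 : ‖(2 + t * I : ℂ)‖ ≤ 2 + |t| := (norm_add_le _ _).trans (by simp)
      have h3 := mem_ball_iff_norm.mp hw
      linarith [abs_nonneg t]
    have hlog : Real.log K + Real.log (1 + |t|) ≤ (Real.log K + 1 / η) * (1 + |t|) ^ η := by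
      have h1 := Real.log_le_rpow_div (by linarith : 0 ≤ 1 + |t|) hη
      have h2 := mul_le_mul_of_nonneg_left htη hlogK
      rw [add_mul, one_div_mul_eq_div]
      linarith
    calc ‖χ.LFunction w‖ ≤ m / σ₀ * ‖w‖ := norm_LFunction_le hχ hσ₀ (hball w hw).le
      _ ≤ m / σ₀ * (4 * (1 + |t|)) := by gcongr
      _ = (4 * (m / σ₀) / c) * (1 + |t|) * c := by field_simp
      _ ≤ K * (1 + |t|) * ‖χ.LFunction (2 + t * I)‖ := by
          gcongr
          · linarith
          · exact hcL t
      _ = Real.exp (Real.log K + Real.log (1 + |t|)) * ‖χ.LFunction (2 + t * I)‖ := by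
          rw [Real.exp_add, Real.exp_log (by linarith), Real.exp_log (by linarith)]
      _ ≤ _ := by gcongr
  · have h1 : z - (2 + t * I) = ((z.re - 2 : ℝ) : ℂ) := by
      apply Complex.ext <;> simp [ht]
    rw [mem_closedBall_iff_norm, h1, norm_real, Real.norm_eq_abs, abs_le]
    constructor <;> linarith

end DirichletCharacter

/-- The Mellin transform of `u ↦ max (N + 1 - u) 0 - max (N - u) 0`. -/
noncomputable def perronKernel (N : ℕ) (s : ℂ) : ℂ :=
  (((N + 1 : ℝ) : ℂ) ^ (s + 1) - ((N : ℝ) : ℂ) ^ (s + 1)) / (s * (s + 1))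

lemma one_add_abs_im_le {z : ℂ} (hz : 1 / 2 ≤ z.re) : 1 + |z.im| ≤ 3 * ‖z‖ := by
  linarith [abs_im_le_norm z, re_le_norm z]

lemma norm_perronKernel_le {N : ℕ} (hN : 1 ≤ N) {θ : ℝ} (hθ₀ : 0 ≤ θ) (hθ₁ : θ ≤ 1) {s : ℂ}
    (hs : 1 / 2 ≤ s.re) :
    ‖perronKernel N s‖ ≤ 18 * (N + 1 : ℝ) ^ (s.re + θ) * (1 + |s.im|) ^ (-(1 + θ)) := by
  have hN0 : (0 : ℝ) < N := by exact_mod_cast hN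
  set X : ℝ := N + 1 with hX
  have hX0 : 0 < X := by linarith
  set τ : ℝ := 1 + |s.im| with hτ
  have hτ0 : 0 < τ := by positivity
  have hs1 : τ ≤ 3 * ‖s‖ := one_add_abs_im_le hs
  have hs2 : τ ≤ 3 * ‖s + 1‖ := by
    simpa using one_add_abs_im_le (z := s + 1) (by simp; linarith)
  have hsn : 0 < ‖s‖ := by linarith
  have hsn' : 0 < ‖s + 1‖ := by linarith
  set a : ℝ := ‖(X : ℂ) ^ (s + 1) - ((N : ℝ) : ℂ) ^ (s + 1)‖ with ha
  have ha1 : a ≤ ‖s + 1‖ * X ^ s.re := by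
    have hder : ∀ y ∈ Icc (N : ℝ) X,
        HasDerivAt (fun y : ℝ ↦ (y : ℂ) ^ (s + 1)) ((s + 1) * (y : ℂ) ^ s) y := by
      intro y hy
      simpa using hasDerivAt_ofReal_cpow_const (hN0.trans_le hy.1).ne' (norm_pos_iff.mp hsn')
    have := (convex_Icc (N : ℝ) X).norm_image_sub_le_of_norm_deriv_le
      (f := fun y : ℝ ↦ (y : ℂ) ^ (s + 1)) (C := ‖s + 1‖ * X ^ s.re)
      (fun y hy ↦ (hder y hy).differentiableAt) (fun y hy ↦ ?_)
      (left_mem_Icc.mpr (by linarith)) (right_mem_Icc.mpr (by linarith))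
    · simpa [ha, hX] using this
    · have hy0 : 0 < y := hN0.trans_le hy.1
      rw [(hder y hy).deriv, norm_mul, norm_cpow_eq_rpow_re_of_pos hy0]
      gcongr
      exact hy.2
  have ha2 : a ≤ 2 * X ^ (s.re + 1) := by
    refine (norm_sub_le _ _).trans ?_
    rw [norm_cpow_eq_rpow_re_of_pos hX0, norm_cpow_eq_rpow_re_of_pos hN0, two_mul]
    simp only [add_re, one_re]
    gcongr
    linarith
  have ha0 : 0 ≤ a := norm_nonneg _
  have hinterp : a ≤ 2 * X ^ (s.re + θ) * ‖s + 1‖ ^ (1 - θ) := by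
    calc a = a ^ (1 - θ) * a ^ θ := by
          rw [← Real.rpow_add_of_nonneg ha0 (by linarith) hθ₀]; simp
      _ ≤ (‖s + 1‖ * X ^ s.re) ^ (1 - θ) * (2 * X ^ (s.re + 1)) ^ θ := by
          gcongr
      _ = 2 ^ θ * (X ^ (s.re * (1 - θ)) * X ^ ((s.re + 1) * θ)) * ‖s + 1‖ ^ (1 - θ) := by
          rw [Real.mul_rpow (by positivity) (by positivity),
            Real.mul_rpow (by positivity) (by positivity), ← Real.rpow_mul hX0.le,
            ← Real.rpow_mul hX0.le]
          ring
      _ = 2 ^ θ * X ^ (s.re + θ) * ‖s + 1‖ ^ (1 - θ) := by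
          rw [← Real.rpow_add hX0]
          ring_nf
      _ ≤ _ := by
          gcongr
          simpa using Real.rpow_le_rpow_of_exponent_le (one_le_two) hθ₁
  have hden : τ ^ (1 + θ) ≤ 9 * (‖s‖ * ‖s + 1‖ ^ θ) := by
    calc τ ^ (1 + θ) = τ * τ ^ θ := by rw [Real.rpow_add hτ0, Real.rpow_one]
      _ ≤ (3 * ‖s‖) * (3 * ‖s + 1‖) ^ θ := by gcongr
      _ = 3 * 3 ^ θ * (‖s‖ * ‖s + 1‖ ^ θ) := by
          rw [Real.mul_rpow (by norm_num) (norm_nonneg _)]; ring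
      _ ≤ 3 * 3 * (‖s‖ * ‖s + 1‖ ^ θ) := by
          gcongr
          simpa using Real.rpow_le_rpow_of_exponent_le (by norm_num : (1 : ℝ) ≤ 3) hθ₁
      _ = _ := by ring
  have hsplit : ‖s + 1‖ ^ (1 - θ) * ‖s + 1‖ ^ θ = ‖s + 1‖ := by
    rw [← Real.rpow_add hsn']; simp
  rw [perronKernel, norm_div, norm_mul, div_le_iff₀ (by positivity), Real.rpow_neg hτ0.le]
  refine hinterp.trans ?_
  rw [← div_eq_mul_inv, div_mul_eq_mul_div, le_div_iff₀ (by positivity)]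
  calc _ ≤ 2 * X ^ (s.re + θ) * ‖s + 1‖ ^ (1 - θ) * (9 * (‖s‖ * ‖s + 1‖ ^ θ)) := by gcongr
    _ = 18 * X ^ (s.re + θ) * (‖s‖ * (‖s + 1‖ ^ (1 - θ) * ‖s + 1‖ ^ θ)) := by ring
    _ = _ := by rw [hsplit]

lemma differentiableAt_perronKernel {N : ℕ} (hN : 1 ≤ N) {s : ℂ} (hs : 0 < s.re) :
    DifferentiableAt ℂ (perronKernel N) s := by
  have hN0 : ((N : ℝ) : ℂ) ≠ 0 := by
    exact_mod_cast (by omega : N ≠ 0)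
  have hX0 : ((N + 1 : ℝ) : ℂ) ≠ 0 := by
    exact_mod_cast (by omega : N + 1 ≠ 0)
  have h1 : s ≠ 0 := fun h ↦ by simp [h] at hs
  have h2 : s + 1 ≠ 0 := fun h ↦ by
    have := congrArg re h
    simp at this
    linarith
  have hlin : DifferentiableAt ℂ (fun z : ℂ ↦ z + 1) s := by fun_prop
  exact ((hlin.const_cpow (.inl hX0)).sub (hlin.const_cpow (.inl hN0))).div
    (differentiableAt_id.mul hlin) (mul_ne_zero h1 h2)

lemma hasMellin_max_sub {X : ℝ} (hX : 0 < X) {s : ℂ} (hs : 0 < s.re) :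
    HasMellin (fun u : ℝ ↦ ((max (X - u) 0 : ℝ) : ℂ)) s ((X : ℂ) ^ (s + 1) / (s * (s + 1))) := by
  have h1 := hasMellin_one_Ioc hs
  have h2 := hasMellin_cpow_Ioc 1 (s := s) (by simp; linarith)
  have h3 := hasMellin_sub h1.1 h2.1
  rw [h1.2, h2.2] at h3
  have hX' : (X : ℂ) ≠ 0 := by exact_mod_cast hX.ne'
  have hs0 : s ≠ 0 := fun h ↦ by simp [h] at hs
  have hs1 : s + 1 ≠ 0 := fun h ↦ by
    have := congrArg re h
    simp at this
    linarith
  have hcongr : ∀ u ∈ Ioi (0 : ℝ), ((max (X - u) 0 : ℝ) : ℂ) =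
      (X : ℂ) • ((Ioc (0 : ℝ) 1).indicator (fun _ ↦ (1 : ℂ)) (X⁻¹ * u) -
        (Ioc (0 : ℝ) 1).indicator (fun t : ℝ ↦ (t : ℂ) ^ (1 : ℂ)) (X⁻¹ * u)) := by
    intro u hu
    have hu0 : 0 < u := hu
    by_cases h : u ≤ X
    · have hmem : X⁻¹ * u ∈ Ioc (0 : ℝ) 1 :=
        ⟨by positivity, by rw [inv_mul_le_iff₀ hX]; simpa using h⟩
      rw [indicator_of_mem hmem, indicator_of_mem hmem, max_eq_left (by linarith)]
      push_cast
      simp only [cpow_one, smul_eq_mul]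
      field_simp
    · have hmem : X⁻¹ * u ∉ Ioc (0 : ℝ) 1 := fun hm ↦ h (by
        have := hm.2
        rw [inv_mul_le_iff₀ hX] at this
        simpa using this)
      rw [indicator_of_notMem hmem, indicator_of_notMem hmem, max_eq_right (by linarith)]
      simp
  have hX1 : 0 < X⁻¹ := by positivity
  have h4 := ((MellinConvergent.comp_mul_left (s := s) hX1).mpr h3.1).const_smul (X : ℂ)
  refine ⟨?_, ?_⟩
  · refine IntegrableOn.congr_fun h4 (fun u hu ↦ ?_) measurableSet_Ioi
    simp only [hcongr u hu]
  · have : mellin (fun u : ℝ ↦ ((max (X - u) 0 : ℝ) : ℂ)) s = mellin (fun u : ℝ ↦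
      (X : ℂ) • ((Ioc (0 : ℝ) 1).indicator (fun _ ↦ (1 : ℂ)) (X⁻¹ * u) -
        (Ioc (0 : ℝ) 1).indicator (fun t : ℝ ↦ (t : ℂ) ^ (1 : ℂ)) (X⁻¹ * u))) s :=
      setIntegral_congr_fun measurableSet_Ioi fun u hu ↦ by simp only [hcongr u hu]
    rw [this, mellin_const_smul,
      mellin_comp_mul_left (fun t : ℝ ↦ (Ioc (0 : ℝ) 1).indicator (fun _ ↦ (1 : ℂ)) t -
        (Ioc (0 : ℝ) 1).indicator (fun t : ℝ ↦ (t : ℂ) ^ (1 : ℂ)) t) _ hX1, h3.2,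
      ofReal_inv, inv_cpow _ _ (by
      rw [arg_ofReal_of_nonneg hX.le]; exact Real.pi_pos.ne), cpow_neg, inv_inv,
      cpow_add _ _ hX', cpow_one, smul_eq_mul, smul_eq_mul]
    field_simp
    ring

lemma integrable_vertical_perronKernel {N : ℕ} (hN : 1 ≤ N) {σ : ℝ} (hσ : 1 / 2 ≤ σ) :
    Integrable fun t : ℝ ↦ perronKernel N (σ + t * I) := by
  have hdom : Integrable (fun t : ℝ ↦ 18 * (N + 1 : ℝ) ^ (σ + 1) * (1 + ‖t‖) ^ (-(1 + 1 : ℝ))) :=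
    (integrable_one_add_norm (by norm_num)).const_mul _
  refine hdom.mono' (Continuous.aestronglyMeasurable ?_) (.of_forall fun t ↦ ?_)
  · rw [continuous_iff_continuousAt]
    intro t
    exact ContinuousAt.comp (f := fun t : ℝ ↦ (σ + t * I : ℂ))
      (differentiableAt_perronKernel hN (by simp; linarith)).continuousAt (by fun_prop)
  · simpa using norm_perronKernel_le hN zero_le_one le_rfl (s := σ + t * I) (by simpa using hσ)

/-- Perron's formula for a single integer `n`, with the exact cutoff `n ≤ N`. -/
lemma integral_perronKernel_mul_cpow {N n : ℕ} (hN : 1 ≤ N) (hn : n ≠ 0) {σ : ℝ}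
    (hσ : 1 / 2 ≤ σ) :
    ∫ t : ℝ, (n : ℂ) ^ (-(σ + t * I : ℂ)) * perronKernel N (σ + t * I) =
      if n ≤ N then (2 * Real.pi : ℂ) else 0 := by
  have hN0 : (0 : ℝ) < N := by exact_mod_cast hN
  have hn0 : (0 : ℝ) < n := by exact_mod_cast Nat.pos_of_ne_zero hn
  set k : ℝ → ℂ := fun u ↦ ((max (N + 1 - u) 0 : ℝ) : ℂ) - ((max (N - u) 0 : ℝ) : ℂ) with hk
  have hmel : ∀ s : ℂ, 0 < s.re → HasMellin k s (perronKernel N s) := by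
    intro s hs
    have h1 := hasMellin_max_sub (X := N + 1) (by linarith) hs
    have h2 := hasMellin_max_sub hN0 hs
    have h3 := hasMellin_sub h1.1 h2.1
    rw [h1.2, h2.2, ← sub_div] at h3
    exact h3
  have hvert : ∀ t : ℝ, mellin k (σ + t * I) = perronKernel N (σ + t * I) := fun t ↦
    (hmel _ (by simp; linarith)).2
  have hinv := mellinInv_mellin_eq σ k hn0 (hmel σ (by simp; linarith)).1
    (by simpa only [VerticalIntegrable, hvert] using integrable_vertical_perronKernel hN hσ)
    (by fun_prop)
  have hkn : k n = if n ≤ N then 1 else 0 := by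
    simp only [hk]
    split_ifs with h
    · have h' : (n : ℝ) ≤ N := by exact_mod_cast h
      rw [max_eq_left (by linarith), max_eq_left (by linarith)]
      push_cast
      ring
    · have h' : (N + 1 : ℝ) ≤ n := by exact_mod_cast (by omega : N + 1 ≤ n)
      rw [max_eq_right (by linarith), max_eq_right (by linarith)]
      simp
  simp only [mellinInv, hvert, smul_eq_mul, real_smul, hkn, ofReal_natCast] at hinv
  push_cast at hinv
  rw [one_div, inv_mul_eq_iff_eq_mul₀ (by simp)] at hinv
  rw [hinv]
  split_ifs <;> simp

namespace DirichletCharacter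

variable {m : ℕ} [NeZero m]

lemma integral_vertical_two_eq_sum_vonMangoldt (χ : DirichletCharacter ℂ m) {N : ℕ} (hN : 1 ≤ N) :
    ∫ t : ℝ, -(deriv χ.LFunction (2 + t * I) / χ.LFunction (2 + t * I)) *
        perronKernel N (2 + t * I) =
      2 * Real.pi * ∑ n ∈ Finset.Icc 1 N, χ n * (ArithmeticFunction.vonMangoldt n : ℂ) := by
  set a : ℕ → ℂ := (fun n : ℕ ↦ χ n) * fun n ↦ (ArithmeticFunction.vonMangoldt n : ℂ) with ha
  have hre : ∀ t : ℝ, 1 < (2 + t * I : ℂ).re := fun t ↦ by simp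
  have hterm : ∀ n ≠ 0, ∀ t : ℝ, LSeries.term a (2 + t * I) n * perronKernel N (2 + t * I) =
      a n * ((n : ℂ) ^ (-(2 + t * I : ℂ)) * perronKernel N (2 + t * I)) := by
    intro n hn t
    rw [LSeries.term_of_ne_zero hn, cpow_neg]
    ring
  have hnorm : ∀ n, ∀ t : ℝ, ‖LSeries.term a (2 + t * I) n‖ = ‖LSeries.term a 2 n‖ := by
    intro n t
    simp [LSeries.norm_term_eq]
  have hK : Integrable fun t : ℝ ↦ perronKernel N (2 + t * I) := by
    simpa using integrable_vertical_perronKernel hN (σ := 2) (by norm_num)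
  have hint : ∀ n, Integrable fun t : ℝ ↦
      LSeries.term a (2 + t * I) n * perronKernel N (2 + t * I) := by
    intro n
    refine hK.bdd_mul (c := ‖LSeries.term a 2 n‖) ?_ (.of_forall fun t ↦ (hnorm n t).le)
    refine Continuous.aestronglyMeasurable ?_
    rcases eq_or_ne n 0 with rfl | hn
    · simpa using continuous_const
    · simp only [LSeries.term_of_ne_zero hn]
      have hn' : (n : ℂ) ≠ 0 := by exact_mod_cast hn
      refine continuous_const.div ?_ fun t ↦ by simp [cpow_eq_zero_iff, hn']
      exact Continuous.const_cpow (by fun_prop) (.inl hn')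
  have hsum := hasSum_integral_of_summable_integral_norm hint (by
    simp only [norm_mul, hnorm, integral_const_mul]
    exact ((LSeriesSummable_twist_vonMangoldt χ (by simp : 1 < (2 : ℂ).re)).norm).mul_right _)
  have hval : ∀ n, ∫ t : ℝ, LSeries.term a (2 + t * I) n * perronKernel N (2 + t * I) =
      if n ∈ Finset.Icc 1 N then 2 * Real.pi * a n else 0 := by
    intro n
    rcases eq_or_ne n 0 with rfl | hn
    · simp
    · simp only [hterm n hn, integral_const_mul]
      have := integral_perronKernel_mul_cpow hN hn (σ := 2) (by norm_num)
      simp only [ofReal_ofNat] at this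
      rw [this]
      have : 1 ≤ n := by omega
      simp only [Finset.mem_Icc, this, true_and]
      split_ifs <;> ring
  simp only [hval] at hsum
  have hfin := hasSum_sum_of_ne_finset_zero (s := Finset.Icc 1 N) (L := .unconditional ℕ)
    (f := fun n ↦ if n ∈ Finset.Icc 1 N then 2 * Real.pi * a n else 0)
    (fun n hn ↦ if_neg hn)
  have heq := hsum.unique hfin
  rw [Finset.sum_congr rfl fun n hn ↦ if_pos hn, ← Finset.mul_sum] at heq
  simp only [ha, Pi.mul_apply] at heq
  rw [← heq]
  refine integral_congr_ae (.of_forall fun t ↦ ?_)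
  have hL := LSeries_twist_vonMangoldt_eq χ (hre t)
  simp only [tsum_mul_right]
  rw [← neg_div, deriv_LFunction_eq_deriv_LSeries χ (hre t), LFunction_eq_LSeries χ (hre t), ← hL]
  rfl

lemma exists_norm_sum_vonMangoldt_le {χ : DirichletCharacter ℂ m} (hχ : χ ≠ 1) {σ₀ α : ℝ}
    (hσ₀ : 1 / 2 ≤ σ₀) (hα₀ : σ₀ < α) (hα₁ : α ≤ 1)
    (hzero : ∀ z : ℂ, σ₀ < z.re → χ.LFunction z ≠ 0) :
    ∃ C, ∀ N : ℕ, 1 ≤ N →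
      ‖∑ n ∈ Finset.Icc 1 N, χ n * (ArithmeticFunction.vonMangoldt n : ℂ)‖ ≤
        C * (N + 1 : ℝ) ^ α := by
  obtain ⟨θ, hθ⟩ : ∃ θ, θ = (α - σ₀) / 2 := ⟨_, rfl⟩
  obtain ⟨σ₁, hσ₁⟩ : ∃ σ₁, σ₁ = σ₀ + θ := ⟨_, rfl⟩
  have hθ₀ : 0 < θ := by linarith
  obtain ⟨C, hC₀, hC⟩ := exists_norm_logDeriv_LFunction_le hχ (η := θ / 2) (σ₁ := σ₁)
    (by linarith) (by linarith) (by linarith) (by linarith) hzero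
  set J : ℝ := ∫ t : ℝ, (1 + ‖t‖) ^ (-(1 + θ / 2)) with hJ
  have hJi : Integrable fun t : ℝ ↦ (1 + ‖t‖) ^ (-(1 + θ / 2)) :=
    integrable_one_add_norm (by simp; linarith)
  refine ⟨(2 * Real.pi)⁻¹ * (18 * C * J), fun N hN ↦ ?_⟩
  set G : ℂ → ℂ := fun z ↦ -(deriv χ.LFunction z / χ.LFunction z) * perronKernel N z with hG
  have hX : (1 : ℝ) ≤ N + 1 := by
    have : (0 : ℝ) ≤ N := N.cast_nonneg
    linarith
  have hbound : ∀ z : ℂ, σ₁ ≤ z.re → z.re ≤ 2 →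
      ‖G z‖ ≤ 18 * C * (N + 1 : ℝ) ^ (z.re + θ) * (1 + |z.im|) ^ (-(1 + θ / 2)) := by
    intro z hz₁ hz₂
    have hτ : 0 < 1 + |z.im| := by positivity
    rw [hG, norm_mul, norm_neg]
    calc _ ≤ C * (1 + |z.im|) ^ (θ / 2) *
          (18 * (N + 1 : ℝ) ^ (z.re + θ) * (1 + |z.im|) ^ (-(1 + θ))) :=
          mul_le_mul (hC z hz₁ hz₂)
            (norm_perronKernel_le hN hθ₀.le (by linarith) (by linarith))
            (norm_nonneg _) (by positivity)
      _ = 18 * C * (N + 1 : ℝ) ^ (z.re + θ) *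
          ((1 + |z.im|) ^ (θ / 2) * (1 + |z.im|) ^ (-(1 + θ))) := by ring
      _ = _ := by
          rw [← Real.rpow_add hτ]
          ring_nf
  have hdiff : DifferentiableOn ℂ G (re ⁻¹' Icc σ₁ 2) := by
    intro z hz
    have hz₁ : σ₁ ≤ z.re := hz.1
    refine DifferentiableAt.differentiableWithinAt ?_
    have hL := differentiable_LFunction hχ
    have hL' : DifferentiableAt ℂ (deriv χ.LFunction) z :=
      (hL.analyticAt z).deriv.differentiableAt
    exact (hL'.div (hL z) (hzero z (by linarith))).neg.mul
      (differentiableAt_perronKernel hN (by linarith))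
  have hshift := integral_vertical_eq_of_norm_le (p := 1 + θ / 2)
    (B := 18 * C * (N + 1 : ℝ) ^ (2 + θ)) (by linarith) (by linarith) hdiff (fun z hz ↦ by
      refine (hbound z hz.1 hz.2).trans ?_
      have : z.re ≤ 2 := hz.2
      gcongr)
  have hformula := integral_vertical_two_eq_sum_vonMangoldt χ hN
  rw [ofReal_ofNat] at hshift
  have hpi : ‖(2 * Real.pi : ℂ)‖ = 2 * Real.pi := by
    simp [abs_of_pos Real.pi_pos]
  have hmain : 2 * Real.pi *
      ‖∑ n ∈ Finset.Icc 1 N, χ n * (ArithmeticFunction.vonMangoldt n : ℂ)‖ ≤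
        18 * C * (N + 1 : ℝ) ^ α * J := by
    rw [← hpi, ← norm_mul, ← hformula, ← hshift, hJ, ← integral_const_mul]
    refine norm_integral_le_of_norm_le (hJi.const_mul _) (.of_forall fun t ↦ ?_)
    have := hbound (σ₁ + t * I) (by simp) (by simp; linarith)
    have hexp : σ₁ + θ = α := by rw [hσ₁, hθ]; ring
    simpa [hexp] using this
  rw [mul_assoc, ← div_eq_inv_mul, le_div_iff₀ (by positivity)]
  linarith

end DirichletCharacter

/-- A Dirichlet series converges to the right of the growth exponent of its partial sums. -/
lemma exists_tendsto_sum_rpow_smul {a : ℕ → ℂ} {C α s : ℝ} (hα : 0 ≤ α) (hs : α < s)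
    (ha : ∀ n : ℕ, ‖∑ i ∈ Finset.range (n + 1), a i‖ ≤ C * (n + 1 : ℝ) ^ α) :
    ∃ L : ℂ, Tendsto (fun n ↦ ∑ i ∈ Finset.range n, ((i : ℝ) ^ (-s)) • a i) atTop (𝓝 L) := by
  have hC : 0 ≤ C := by simpa using (norm_nonneg _).trans (ha 0)
  have hgrow : ∀ n : ℕ, 1 ≤ n →
      ‖∑ i ∈ Finset.range (n + 1), a i‖ ≤ C * 2 ^ α * (n : ℝ) ^ α := by
    intro n hn
    have hn' : (1 : ℝ) ≤ n := by exact_mod_cast hn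
    refine (ha n).trans ?_
    rw [mul_assoc, ← Real.mul_rpow (by norm_num) (by linarith)]
    gcongr
    linarith
  have hstep : ∀ i : ℕ, 1 ≤ i →
      |((i + 1 : ℕ) : ℝ) ^ (-s) - (i : ℝ) ^ (-s)| ≤ s * (i : ℝ) ^ (-s - 1) := by
    intro i hi
    have hi' : (1 : ℝ) ≤ i := by exact_mod_cast hi
    have hder : ∀ y ∈ Icc (i : ℝ) (i + 1),
        HasDerivAt (fun y : ℝ ↦ y ^ (-s)) (-s * y ^ (-s - 1)) y := fun y hy ↦
      Real.hasDerivAt_rpow_const (.inl (by linarith [hy.1] : 0 < y).ne')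
    have := (convex_Icc (i : ℝ) (i + 1)).norm_image_sub_le_of_norm_deriv_le
      (f := fun y : ℝ ↦ y ^ (-s)) (C := s * (i : ℝ) ^ (-s - 1))
      (fun y hy ↦ (hder y hy).differentiableAt) (fun y hy ↦ ?_)
      (left_mem_Icc.mpr (by linarith)) (right_mem_Icc.mpr (by linarith))
    · simpa using this
    · have hy0 : 0 < y := by linarith [hy.1]
      rw [(hder y hy).deriv, norm_mul, norm_neg, Real.norm_of_nonneg (by linarith),
        Real.norm_of_nonneg (by positivity)]
      exact mul_le_mul_of_nonneg_left
        (Real.rpow_le_rpow_of_nonpos (by linarith) hy.1 (by linarith)) (by linarith)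
  have hsummable : Summable fun i : ℕ ↦
      (((i + 1 : ℕ) : ℝ) ^ (-s) - (i : ℝ) ^ (-s)) • ∑ j ∈ Finset.range (i + 1), a j := by
    refine Summable.of_norm_bounded_eventually_nat
      (g := fun i : ℕ ↦ s * (C * 2 ^ α) * (i : ℝ) ^ (α - s - 1))
      ((Real.summable_nat_rpow.mpr (by linarith)).mul_left _) ?_
    filter_upwards [eventually_ge_atTop 1] with i hi
    have hi' : (0 : ℝ) < i := by exact_mod_cast hi
    rw [norm_smul, Real.norm_eq_abs]
    calc _ ≤ s * (i : ℝ) ^ (-s - 1) * (C * 2 ^ α * (i : ℝ) ^ α) :=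
          mul_le_mul (hstep i hi) (hgrow i hi) (norm_nonneg _)
            (mul_nonneg (by linarith) (by positivity))
      _ = s * (C * 2 ^ α) * ((i : ℝ) ^ (-s - 1) * (i : ℝ) ^ α) := by ring
      _ = _ := by
          rw [← Real.rpow_add hi']
          ring_nf
  have hboundary : Tendsto (fun n : ℕ ↦ ((n : ℝ) ^ (-s)) • ∑ i ∈ Finset.range (n + 1), a i)
      atTop (𝓝 0) := by
    have hlim : Tendsto (fun n : ℕ ↦ C * 2 ^ α * (n : ℝ) ^ (-(s - α))) atTop (𝓝 0) := by
      simpa using ((tendsto_rpow_neg_atTop (by linarith : 0 < s - α)).comp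
        tendsto_natCast_atTop_atTop).const_mul (C * 2 ^ α)
    refine squeeze_zero_norm' ?_ hlim
    filter_upwards [eventually_ge_atTop 1] with n hn
    have hn' : (0 : ℝ) < n := by exact_mod_cast hn
    rw [norm_smul, Real.norm_of_nonneg (by positivity)]
    calc _ ≤ (n : ℝ) ^ (-s) * (C * 2 ^ α * (n : ℝ) ^ α) := by
          gcongr
          exact hgrow n hn
      _ = C * 2 ^ α * ((n : ℝ) ^ (-s) * (n : ℝ) ^ α) := by ring
      _ = _ := by
          rw [← Real.rpow_add hn']
          ring_nf
  refine ⟨_, (tendsto_add_atTop_iff_nat 1).mp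
    ((hboundary.sub hsummable.hasSum.tendsto_sum_nat).congr fun n ↦ ?_)⟩
  rw [Finset.sum_range_by_parts (fun i : ℕ ↦ (i : ℝ) ^ (-s)) a (n + 1)]
  simp

namespace DirichletCharacter

variable {m : ℕ} [NeZero m]

lemma exists_norm_sum_prime_log_le {χ : DirichletCharacter ℂ m} (hχ : χ ≠ 1) {σ₀ α : ℝ}
    (hσ₀ : 1 / 2 ≤ σ₀) (hα₀ : σ₀ < α) (hα₁ : α ≤ 1)
    (hzero : ∀ z : ℂ, σ₀ < z.re → χ.LFunction z ≠ 0) :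
    ∃ C, ∀ N : ℕ, ‖∑ n ∈ Finset.range (N + 1), if n.Prime then χ n * (Real.log n : ℂ) else 0‖ ≤
        C * (N + 1 : ℝ) ^ α := by
  obtain ⟨C, hC⟩ := exists_norm_sum_vonMangoldt_le hχ hσ₀ hα₀ hα₁ hzero
  obtain ⟨D, hD⟩ := Chebyshev.psi_sub_theta_le_mul_sqrt
  refine ⟨|C| + |D|, fun N ↦ ?_⟩
  rcases Nat.eq_zero_or_pos N with rfl | hN
  · simp
    positivity
  have hX : (1 : ℝ) ≤ N + 1 := by
    have : (0 : ℝ) ≤ N := N.cast_nonneg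
    linarith
  have hrange : ∑ n ∈ Finset.range (N + 1), (if n.Prime then χ n * (Real.log n : ℂ) else 0) =
      ∑ n ∈ Finset.Icc 1 N, if n.Prime then χ n * (Real.log n : ℂ) else 0 := by
    rw [Finset.range_eq_Ico, Finset.sum_eq_sum_Ico_succ_bot (by omega)]
    simp [← Finset.Ico_add_one_right_eq_Icc]
  have hsplit : ∑ n ∈ Finset.Icc 1 N, (if n.Prime then χ n * (Real.log n : ℂ) else 0) =
      ∑ n ∈ Finset.Icc 1 N, χ n * (ArithmeticFunction.vonMangoldt n : ℂ) -
      ∑ n ∈ Finset.Icc 1 N with ¬ n.Prime, χ n * (ArithmeticFunction.vonMangoldt n : ℂ) := by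
    rw [Finset.sum_filter, ← Finset.sum_sub_distrib]
    refine Finset.sum_congr rfl fun n _ ↦ ?_
    by_cases hn : n.Prime
    · simp [hn, ArithmeticFunction.vonMangoldt_apply_prime hn]
    · simp [hn]
  have hrest : ‖∑ n ∈ Finset.Icc 1 N with ¬ n.Prime,
      χ n * (ArithmeticFunction.vonMangoldt n : ℂ)‖ ≤ |D| * (N + 1 : ℝ) ^ α := by
    calc _ ≤ ∑ n ∈ Finset.Icc 1 N with ¬ n.Prime, ArithmeticFunction.vonMangoldt n := by
          refine norm_sum_le_of_le _ fun n _ ↦ ?_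
          rw [norm_mul, norm_real, Real.norm_of_nonneg ArithmeticFunction.vonMangoldt_nonneg]
          exact mul_le_of_le_one_left ArithmeticFunction.vonMangoldt_nonneg (χ.norm_le_one _)
      _ = Chebyshev.psi N - Chebyshev.theta N := by
          rw [Chebyshev.psi_sub_theta_eq_sum_not_prime, Nat.floor_natCast]
          rfl
      _ ≤ D * √N := hD N
      _ ≤ |D| * (N + 1 : ℝ) ^ α := by
          refine mul_le_mul (le_abs_self D) ?_ (Real.sqrt_nonneg _) (abs_nonneg D)
          rw [Real.sqrt_eq_rpow]
          calc (N : ℝ) ^ (1 / 2 : ℝ) ≤ (N + 1 : ℝ) ^ (1 / 2 : ℝ) := by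
                gcongr
                linarith
            _ ≤ _ := Real.rpow_le_rpow_of_exponent_le hX (by linarith)
  rw [hrange, hsplit, add_mul]
  refine (norm_sub_le _ _).trans (add_le_add ((hC N hN).trans ?_) hrest)
  gcongr
  exact le_abs_self C

/-- If `L(s, χ)` has no zeros with real part larger than `σ₀ ≥ 1 / 2`, then the prime sum
`∑ χ(p) p ^ (-s)` converges for every real `s > σ₀`. -/
theorem exists_tendsto_sum_prime {χ : DirichletCharacter ℂ m} (hχ : χ ≠ 1) {σ₀ s : ℝ}
    (hσ₀ : 1 / 2 ≤ σ₀) (hσ₁ : σ₀ < 1) (hs : σ₀ < s)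
    (hzero : ∀ z : ℂ, σ₀ < z.re → χ.LFunction z ≠ 0) :
    ∃ L : ℂ, Tendsto (fun n ↦ ∑ p ∈ Finset.range n, if p.Prime then
      χ p * (((p : ℝ) ^ (-s) : ℝ) : ℂ) else 0) atTop (𝓝 L) := by
  obtain ⟨α, hα₀, hα⟩ := exists_between (lt_min hσ₁ hs)
  have hα₁ := hα.trans_le (min_le_left _ _)
  have hα₂ := hα.trans_le (min_le_right _ _)
  obtain ⟨C, hC⟩ := exists_norm_sum_prime_log_le hχ hσ₀ hα₀ hα₁.le hzero
  obtain ⟨L, hL⟩ := exists_tendsto_sum_rpow_smul (by linarith) hα₂ hC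
  obtain ⟨B, hB⟩ := (Metric.isBounded_range_of_tendsto _ hL).exists_norm_le
  have hlog : ∀ i : ℕ, 0 < Real.log (max (i : ℝ) 2) := fun i ↦
    Real.log_pos (lt_of_lt_of_le one_lt_two (le_max_right _ _))
  have hanti : Antitone fun i : ℕ ↦ (Real.log (max (i : ℝ) 2))⁻¹ := by
    intro i j hij
    refine inv_anti₀ (hlog i) (Real.log_le_log (by positivity) ?_)
    gcongr
  have hzero' : Tendsto (fun i : ℕ ↦ (Real.log (max (i : ℝ) 2))⁻¹) atTop (𝓝 0) := by
    refine tendsto_inv_atTop_zero.comp (Real.tendsto_log_atTop.comp ?_)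
    exact tendsto_atTop_mono (fun i ↦ le_max_left _ _) tendsto_natCast_atTop_atTop
  obtain ⟨L', hL'⟩ := cauchySeq_tendsto_of_complete
    (hanti.cauchySeq_series_mul_of_tendsto_zero_of_bounded hzero'
      (fun n ↦ hB _ (mem_range_self n)))
  refine ⟨L', hL'.congr fun n ↦ Finset.sum_congr rfl fun p _ ↦ ?_⟩
  by_cases hp : p.Prime
  · have hp2 : (2 : ℝ) ≤ p := by exact_mod_cast hp.two_le
    have hlp : (Real.log p : ℂ) ≠ 0 := by
      exact_mod_cast (Real.log_pos (by linarith)).ne'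
    simp only [hp, if_true, max_eq_left hp2, real_smul, ofReal_inv]
    field_simp
  · simp [hp]

end DirichletCharacter

end PrimeSums

section Centered

variable {b m : ℕ} [NeZero m]

lemma spectralClass_neg_eq_iff (hb : 2 ≤ b) (hbm : b ∣ m) (x a : (ZMod m)ˣ) :
    spectralClass b m (-x) = spectralClass b m (-a) ↔
      spectralClass b m x = spectralClass b m a := by
  have hm : 2 ≤ m := hb.trans (Nat.le_of_dvd (NeZero.pos m) hbm)
  have : Fact (1 < m) := ⟨hm⟩
  have hne : ∀ u : (ZMod m)ˣ, (u : ZMod m) ≠ 0 := fun u ↦ u.ne_zero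
  have hclass : ∀ u v : (ZMod m)ˣ, spectralClass b m u = spectralClass b m v ↔
      ((u : ZMod m).val : ZMod b) = ((v : ZMod m).val : ZMod b) := by
    intro u v
    have hu : 1 ≤ (u : ZMod m).val := Nat.one_le_iff_ne_zero.mpr (by simp)
    have hv : 1 ≤ (v : ZMod m).val := Nat.one_le_iff_ne_zero.mpr (by simp)
    rw [spectralClass, spectralClass, ← ZMod.natCast_eq_natCast_iff', Nat.cast_sub hu,
      Nat.cast_sub hv, sub_left_inj]
  have hneg : ∀ u : (ZMod m)ˣ, (((-u : (ZMod m)ˣ) : ZMod m).val : ZMod b) =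
      -((u : ZMod m).val : ZMod b) := by
    intro u
    have : NeZero (u : ZMod m) := ⟨hne u⟩
    rw [Units.val_neg, ZMod.val_neg_of_ne_zero, Nat.cast_sub (ZMod.val_lt _).le,
      (ZMod.natCast_eq_zero_iff m b).mpr hbm, zero_sub]
  rw [hclass, hclass, hneg, hneg, neg_inj]

lemma centered_neg (hb : 2 ≤ b) (hbm : b ∣ m) {S : (ZMod m)ˣ → ℝ}
    (hS : ∀ a : (ZMod m)ˣ, S a + S (-a) = -1) (a : (ZMod m)ˣ) :
    centered b m S (-a) = -centered b m S a := by
  set A := Finset.univ.filter fun x : (ZMod m)ˣ ↦ spectralClass b m x = spectralClass b m a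
    with hA
  have himage : (Finset.univ.filter fun x : (ZMod m)ˣ ↦
      spectralClass b m x = spectralClass b m (-a)) = A.map (Equiv.neg _).toEmbedding := by
    ext x
    simp only [Finset.mem_map_equiv, hA, Finset.mem_filter, Finset.mem_univ, true_and]
    simpa using spectralClass_neg_eq_iff hb hbm (-x) a
  have hcard : (A.card : ℝ) ≠ 0 := by
    exact_mod_cast Finset.card_ne_zero_of_mem (a := a) (by simp [hA])
  have hsum : ∑ x ∈ A, S (-x) = -(A.card : ℝ) - ∑ x ∈ A, S x := by
    have : ∀ x ∈ A, S (-x) = -1 - S x := fun x _ ↦ by linarith [hS x]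
    rw [Finset.sum_congr rfl this, Finset.sum_sub_distrib]
    simp
  rw [centered, centered, himage, Finset.sum_map, Finset.card_map]
  simp only [Equiv.coe_toEmbedding, Equiv.neg_apply, ← hA, hsum]
  have := hS a
  field_simp
  linear_combination (A.card : ℝ) * this

lemma centeredZ_neg (hb : 2 ≤ b) (hbm : b ∣ m) {S : (ZMod m)ˣ → ℝ}
    (hS : ∀ a : (ZMod m)ˣ, S a + S (-a) = -1) (x : ZMod m) :
    centeredZ b m S (-x) = -centeredZ b m S x := by
  by_cases hx : IsUnit x
  · rw [centeredZ, centeredZ, dif_pos hx, dif_pos hx.neg, ← centered_neg hb hbm hS]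
    congr 1
    ext
    simp
  · rw [centeredZ, centeredZ, dif_neg hx, dif_neg (by rwa [IsUnit.neg_iff]), neg_zero]

end Centered

/-- An odd function on `ℤ/mℤ` supported on the units is a combination of odd Dirichlet
characters. -/
lemma exists_eq_sum_odd_dirichletCharacter {m : ℕ} [NeZero m] {f : ZMod m → ℂ}
    (hodd : ∀ x, f (-x) = -f x) (hsupp : ∀ x, ¬ IsUnit x → f x = 0) :
    ∃ c : DirichletCharacter ℂ m → ℂ, (∀ χ, ¬ χ.Odd → c χ = 0) ∧
      ∀ x, f x = ∑ χ, c χ * χ x := by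
  classical
  have hφ : (m.totient : ℂ) ≠ 0 := by
    exact_mod_cast (Nat.totient_pos.mpr (NeZero.pos m)).ne'
  refine ⟨fun χ ↦ (m.totient : ℂ)⁻¹ * ∑ u : (ZMod m)ˣ, f u * χ ((u : ZMod m)⁻¹), ?_, ?_⟩
  · intro χ hχ
    have heven : χ.Even := χ.even_or_odd.resolve_right hχ
    have hself : ∑ u : (ZMod m)ˣ, f u * χ ((u : ZMod m)⁻¹) =
        -∑ u : (ZMod m)ˣ, f u * χ ((u : ZMod m)⁻¹) := by
      rw [← Finset.sum_neg_distrib, ← Equiv.sum_comp (Equiv.neg (ZMod m)ˣ)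
        (fun u : (ZMod m)ˣ ↦ f u * χ ((u : ZMod m)⁻¹))]
      refine Finset.sum_congr rfl fun u _ ↦ ?_
      have hinv : ((-u : (ZMod m)ˣ) : ZMod m)⁻¹ = -(u : ZMod m)⁻¹ := by
        rw [ZMod.inv_coe_unit, ZMod.inv_coe_unit, inv_neg, Units.val_neg]
      rw [Equiv.neg_apply, hinv, heven.eval_neg, Units.val_neg, hodd, neg_mul]
    simp only [self_eq_neg.mp hself, mul_zero]
  · intro x
    have hexpand : ∑ χ : DirichletCharacter ℂ m,
        (m.totient : ℂ)⁻¹ * (∑ u : (ZMod m)ˣ, f u * χ ((u : ZMod m)⁻¹)) * χ x =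
        (m.totient : ℂ)⁻¹ * ∑ u : (ZMod m)ˣ, f u *
          ∑ χ : DirichletCharacter ℂ m, χ ((u : ZMod m)⁻¹) * χ x := by
      simp only [Finset.mul_sum, Finset.sum_mul]
      rw [Finset.sum_comm]
      simp only [mul_assoc]
    rw [hexpand]
    simp only [DirichletCharacter.sum_char_inv_mul_char_eq ℂ (Units.isUnit _)]
    by_cases hx : IsUnit x
    · obtain ⟨v, rfl⟩ := hx
      simp only [Units.val_inj, mul_ite, mul_zero, Finset.sum_ite_eq', Finset.mem_univ, if_true]
      field_simp
    · rw [hsupp x hx, Finset.sum_eq_zero, mul_zero]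
      intro u _
      have hne : (u : ZMod m) ≠ x := fun h ↦ hx (h ▸ u.isUnit)
      rw [if_neg hne, mul_zero]

open Filter Finset in
/-- Conditional penetration below `s = 1`: if every odd Dirichlet character `χ` mod
`m = b^(ℓ+1)` has `L(s, χ) ≠ 0` on `Re(s) > σ₀` for some `σ₀ ∈ (1/2, 1)`, then for every
real `s > σ₀` the centered prime harmonic sum `Σ_{p ≤ x, p prime, p ∤ b} S°(p mod m)/p^s`
converges as `x → ∞`. -/
theorem conditional_penetration (b ℓ m : ℕ) (hb : 2 ≤ b) (hℓ : 1 ≤ ℓ)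
    (hm : m = b ^ (ℓ + 1)) [NeZero m]
    (S : (ZMod m)ˣ → ℝ) (hS : ∀ a : (ZMod m)ˣ, S a + S (-a) = -1)
    (σ₀ : ℝ) (hσ₀ : 1 / 2 < σ₀ ∧ σ₀ < 1)
    (hzero : ∀ χ : DirichletCharacter ℂ m, χ.Odd →
      ∀ z : ℂ, σ₀ < z.re → χ.LFunction z ≠ 0)
    (s : ℝ) (hs : σ₀ < s) :
    ∃ L : ℝ, Tendsto
      (fun x : ℕ => ∑ p ∈ (range (x + 1)).filter (fun p => p.Prime ∧ ¬ p ∣ b),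
        centeredZ b m S (p : ZMod m) / (p : ℝ) ^ s)
      atTop (nhds L) := by
  have hbm : b ∣ m := hm ▸ dvd_pow_self b (by omega)
  set f : ZMod m → ℝ := centeredZ b m S with hf
  obtain ⟨c, hc, hexpand⟩ := exists_eq_sum_odd_dirichletCharacter (f := fun x ↦ (f x : ℂ))
    (fun x ↦ by simp [hf, centeredZ_neg hb hbm hS])
    (fun x hx ↦ by simp [hf, centeredZ, hx])
  have hne : ∀ χ : DirichletCharacter ℂ m, χ.Odd → χ ≠ 1 := by
    rintro χ hχ rfl
    have h1 : (1 : DirichletCharacter ℂ m) (-1) = 1 := MulChar.one_apply isUnit_one.neg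
    have h2 : (1 : ℂ) = -1 := h1.symm.trans hχ
    norm_num at h2
  have hconv : ∀ χ : DirichletCharacter ℂ m, ∃ L : ℂ, Tendsto (fun n ↦ ∑ p ∈ range n,
      c χ * (if p.Prime then χ p * (((p : ℝ) ^ (-s) : ℝ) : ℂ) else 0)) atTop (nhds L) := by
    intro χ
    by_cases hχ : χ.Odd
    · obtain ⟨L, hL⟩ := DirichletCharacter.exists_tendsto_sum_prime (hne χ hχ) hσ₀.1.le hσ₀.2 hs
        (hzero χ hχ)
      exact ⟨c χ * L, by simpa only [mul_sum] using hL.const_mul (c χ)⟩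
    · exact ⟨0, by simp [hc χ hχ]⟩
  choose L hL using hconv
  have htot := tendsto_finsetSum (Finset.univ : Finset (DirichletCharacter ℂ m))
    fun χ _ ↦ hL χ
  have hre := (Complex.continuous_re.tendsto _).comp (htot.comp (tendsto_add_atTop_nat 1))
  refine ⟨_, hre.congr fun n ↦ ?_⟩
  have hterm : ∀ p : ℕ, ∑ χ : DirichletCharacter ℂ m,
      c χ * (if p.Prime then χ p * (((p : ℝ) ^ (-s) : ℝ) : ℂ) else 0) =
        ((if p.Prime ∧ ¬ p ∣ b then f p / (p : ℝ) ^ s else 0 : ℝ) : ℂ) := by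
    intro p
    by_cases hp : p.Prime
    · have hsum : ∑ χ : DirichletCharacter ℂ m, c χ * (χ p * (((p : ℝ) ^ (-s) : ℝ) : ℂ)) =
          ((f p / (p : ℝ) ^ s : ℝ) : ℂ) := by
        simp only [← mul_assoc, ← sum_mul, ← hexpand]
        rw [Real.rpow_neg (Nat.cast_nonneg p), div_eq_mul_inv]
        push_cast
        rfl
      by_cases hpb : p ∣ b
      · have hnu : ¬ IsUnit (p : ZMod m) := by
          rw [ZMod.isUnit_iff_coprime, hp.coprime_iff_not_dvd, not_not]
          exact hpb.trans hbm
        have hfp : f p = 0 := by simp [hf, centeredZ, hnu]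
        simp only [hp, if_true, hsum, hfp, hpb]
        simp
      · simp only [hp, if_true, hsum, hpb, not_false_eq_true, and_self]
    · simp [hp]
  simp only [Function.comp_apply]
  rw [sum_comm, sum_congr rfl fun p _ ↦ hterm p, ← Complex.ofReal_sum, Complex.ofReal_re,
    sum_filter]
end

section
/- Let χ be a non-trivial primitive Dirichlet character mod m and let σ₀ ∈ (1/2, 1). Suppose L(s, χ) has no zeros with Re(s) > σ₀. Then there is a constant C > 0 such that for all real x ≥ 2, |Σ_{n ≤ x} Λ(n) χ(n)| ≤ C · x^{σ₀} · (log(m·x))², where Λ is the von Mangoldt function. -/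
open Complex Metric Finset in
/-- One zero of a holomorphic function on a disc is divided out by a Blaschke factor. -/
lemma exists_blaschke_quotient {g : ℂ → ℂ} {R R' M : ℝ} {w : ℂ} (hRR' : R < R')
    (hg : DifferentiableOn ℂ g (ball 0 R')) (hM : ∀ z ∈ closedBall 0 R, ‖g z‖ ≤ M)
    (hw : ‖w‖ < R) (hgw : g w = 0) :
    ∃ q : ℂ → ℂ, DifferentiableOn ℂ q (ball 0 R') ∧ (∀ z ∈ closedBall 0 R, ‖q z‖ ≤ M) ∧
      ∀ z ∈ closedBall 0 R, g z = (R * (z - w) / (R ^ 2 - (starRingEnd ℂ) w * z)) * q z := by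
  have hR : 0 < R := (norm_nonneg w).trans_lt hw
  have hden (z : ℂ) (hz : z ∈ closedBall 0 R) : (R : ℂ) ^ 2 - (starRingEnd ℂ) w * z ≠ 0 := by
    intro h
    have h1 : ‖(R : ℂ) ^ 2‖ = ‖(starRingEnd ℂ) w * z‖ := by rw [sub_eq_zero.mp h]
    rw [norm_mul, norm_pow, RCLike.norm_conj, norm_real, Real.norm_of_nonneg hR.le] at h1
    have hz' : ‖z‖ ≤ R := by simpa using hz
    nlinarith [norm_nonneg w, norm_nonneg z]
  have hRc : (R : ℂ) ≠ 0 := by exact_mod_cast hR.ne'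
  have hwU : ball (0 : ℂ) R' ∈ nhds w :=
    isOpen_ball.mem_nhds (by simpa using hw.trans hRR')
  have hfac (z : ℂ) : g z = (z - w) * dslope g w z := by
    have := sub_smul_dslope g w z
    simp only [smul_eq_mul, hgw, sub_zero] at this
    exact this.symm
  set q : ℂ → ℂ := fun z ↦ ((R ^ 2 - (starRingEnd ℂ) w * z) / R) * dslope g w z with hq
  have hqd : DifferentiableOn ℂ q (ball 0 R') :=
    DifferentiableOn.mul (by fun_prop) ((differentiableOn_dslope hwU).mpr hg)
  have heq (z : ℂ) (hz : z ∈ closedBall 0 R) :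
      g z = (R * (z - w) / (R ^ 2 - (starRingEnd ℂ) w * z)) * q z := by
    have := hden z hz
    rw [hfac z]
    simp only [hq]
    generalize (R : ℂ) ^ 2 - (starRingEnd ℂ) w * z = D at this ⊢
    field_simp
  refine ⟨q, hqd, fun z hz ↦ ?_, heq⟩
  have hcl : closure (ball (0 : ℂ) R) = closedBall 0 R := closure_ball _ hR.ne'
  have hfr : frontier (ball (0 : ℂ) R) = sphere 0 R := frontier_ball _ hR.ne'
  refine norm_le_of_forall_mem_frontier_norm_le (U := ball 0 R) isBounded_ball
    (hqd.diffContOnCl_ball (closedBall_subset_ball hRR')) (fun y hy ↦ ?_) (hcl ▸ hz)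
  rw [hfr] at hy
  have hy' := sphere_subset_closedBall hy
  have hone := norm_canonicalFactor_eval_circle_eq_one (w := w) (by simpa using hw) hy
  have hyw : y - w ≠ 0 := by
    intro h
    rw [sub_eq_zero.mp h] at hy
    simp at hy
    linarith
  have : q y = canonicalFactor R w y * g y := by
    rw [canonicalFactor_apply, hq, hfac y]
    field_simp
  rw [this, norm_mul, hone, one_mul]
  exact hM y hy'

open Complex Metric Finset in
/-- Factorization of a holomorphic function on a disc into finitely many Blaschke factors and
a bounded function without zeros in a smaller disc. -/
lemma exists_blaschke_factorization {f : ℂ → ℂ} {r R R' A : ℝ} (hr : 0 < r) (hrR : r < R)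
    (hRR' : R < R') (hf : DifferentiableOn ℂ f (ball 0 R')) (h0 : f 0 ≠ 0)
    (hM : ∀ z ∈ closedBall 0 R, ‖f z‖ ≤ Real.exp A * ‖f 0‖) :
    ∃ (N : ℕ) (ρ : ℕ → ℂ) (g : ℂ → ℂ), (∀ i < N, ‖ρ i‖ ≤ r) ∧
      DifferentiableOn ℂ g (ball 0 R') ∧
      (∀ z ∈ closedBall 0 R, ‖g z‖ ≤ Real.exp A * ‖f 0‖) ∧
      (∀ z ∈ closedBall 0 R, f z =
        (∏ i ∈ range N, (R * (z - ρ i) / (R ^ 2 - (starRingEnd ℂ) (ρ i) * z))) * g z) ∧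
      (∀ z ∈ closedBall 0 r, g z ≠ 0) ∧ N * Real.log (R / r) ≤ A := by
  have hR : 0 < R := hr.trans hrR
  have h0' : 0 < ‖f 0‖ := norm_pos_iff.mpr h0
  have hcount (N : ℕ) (ρ : ℕ → ℂ) (g : ℂ → ℂ) (hρ : ∀ i < N, ‖ρ i‖ ≤ r)
      (hg : ∀ z ∈ closedBall 0 R, ‖g z‖ ≤ Real.exp A * ‖f 0‖)
      (hfg : ∀ z ∈ closedBall 0 R, f z =
        (∏ i ∈ range N, (R * (z - ρ i) / (R ^ 2 - (starRingEnd ℂ) (ρ i) * z))) * g z) :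
      N * Real.log (R / r) ≤ A := by
    have hz : (0 : ℂ) ∈ closedBall 0 R := by simpa using hR.le
    have h1 : ‖f 0‖ ≤ (r / R) ^ N * (Real.exp A * ‖f 0‖) := by
      conv_lhs => rw [hfg 0 hz, norm_mul, norm_prod]
      refine mul_le_mul ?_ (hg 0 hz) (norm_nonneg _) (by positivity)
      calc _ ≤ ∏ _i ∈ range N, r / R := by
            refine prod_le_prod (fun i _ ↦ norm_nonneg _) fun i hi ↦ ?_
            have := hρ i (mem_range.mp hi)
            simp only [zero_sub, mul_zero, sub_zero, norm_div, norm_mul, norm_neg, norm_pow,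
              norm_real, Real.norm_of_nonneg hR.le]
            rw [div_le_div_iff₀ (by positivity) hR]
            nlinarith [mul_le_mul_of_nonneg_left this (sq_nonneg R)]
        _ = _ := by rw [prod_const, card_range]
    have h2 : 1 ≤ (r / R) ^ N * Real.exp A := by
      by_contra! h
      nlinarith
    have h3 := Real.log_le_log one_pos h2
    rw [Real.log_mul (by positivity) (by positivity), Real.log_exp, Real.log_pow, Real.log_one,
      ← inv_div R r, Real.log_inv] at h3
    linarith
  by_contra H
  have key : ∀ N : ℕ, ∃ (ρ : ℕ → ℂ) (g : ℂ → ℂ), (∀ i < N, ‖ρ i‖ ≤ r) ∧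
      DifferentiableOn ℂ g (ball 0 R') ∧
      (∀ z ∈ closedBall 0 R, ‖g z‖ ≤ Real.exp A * ‖f 0‖) ∧
      (∀ z ∈ closedBall 0 R, f z =
        (∏ i ∈ range N, (R * (z - ρ i) / (R ^ 2 - (starRingEnd ℂ) (ρ i) * z))) * g z) := by
    intro N
    induction N with
    | zero => exact ⟨0, f, by simp, hf, hM, by simp⟩
    | succ N ih =>
      obtain ⟨ρ, g, hρ, hgd, hgM, hfg⟩ := ih
      obtain ⟨w, hw, hgw⟩ : ∃ w ∈ closedBall (0 : ℂ) r, g w = 0 := by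
        by_contra! h
        exact H ⟨N, ρ, g, hρ, hgd, hgM, hfg, h, hcount N ρ g hρ hgM hfg⟩
      have hw' : ‖w‖ ≤ r := by simpa using hw
      obtain ⟨q, hqd, hqM, hgq⟩ :=
        exists_blaschke_quotient hRR' hgd hgM (hw'.trans_lt hrR) hgw
      refine ⟨Function.update ρ N w, q, fun i hi ↦ ?_, hqd, hqM, fun z hz ↦ ?_⟩
      · rcases eq_or_ne i N with rfl | hne
        · simpa using hw'
        · simpa [hne] using hρ i (by omega)
      · rw [hfg z hz, hgq z hz, prod_range_succ, Function.update_self, mul_assoc]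
        congr 1
        refine prod_congr rfl fun i hi ↦ ?_
        rw [Function.update_of_ne (mem_range.mp hi).ne]
  obtain ⟨N, hN⟩ := exists_nat_gt (A / Real.log (R / r))
  obtain ⟨ρ, g, hρ, -, hgM, hfg⟩ := key N
  have hlog : 0 < Real.log (R / r) := Real.log_pos ((one_lt_div hr).mpr hrR)
  rw [div_lt_iff₀ hlog] at hN
  exact absurd (hcount N ρ g hρ hgM hfg) (not_le.mpr hN)

open Complex Metric in
/-- Second derivative bound for the logarithm of a zero-free bounded holomorphic function. -/
lemma norm_deriv_logDeriv_le_of_ne_zero {g : ℂ → ℂ} {r A : ℝ} (hA : 0 < A)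
    {d : ℝ} (hd : 0 < d)
    (hg : DifferentiableOn ℂ g (ball 0 r)) (hg0 : ∀ z ∈ ball 0 r, g z ≠ 0)
    (hM : ∀ z ∈ ball 0 r, ‖g z‖ ≤ Real.exp A * ‖g 0‖) {z : ℂ} (hz : ‖z‖ ≤ r - 2 * d) :
    DifferentiableAt ℂ (logDeriv g) z ∧ ‖deriv (logDeriv g) z‖ ≤ 4 * A * r / d ^ 3 := by
  have hr : 0 < r := by linarith [norm_nonneg z]
  have hzr : z ∈ ball (0 : ℂ) r := by simp; linarith
  have hmem0 : (0 : ℂ) ∈ ball (0 : ℂ) r := by simpa using hr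
  have hld : DifferentiableOn ℂ (logDeriv g) (ball 0 r) :=
    (hg.deriv isOpen_ball).div hg hg0
  obtain ⟨φ, hφ0, hφ⟩ := hld.isExactOn_ball.with_val_at 0 0
  have hφd : DifferentiableOn ℂ φ (ball 0 r) := fun x hx ↦
    (hφ x hx).differentiableAt.differentiableWithinAt
  have hexp : ∀ x ∈ ball (0 : ℂ) r, g x * exp (-φ x) = g 0 := by
    have hcd : DifferentiableOn ℂ (fun x ↦ g x * exp (-φ x)) (ball 0 r) := hg.mul hφd.neg.cexp
    intro x hx
    have := isOpen_ball.is_const_of_deriv_eq_zero (convex_ball (0 : ℂ) r).isPreconnected hcd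
      (fun y hy ↦ ?_) hx hmem0
    · simpa [hφ0] using this
    · have h1 := (hg.differentiableAt (isOpen_ball.mem_nhds hy)).hasDerivAt
      have h2 := (h1.mul (hφ y hy).neg.cexp).deriv
      have hgy := hg0 y hy
      refine h2.trans ?_
      simp only [logDeriv_apply, Pi.zero_apply]
      field_simp
      ring
  have hre : Set.MapsTo φ (ball 0 r) {z | z.re ≤ A} := by
    intro x hx
    have hg00 := norm_pos_iff.mpr (hg0 0 hmem0)
    have h1 : ‖g x‖ = Real.exp (φ x).re * ‖g 0‖ := by
      rw [← hexp x hx, norm_mul, norm_exp, neg_re, mul_left_comm, ← Real.exp_add]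
      simp
    have h2 := hM x hx
    rw [h1] at h2
    exact Real.exp_le_exp.mp (le_of_mul_le_mul_right h2 hg00)
  have hball : closedBall z d ⊆ ball 0 r := by
    intro y hy
    have := norm_sub_norm_le y z
    simp [dist_eq_norm] at hy ⊢
    linarith
  have hderiv : ∀ᶠ y in nhds z, logDeriv g y = deriv φ y := by
    filter_upwards [isOpen_ball.mem_nhds hzr] with y hy
    exact (hφ y hy).deriv.symm
  refine ⟨hld.differentiableAt (isOpen_ball.mem_nhds hzr), ?_⟩
  have hC := norm_iteratedDeriv_le_of_forall_mem_sphere_norm_le 2 hd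
    (hφd.diffContOnCl_ball hball) (C := 2 * A * r / d) (fun y hy ↦ ?_)
  · rw [Filter.EventuallyEq.deriv_eq hderiv]
    rw [iteratedDeriv_succ, iteratedDeriv_one] at hC
    refine hC.trans (le_of_eq ?_)
    norm_num [Nat.factorial]
    field_simp
    norm_num
  · have hy' := hball (sphere_subset_closedBall hy)
    have hB := borelCaratheodory_zero hA hφd hre hr hy' hφ0
    have hyr : ‖y‖ < r := by simpa using hy'
    have hyd : ‖y‖ ≤ r - d := by
      have := norm_sub_norm_le y z
      rw [mem_sphere, dist_eq_norm] at hy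
      linarith
    refine hB.trans ?_
    gcongr
    linarith

open Complex Metric Finset in
/-- The derivative of `f' / f` on a disc is controlled by the zeros of `f` in a larger disc. -/
lemma exists_zeros_norm_deriv_logDeriv_le {f : ℂ → ℂ} {A : ℝ} (hA : 0 < A)
    (hf : DifferentiableOn ℂ f (ball 0 2)) (h0 : f 0 ≠ 0)
    (hM : ∀ z ∈ closedBall 0 (19 / 10), ‖f z‖ ≤ Real.exp A * ‖f 0‖) :
    ∃ (N : ℕ) (ρ : ℕ → ℂ), N ≤ 19 * A ∧ (∀ i < N, f (ρ i) = 0) ∧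
      ∀ z : ℂ, ‖z‖ ≤ 8 / 5 → f z ≠ 0 →
        ‖deriv (logDeriv f) z‖ ≤ ∑ i ∈ range N, (‖z - ρ i‖ ^ 2)⁻¹ + 8000 * A := by
  obtain ⟨N, ρ, g, hρ, hgd, hgM, hfg, hg0, hN⟩ :=
    exists_blaschke_factorization (r := 9 / 5) (by norm_num) (by norm_num) (by norm_num) hf h0 hM
  have hN' : (N : ℝ) ≤ 19 * A := by
    have h1 := Real.one_sub_inv_le_log_of_pos (x := 19 / 10 / (9 / 5)) (by norm_num)
    have h2 : (1 / 19 : ℝ) ≤ Real.log (19 / 10 / (9 / 5)) := le_trans (by norm_num) h1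
    nlinarith [mul_le_mul_of_nonneg_left h2 (Nat.cast_nonneg (α := ℝ) N)]
  have hsub : ball (0 : ℂ) (9 / 5) ⊆ closedBall 0 (19 / 10) :=
    ball_subset_closedBall.trans (closedBall_subset_closedBall (by norm_num))
  refine ⟨N, ρ, hN', fun i hi ↦ ?_, fun z hz hfz ↦ ?_⟩
  · have hmem : ρ i ∈ closedBall (0 : ℂ) (19 / 10) := by
      have := hρ i hi
      simp; linarith
    rw [hfg _ hmem, prod_eq_zero (mem_range.mpr hi) (by simp), zero_mul]
  have hzb : z ∈ ball (0 : ℂ) (9 / 5) := by simp; linarith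
  have hg00 : ‖f 0‖ ≤ ‖g 0‖ := by
    rw [hfg 0 (by simp; norm_num), norm_mul, norm_prod]
    refine mul_le_of_le_one_left (norm_nonneg _) (prod_le_one (fun i _ ↦ norm_nonneg _) ?_)
    intro i hi
    have := hρ i (mem_range.mp hi)
    simp only [zero_sub, mul_zero, sub_zero, norm_div, norm_mul, norm_neg, norm_pow, norm_real]
    norm_num
    linarith
  obtain ⟨hgdiff, hgbound⟩ := norm_deriv_logDeriv_le_of_ne_zero (g := g) (r := 9 / 5) (d := 1 / 10)
    hA (by norm_num) (hgd.mono (ball_subset_ball (by norm_num)))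
    (fun y hy ↦ hg0 y (ball_subset_closedBall hy))
    (fun y hy ↦ (hgM y (hsub hy)).trans (by gcongr)) (z := z) (by linarith)
  have hden (i : ℕ) (hi : i < N) (y : ℂ) (hy : ‖y‖ < 9 / 5) :
      (((19 / 10 : ℝ) : ℂ) ^ 2 - (starRingEnd ℂ) (ρ i) * y) ≠ 0 := by
    intro h
    have h1 : ‖((19 / 10 : ℝ) : ℂ) ^ 2‖ = ‖(starRingEnd ℂ) (ρ i) * y‖ := by rw [sub_eq_zero.mp h]
    rw [norm_mul, norm_pow, RCLike.norm_conj, norm_real, Real.norm_of_nonneg (by norm_num)] at h1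
    nlinarith [norm_nonneg (ρ i), norm_nonneg y, hρ i hi]
  have hfac (y : ℂ) (hy : y ∈ ball (0 : ℂ) (9 / 5)) (hfy : f y ≠ 0) (i : ℕ) (hi : i < N) :
      y - ρ i ≠ 0 := by
    intro h
    apply hfy
    rw [hfg y (hsub hy), prod_eq_zero (mem_range.mpr hi) (by simp [h]), zero_mul]
  have hnear : ∀ᶠ y in nhds z, y ∈ ball (0 : ℂ) (9 / 5) ∧ f y ≠ 0 := by
    refine Filter.Eventually.and (isOpen_ball.mem_nhds hzb) ?_
    refine ContinuousAt.eventually_ne ?_ hfz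
    exact (hf.differentiableAt (isOpen_ball.mem_nhds
      (ball_subset_ball (by norm_num) hzb))).continuousAt
  have hlog : ∀ᶠ y in nhds z, logDeriv f y =
      (∑ i ∈ range N, (1 / (y - ρ i) + (starRingEnd ℂ) (ρ i) /
        (((19 / 10 : ℝ) : ℂ) ^ 2 - (starRingEnd ℂ) (ρ i) * y))) + logDeriv g y := by
    filter_upwards [hnear] with y ⟨hy, hfy⟩
    have hy' : ‖y‖ < 9 / 5 := by simpa using hy
    have hloc : f =ᶠ[nhds y] fun y ↦ (∏ i ∈ range N, (((19 / 10 : ℝ) : ℂ) * (y - ρ i) /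
        (((19 / 10 : ℝ) : ℂ) ^ 2 - (starRingEnd ℂ) (ρ i) * y))) * g y := by
      filter_upwards [isOpen_ball.mem_nhds hy] with x hx using hfg x (hsub hx)
    have hd (i : ℕ) (hi : i ∈ range N) : DifferentiableAt ℂ (fun y ↦ ((19 / 10 : ℝ) : ℂ) *
        (y - ρ i) / (((19 / 10 : ℝ) : ℂ) ^ 2 - (starRingEnd ℂ) (ρ i) * y)) y :=
      DifferentiableAt.div (by fun_prop) (by fun_prop) (hden i (mem_range.mp hi) y hy')
    have hne (i : ℕ) (hi : i ∈ range N) : ((19 / 10 : ℝ) : ℂ) *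
        (y - ρ i) / (((19 / 10 : ℝ) : ℂ) ^ 2 - (starRingEnd ℂ) (ρ i) * y) ≠ 0 :=
      div_ne_zero (mul_ne_zero (by norm_num) (hfac y hy hfy i (mem_range.mp hi)))
        (hden i (mem_range.mp hi) y hy')
    rw [(logDeriv_congr_nhds hloc).eq_of_nhds, logDeriv_mul y (prod_ne_zero_iff.mpr hne)
      (hg0 y (ball_subset_closedBall hy)) (DifferentiableAt.fun_finsetProd hd)
      (hgd.differentiableAt (isOpen_ball.mem_nhds (ball_subset_ball (by norm_num) hy))),
      logDeriv_prod hne hd]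
    congr 1
    refine sum_congr rfl fun i hi ↦ ?_
    have hi' := mem_range.mp hi
    have h1 := hden i hi' y hy'
    have h2 := hfac y hy hfy i hi'
    rw [logDeriv_div (f := fun y ↦ ((19 / 10 : ℝ) : ℂ) * (y - ρ i)) y
      (mul_ne_zero (by norm_num) h2) h1 (by fun_prop) (by fun_prop),
      logDeriv_const_mul _ _ (by norm_num), logDeriv_apply, logDeriv_apply]
    have e1 : deriv (fun y ↦ y - ρ i) y = 1 := by simp
    have e2 : deriv (fun y ↦ ((19 / 10 : ℝ) : ℂ) ^ 2 - (starRingEnd ℂ) (ρ i) * y) y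
        = - (starRingEnd ℂ) (ρ i) := by
      rw [deriv_const_sub, deriv_const_mul_field, deriv_id'', mul_one]
    rw [e1, e2, neg_div, sub_neg_eq_add]
  have hzn : ‖z‖ < 9 / 5 := by linarith
  have hder : HasDerivAt (logDeriv f) ((∑ i ∈ range N, (-1 / (z - ρ i) ^ 2 +
      (starRingEnd ℂ) (ρ i) * (starRingEnd ℂ) (ρ i) /
        (((19 / 10 : ℝ) : ℂ) ^ 2 - (starRingEnd ℂ) (ρ i) * z) ^ 2)) + deriv (logDeriv g) z) z := by
    refine HasDerivAt.congr_of_eventuallyEq ?_ hlog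
    refine HasDerivAt.add (HasDerivAt.fun_sum fun i hi ↦ ?_) hgdiff.hasDerivAt
    have h1 := hden i (mem_range.mp hi) z hzn
    have h2 := hfac z hzb hfz i (mem_range.mp hi)
    have e1 : HasDerivAt (fun y ↦ y - ρ i) 1 z := (hasDerivAt_id z).sub_const _
    have e2 : HasDerivAt (fun y ↦ ((19 / 10 : ℝ) : ℂ) ^ 2 - (starRingEnd ℂ) (ρ i) * y)
        (-((starRingEnd ℂ) (ρ i) * 1)) z :=
      ((hasDerivAt_id z).const_mul ((starRingEnd ℂ) (ρ i))).const_sub _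
    refine HasDerivAt.add ?_ ?_
    · refine ((hasDerivAt_const z (1 : ℂ)).fun_div e1 h2).congr_deriv ?_
      simp
    · refine ((hasDerivAt_const z ((starRingEnd ℂ) (ρ i))).fun_div e2 h1).congr_deriv ?_
      simp
  rw [hder.deriv]
  have hterm (i : ℕ) (hi : i ∈ range N) : ‖-1 / (z - ρ i) ^ 2 +
      (starRingEnd ℂ) (ρ i) * (starRingEnd ℂ) (ρ i) /
        (((19 / 10 : ℝ) : ℂ) ^ 2 - (starRingEnd ℂ) (ρ i) * z) ^ 2‖ ≤
      (‖z - ρ i‖ ^ 2)⁻¹ + 7 := by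
    have hρi := hρ i (mem_range.mp hi)
    have hlow : (7 / 10 : ℝ) ≤ ‖((19 / 10 : ℝ) : ℂ) ^ 2 - (starRingEnd ℂ) (ρ i) * z‖ := by
      have h1 := norm_sub_norm_le (((19 / 10 : ℝ) : ℂ) ^ 2) ((starRingEnd ℂ) (ρ i) * z)
      rw [norm_mul, norm_pow, RCLike.norm_conj, norm_real, Real.norm_of_nonneg (by norm_num)] at h1
      nlinarith [norm_nonneg (ρ i), norm_nonneg z]
    refine (norm_add_le _ _).trans (add_le_add ?_ ?_)
    · simp
    · rw [norm_div, norm_mul, norm_pow, RCLike.norm_conj, div_le_iff₀ (by positivity)]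
      nlinarith [norm_nonneg (ρ i)]
  calc _ ≤ ∑ i ∈ range N, ((‖z - ρ i‖ ^ 2)⁻¹ + 7) + 4 * A * (9 / 5) / (1 / 10) ^ 3 :=
        (norm_add_le _ _).trans (add_le_add (norm_sum_le_of_le _ hterm) hgbound)
    _ ≤ _ := by
      rw [sum_add_distrib, sum_const, card_range, nsmul_eq_mul]
      norm_num
      nlinarith

/-- Mean value bound for differences of complex powers of positive reals. -/
lemma norm_ofReal_cpow_sub_cpow_le {a b M : ℝ} {w : ℂ} (ha : 0 < a) (hab : a ≤ b)
    (hM : ∀ x ∈ Set.Icc a b, x ^ (w.re - 1) ≤ M) :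
    ‖(b : ℂ) ^ w - (a : ℂ) ^ w‖ ≤ ‖w‖ * M * (b - a) := by
  rcases eq_or_ne w 0 with rfl | hw
  · simp
  have hderiv : ∀ x ∈ Set.Icc a b,
      HasDerivWithinAt (fun x : ℝ ↦ (x : ℂ) ^ w) (w * (x : ℂ) ^ (w - 1)) (Set.Icc a b) x := by
    intro x hx
    exact (hasDerivAt_ofReal_cpow_const (ha.trans_le hx.1).ne' hw).hasDerivWithinAt
  have hbound : ∀ x ∈ Set.Icc a b, ‖w * (x : ℂ) ^ (w - 1)‖ ≤ ‖w‖ * M := by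
    intro x hx
    rw [norm_mul, Complex.norm_cpow_eq_rpow_re_of_pos (ha.trans_le hx.1)]
    gcongr
    simpa using hM x hx
  have := (convex_Icc a b).norm_image_sub_le_of_norm_hasDerivWithin_le hderiv hbound
    (Set.left_mem_Icc.mpr hab) (Set.right_mem_Icc.mpr hab)
  rwa [Real.norm_of_nonneg (sub_nonneg.mpr hab)] at this

open Finset in
/-- Partial sums of a non-trivial Dirichlet character are bounded. -/
lemma DirichletCharacter.exists_norm_sum_range_le {m : ℕ} [NeZero m] {χ : DirichletCharacter ℂ m}
    (hχ : χ ≠ 1) : ∃ B : ℝ, 0 < B ∧ ∀ n : ℕ, ‖∑ k ∈ range n, χ ((k + 1 : ℕ) : ZMod m)‖ ≤ B := by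
  have hzero : ∑ k ∈ range m, χ (k : ZMod m) = 0 := by
    rw [← MulChar.sum_eq_zero_of_ne_one hχ]
    obtain ⟨n, rfl⟩ := Nat.exists_eq_succ_of_ne_zero (NeZero.ne m)
    rw [← Fin.sum_univ_eq_sum_range (fun k ↦ χ ((k : ℕ) : ZMod (n + 1)))]
    refine sum_congr rfl fun i _ ↦ ?_
    congr 1
    exact Fin.cast_val_eq_self i
  have hper : Function.Periodic (fun n ↦ ∑ k ∈ range n, χ (k : ZMod m)) m := by
    intro n
    simp only
    rw [add_comm, sum_range_add, hzero, zero_add]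
    simp
  refine ⟨m + 1, by positivity, fun n ↦ ?_⟩
  have h1 : ∑ k ∈ range n, χ ((k + 1 : ℕ) : ZMod m)
      = ∑ k ∈ range (n + 1), χ (k : ZMod m) - χ ((0 : ℕ) : ZMod m) := by
    rw [sum_range_succ' (fun k ↦ χ (k : ZMod m))]
    ring
  rw [h1]
  refine (norm_sub_le _ _).trans (add_le_add ?_ (χ.norm_le_one _))
  have h2 := hper.map_mod_nat (n + 1)
  rw [← h2]
  refine (norm_sum_le_of_le _ (fun k _ ↦ χ.norm_le_one _)).trans ?_
  simpa using (Nat.mod_lt _ (NeZero.pos m)).le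

open Finset in
/-- `L(s, χ)` has at most linear growth in a half plane inside `Re s > 0`. -/
lemma DirichletCharacter.exists_norm_LFunction_le {m : ℕ} [NeZero m] {χ : DirichletCharacter ℂ m}
    (hχ : χ ≠ 1) :
    ∃ C : ℝ, 0 < C ∧ ∀ s : ℂ, 1 / 10 ≤ s.re → ‖χ.LFunction s‖ ≤ C * ‖s‖ := by
  obtain ⟨B, hB, hS⟩ := DirichletCharacter.exists_norm_sum_range_le hχ
  set S : ℕ → ℂ := fun n ↦ ∑ k ∈ range n, χ ((k + 1 : ℕ) : ZMod m) with hSdef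
  set u : ℂ → ℕ → ℂ := fun s n ↦ (((n + 1 : ℕ) : ℝ) : ℂ) ^ (-s) with hu
  set term : ℕ → ℂ → ℂ := fun n s ↦ S (n + 1) * (u s n - u s (n + 1)) with hterm
  have hdiff (s : ℂ) (hs : 0 < s.re) (n : ℕ) :
      ‖u s n - u s (n + 1)‖ ≤ ‖s‖ * ((n + 1 : ℕ) : ℝ) ^ (-s.re - 1) := by
    rw [norm_sub_rev]
    have h := norm_ofReal_cpow_sub_cpow_le (a := ((n + 1 : ℕ) : ℝ)) (b := ((n + 1 + 1 : ℕ) : ℝ))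
      (w := -s) (M := ((n + 1 : ℕ) : ℝ) ^ (-s.re - 1)) (by positivity) (by push_cast; linarith)
      (fun x hx ↦ by
        rw [Complex.neg_re]
        exact Real.rpow_le_rpow_of_nonpos (by positivity) hx.1 (by linarith))
    refine h.trans (le_of_eq ?_)
    push_cast
    rw [norm_neg]
    ring
  have hsumm (ε : ℝ) (hε : 0 < ε) : Summable fun n : ℕ ↦ ((n + 1 : ℕ) : ℝ) ^ (-ε - 1) :=
    (summable_nat_add_iff 1).mpr (Real.summable_nat_rpow.mpr (by linarith))
  have htermle (ε : ℝ) (s : ℂ) (hε : 0 < ε) (hs : ε ≤ s.re) (n : ℕ) :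
      ‖term n s‖ ≤ B * (‖s‖ * ((n + 1 : ℕ) : ℝ) ^ (-ε - 1)) := by
    rw [hterm, norm_mul]
    refine mul_le_mul (hS _) ((hdiff s (hε.trans_le hs) n).trans ?_) (norm_nonneg _) hB.le
    gcongr
    exact_mod_cast Nat.le_add_left 1 n
  set E : ℂ → ℂ := fun s ↦ ∑' n, term n s with hE
  have hEdiff : DifferentiableOn ℂ E {s | 0 < s.re} := by
    intro s hs
    have hs : 0 < s.re := hs
    have hopen : IsOpen ({w : ℂ | s.re / 2 < w.re} ∩ Metric.ball 0 (‖s‖ + 1)) :=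
      (isOpen_lt continuous_const Complex.continuous_re).inter Metric.isOpen_ball
    have hd := Complex.differentiableOn_tsum_of_summable_norm
      (F := term) (u := fun n ↦ B * ((‖s‖ + 1) * ((n + 1 : ℕ) : ℝ) ^ (-(s.re / 2) - 1)))
      (((hsumm _ (half_pos hs)).mul_left _).mul_left _) (fun n w hw ↦ ?_) hopen (fun n w hw ↦ ?_)
    · exact (hd.differentiableAt (hopen.mem_nhds
        ⟨by simp; linarith, by simp⟩)).differentiableWithinAt
    · have h1 (k : ℕ) : DifferentiableAt ℂ (fun s ↦ u s k) w :=
        DifferentiableAt.const_cpow (by fun_prop) (Or.inl (by norm_cast))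
      exact (((h1 n).sub (h1 (n + 1))).const_mul _).differentiableWithinAt
    · refine (htermle _ w (half_pos hs) hw.1.le n).trans ?_
      have : ‖w‖ ≤ ‖s‖ + 1 := (mem_ball_zero_iff.mp hw.2).le
      gcongr
  have hEL : ∀ s : ℂ, 1 < s.re → χ.LFunction s = E s := by
    intro s hs
    have hs0 : 0 < s.re := by linarith
    rw [χ.LFunction_eq_LSeries hs]
    have hL : LSeriesSummable (fun n ↦ χ n) s := χ.LSeriesSummable_of_one_lt_re hs
    have h1 : Filter.Tendsto (fun N ↦ ∑ n ∈ range N, χ ((n + 1 : ℕ) : ZMod m) * u s n)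
        Filter.atTop (nhds (LSeries (fun n ↦ χ n) s)) := by
      have h := (hL.hasSum.tendsto_sum_nat).comp (Filter.tendsto_add_atTop_nat 1)
      refine h.congr fun N ↦ ?_
      simp only [Function.comp]
      rw [sum_range_succ', LSeries.term_zero, add_zero]
      refine sum_congr rfl fun n _ ↦ ?_
      rw [LSeries.term_of_ne_zero (Nat.succ_ne_zero n), hu]
      simp only [Complex.ofReal_natCast, Complex.cpow_neg]
      rw [div_eq_mul_inv]
    have h2 (N : ℕ) : ∑ n ∈ range N, χ ((n + 1 : ℕ) : ZMod m) * u s n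
        = S N * u s N + ∑ n ∈ range N, term n s := by
      induction N with
      | zero => simp [hSdef]
      | succ N ih =>
        rw [sum_range_succ, ih, sum_range_succ]
        have : S (N + 1) = S N + χ ((N + 1 : ℕ) : ZMod m) := by rw [hSdef]; simp [sum_range_succ]
        simp only [hterm, this]
        ring
    have h3 : Filter.Tendsto (fun N ↦ S N * u s N) Filter.atTop (nhds 0) := by
      have hb : ∀ N, ‖S N * u s N‖ ≤ B * ((N + 1 : ℕ) : ℝ) ^ (-s.re) := by
        intro N
        rw [norm_mul]
        refine mul_le_mul (hS N) (le_of_eq ?_) (norm_nonneg _) hB.le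
        rw [hu]
        simp only
        rw [Complex.norm_cpow_eq_rpow_re_of_pos (by positivity), Complex.neg_re]
      refine squeeze_zero_norm hb ?_
      rw [← mul_zero B]
      exact (((tendsto_rpow_neg_atTop hs0).comp tendsto_natCast_atTop_atTop).comp
        (Filter.tendsto_add_atTop_nat 1)).const_mul B
    have h4 : Filter.Tendsto (fun N ↦ ∑ n ∈ range N, term n s) Filter.atTop (nhds (E s)) :=
      (Summable.of_norm_bounded (((hsumm _ hs0).mul_left _).mul_left _)
        (fun n ↦ htermle s.re s hs0 le_rfl n)).hasSum.tendsto_sum_nat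
    have h5 := h3.add h4
    rw [zero_add] at h5
    exact tendsto_nhds_unique h1 (h5.congr fun N ↦ (h2 N).symm)
  have hopen0 : IsOpen {s : ℂ | 0 < s.re} := isOpen_lt continuous_const Complex.continuous_re
  have heq : Set.EqOn χ.LFunction E {s | 0 < s.re} := by
    refine AnalyticOnNhd.eqOn_of_preconnected_of_eventuallyEq (z₀ := 2)
      (fun z _ ↦ (differentiable_LFunction hχ).analyticAt z) (hEdiff.analyticOnNhd hopen0)
      (convex_halfSpace_re_gt 0).isPreconnected (by simp) ?_
    filter_upwards [(isOpen_lt continuous_const Complex.continuous_re).mem_nhds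
      (show (2 : ℂ) ∈ {s : ℂ | 1 < s.re} by simp)] with s hs using hEL s hs
  refine ⟨B * (∑' n : ℕ, ((n + 1 : ℕ) : ℝ) ^ (-(1 / 10 : ℝ) - 1) + 1), ?_, fun s hs ↦ ?_⟩
  · have : 0 ≤ ∑' n : ℕ, ((n + 1 : ℕ) : ℝ) ^ (-(1 / 10 : ℝ) - 1) :=
      tsum_nonneg fun n ↦ by positivity
    positivity
  · rw [heq (show 0 < s.re by linarith)]
    refine (tsum_of_norm_bounded (((hsumm (1 / 10) (by norm_num)).hasSum.mul_left _).mul_left _)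
      (fun n ↦ htermle (1 / 10) s (by norm_num) hs n)).trans ?_
    nlinarith [mul_nonneg hB.le (norm_nonneg s)]

/-- `L(s, χ)` is bounded away from zero on the line `Re s = 2`. -/
lemma DirichletCharacter.exists_le_norm_LFunction_two_s9 {m : ℕ} [NeZero m]
    (χ : DirichletCharacter ℂ m) :
    ∃ c : ℝ, 0 < c ∧ ∀ s : ℂ, s.re = 2 → c ≤ ‖χ.LFunction s‖ := by
  have hsum : Summable fun n : ℕ ↦ (n : ℝ) ^ (-2 : ℝ) := Real.summable_nat_rpow.mpr (by norm_num)
  set Z : ℝ := ∑' n : ℕ, (n : ℝ) ^ (-2 : ℝ) with hZ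
  have hZ0 : 0 ≤ Z := tsum_nonneg fun n ↦ by positivity
  refine ⟨(Z + 1)⁻¹, by positivity, fun s hs ↦ ?_⟩
  have hs1 : 1 < s.re := by rw [hs]; norm_num
  have hmul := LSeries.mul_mu_eq_one χ hs1
  rw [← χ.LFunction_eq_LSeries hs1] at hmul
  set W := LSeries ((fun n : ℕ ↦ χ n) * fun n ↦ ((ArithmeticFunction.moebius n : ℤ) : ℂ)) s with hW
  have hWle : ‖W‖ ≤ Z := by
    refine tsum_of_norm_bounded hsum.hasSum fun n ↦ ?_
    rcases eq_or_ne n 0 with rfl | hn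
    · simp
    · rw [LSeries.norm_term_eq, if_neg hn, hs, Real.rpow_neg (by positivity), ← one_div]
      gcongr
      simp only [Pi.mul_apply, norm_mul]
      refine mul_le_one₀ (χ.norm_le_one _) (norm_nonneg _) ?_
      rw [Complex.norm_intCast]
      exact_mod_cast ArithmeticFunction.abs_moebius_le_one
  have hn : ‖χ.LFunction s‖ * ‖W‖ = 1 := by
    rw [← norm_mul]
    simpa using congrArg norm hmul
  rw [inv_le_iff_one_le_mul₀ (by positivity)]
  nlinarith [norm_nonneg (χ.LFunction s)]

open Finset in
/-- Local bound for the derivative of the logarithmic derivative of `L(s, χ)` in terms of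
nearby zeros. -/
lemma DirichletCharacter.exists_zeros_norm_deriv_logDeriv_LFunction_le {m : ℕ} [NeZero m]
    {χ : DirichletCharacter ℂ m} (hχ : χ ≠ 1) :
    ∃ C : ℝ, 0 < C ∧ ∀ τ : ℝ, ∃ (N : ℕ) (ρ : ℕ → ℂ), N ≤ C * Real.log (|τ| + 3) ∧
      (∀ i < N, χ.LFunction (ρ i) = 0) ∧
      ∀ s : ℂ, ‖s - (2 + τ * Complex.I)‖ ≤ 8 / 5 → χ.LFunction s ≠ 0 →
        ‖deriv (logDeriv χ.LFunction) s‖ ≤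
          ∑ i ∈ range N, (‖s - ρ i‖ ^ 2)⁻¹ + C * Real.log (|τ| + 3) := by
  obtain ⟨C, hC, hCle⟩ := exists_norm_LFunction_le hχ
  obtain ⟨c, hc, hcle⟩ := exists_le_norm_LFunction_two_s9 χ
  set C₁ := 1 + |Real.log (2 * C / c)| with hC₁
  have hC₁1 : 1 ≤ C₁ := by simp [hC₁]
  refine ⟨8000 * C₁, by positivity, fun τ ↦ ?_⟩
  have hlog : 1 ≤ Real.log (|τ| + 3) := by
    rw [Real.le_log_iff_exp_le (by positivity)]
    linarith [Real.exp_one_lt_d9, abs_nonneg τ]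
  set a : ℂ := 2 + τ * Complex.I with ha
  have ha2 : a.re = 2 := by simp [ha]
  have hna : ‖a‖ ≤ 2 + |τ| := by
    refine (norm_add_le _ _).trans ?_
    simp
  have hA : 0 < C₁ * Real.log (|τ| + 3) := by positivity
  have hdiff := differentiable_LFunction hχ
  have hM : ∀ z ∈ Metric.closedBall (0 : ℂ) (19 / 10),
      ‖χ.LFunction (a + z)‖ ≤ Real.exp (C₁ * Real.log (|τ| + 3)) * ‖χ.LFunction (a + 0)‖ := by
    intro z hz
    rw [add_zero]
    have hz' : ‖z‖ ≤ 19 / 10 := by simpa using hz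
    have hre : 1 / 10 ≤ (a + z).re := by
      have := (abs_le.mp ((Complex.abs_re_le_norm z).trans hz')).1
      simp [ha2]; linarith
    have h3 : 2 * C * (|τ| + 3) ≤ Real.exp (C₁ * Real.log (|τ| + 3)) * c := by
      have h4 : 2 * C / c * (|τ| + 3) ≤ Real.exp (C₁ * Real.log (|τ| + 3)) := by
        have h5 : Real.log (2 * C / c) + Real.log (|τ| + 3) ≤ C₁ * Real.log (|τ| + 3) := by
          have := le_abs_self (Real.log (2 * C / c))
          have := abs_nonneg (Real.log (2 * C / c))
          rw [hC₁]; nlinarith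
        refine le_trans (le_of_eq ?_) (Real.exp_le_exp.mpr h5)
        rw [Real.exp_add, Real.exp_log (by positivity), Real.exp_log (by positivity)]
      calc _ = 2 * C / c * (|τ| + 3) * c := by field_simp
        _ ≤ _ := by gcongr
    calc ‖χ.LFunction (a + z)‖ ≤ C * ‖a + z‖ := hCle _ hre
      _ ≤ C * (2 * (|τ| + 3)) := by
          gcongr
          linarith [norm_add_le a z, abs_nonneg τ]
      _ ≤ Real.exp (C₁ * Real.log (|τ| + 3)) * c := by linarith
      _ ≤ _ := by gcongr; exact hcle _ ha2
  obtain ⟨N, ρ, hN, hρ, hbound⟩ := exists_zeros_norm_deriv_logDeriv_le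
    (f := fun z ↦ χ.LFunction (a + z)) hA
    (hdiff.comp (by fun_prop)).differentiableOn
    (norm_pos_iff.mp (hc.trans_le (hcle _ (by simp [ha2])))) hM
  refine ⟨N, fun i ↦ a + ρ i, by nlinarith, hρ, fun s hs hs0 ↦ ?_⟩
  have h1 : logDeriv (fun z ↦ χ.LFunction (a + z)) =
      fun z ↦ logDeriv χ.LFunction (a + z) := by
    ext z
    simp [logDeriv_apply, deriv_comp_const_add]
  have h2 := hbound (s - a) hs (by simpa using hs0)
  rw [h1, deriv_comp_const_add] at h2
  simp only [add_sub_cancel] at h2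
  simp only [sub_sub] at h2
  rwa [← mul_assoc] at h2

open Finset in
/-- Pointwise bound for the derivative of `L'/L` to the right of the zeros. -/
lemma DirichletCharacter.exists_norm_deriv_logDeriv_LFunction_le {m : ℕ} [NeZero m]
    {χ : DirichletCharacter ℂ m} (hχ : χ ≠ 1) {σ₀ : ℝ} (hσ₀ : 1 / 2 < σ₀)
    (hzero : ∀ z : ℂ, σ₀ < z.re → χ.LFunction z ≠ 0) :
    ∃ C : ℝ, 0 < C ∧ ∀ s : ℂ, σ₀ < s.re → s.re ≤ 2 →
      ‖deriv (logDeriv χ.LFunction) s‖ ≤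
        C * Real.log (|s.im| + 3) * (((s.re - σ₀) ^ 2)⁻¹ + 1) := by
  obtain ⟨C, hC, h⟩ := exists_zeros_norm_deriv_logDeriv_LFunction_le hχ
  refine ⟨C, hC, fun s hs hs2 ↦ ?_⟩
  obtain ⟨N, ρ, hN, hρ, hb⟩ := h s.im
  have hnear : ‖s - (2 + s.im * Complex.I)‖ ≤ 8 / 5 := by
    have : s - (2 + s.im * Complex.I) = ((s.re - 2 : ℝ) : ℂ) := by
      apply Complex.ext <;> simp
    rw [this, Complex.norm_real, Real.norm_eq_abs, abs_le]
    constructor <;> linarith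
  refine (hb s hnear (hzero s hs)).trans ?_
  have hterm : ∀ i ∈ range N, (‖s - ρ i‖ ^ 2)⁻¹ ≤ ((s.re - σ₀) ^ 2)⁻¹ := by
    intro i hi
    have hre : (ρ i).re ≤ σ₀ := by
      by_contra! hlt
      exact hzero _ hlt (hρ i (mem_range.mp hi))
    have hd : 0 < s.re - σ₀ := by linarith
    have : s.re - σ₀ ≤ ‖s - ρ i‖ := by
      refine le_trans ?_ (Complex.re_le_norm _)
      simp; linarith
    gcongr
  have := sum_le_card_nsmul _ _ _ hterm
  rw [card_range, nsmul_eq_mul] at this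
  have h2 : (N : ℝ) * ((s.re - σ₀) ^ 2)⁻¹ ≤
      C * Real.log (|s.im| + 3) * ((s.re - σ₀) ^ 2)⁻¹ := by gcongr
  linarith

open MeasureTheory in
/-- Integrability of a Poisson-type kernel. -/
lemma integrable_inv_sq_add_sq {δ : ℝ} (hδ : 0 < δ) (γ : ℝ) :
    Integrable (fun t : ℝ ↦ (δ ^ 2 + (t - γ) ^ 2)⁻¹) := by
  have h := (((integrable_inv_one_add_sq).comp_div hδ.ne').comp_sub_right γ).const_mul (δ ^ 2)⁻¹
  refine h.congr (.of_forall fun t ↦ ?_)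
  simp only [← mul_inv]
  congr 1
  field_simp

open MeasureTheory in
/-- The integral of a Poisson-type kernel. -/
lemma lintegral_inv_sq_add_sq {δ : ℝ} (hδ : 0 < δ) (γ : ℝ) :
    ∫⁻ t : ℝ, ENNReal.ofReal ((δ ^ 2 + (t - γ) ^ 2)⁻¹) = ENNReal.ofReal (Real.pi / δ) := by
  have hrw : ∀ t : ℝ, (δ ^ 2 + (t - γ) ^ 2)⁻¹ =
      (δ ^ 2)⁻¹ * (1 + ((t - γ) / δ) ^ 2)⁻¹ := by
    intro t
    rw [← mul_inv]
    congr 1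
    field_simp
  rw [← ofReal_integral_eq_lintegral_ofReal (integrable_inv_sq_add_sq hδ γ)
    (.of_forall fun t ↦ by positivity)]
  congr 1
  simp_rw [hrw]
  rw [integral_const_mul,
    integral_sub_right_eq_self (fun t : ℝ ↦ (1 + (t / δ) ^ 2)⁻¹) γ,
    Measure.integral_comp_div (fun t : ℝ ↦ (1 + t ^ 2)⁻¹) δ, integral_univ_inv_one_add_sq,
    smul_eq_mul, abs_of_pos hδ]
  field_simp

open Finset MeasureTheory in
/-- Mean bound for the derivative of `L'/L` on vertical unit segments to the right of the
zeros. -/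
lemma DirichletCharacter.exists_lintegral_deriv_logDeriv_LFunction_le {m : ℕ} [NeZero m]
    {χ : DirichletCharacter ℂ m} (hχ : χ ≠ 1) {σ₀ : ℝ} (hσ₀ : 1 / 2 < σ₀)
    (hzero : ∀ z : ℂ, σ₀ < z.re → χ.LFunction z ≠ 0) :
    ∃ C : ℝ, 0 < C ∧ ∀ δ : ℝ, 0 < δ → δ ≤ 1 → σ₀ + δ ≤ 2 → ∀ n : ℤ,
      ∫⁻ t in Set.Ioc (n : ℝ) (n + 1),
        ‖deriv (logDeriv χ.LFunction) ((σ₀ + δ : ℝ) + t * Complex.I)‖ₑ ≤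
        ENNReal.ofReal (C * Real.log (|(n : ℝ)| + 4) / δ) := by
  obtain ⟨C, hC, h⟩ := exists_zeros_norm_deriv_logDeriv_LFunction_le hχ
  refine ⟨5 * C, by positivity, fun δ hδ hδ1 hδ2 n ↦ ?_⟩
  obtain ⟨N, ρ, hN, hρ, hb⟩ := h (n + 1 / 2)
  set ℓ := Real.log (|(n : ℝ) + 1 / 2| + 3) with hℓ
  have hℓ0 : 0 ≤ ℓ := Real.log_nonneg (by linarith [abs_nonneg ((n : ℝ) + 1 / 2)])
  have hℓ1 : ℓ ≤ Real.log (|(n : ℝ)| + 4) := by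
    refine Real.log_le_log (by positivity) ?_
    have := abs_add_le (n : ℝ) (1 / 2)
    rw [abs_of_pos (by norm_num : (0 : ℝ) < 1 / 2)] at this
    linarith
  have hpt : ∀ t ∈ Set.Ioc (n : ℝ) (n + 1),
      ‖deriv (logDeriv χ.LFunction) ((σ₀ + δ : ℝ) + t * Complex.I)‖ₑ ≤
        ∑ i ∈ range N, ENNReal.ofReal ((δ ^ 2 + (t - (ρ i).im) ^ 2)⁻¹) +
          ENNReal.ofReal (C * ℓ) := by
    intro t ht
    set s : ℂ := (σ₀ + δ : ℝ) + t * Complex.I with hs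
    have hsre : s.re = σ₀ + δ := by simp [hs]
    have hsim : s.im = t := by simp [hs]
    have hnear : ‖s - (2 + ((n + 1 / 2 : ℝ) : ℂ) * Complex.I)‖ ≤ 8 / 5 := by
      rw [← sq_le_sq₀ (norm_nonneg _) (by norm_num), Complex.sq_norm, Complex.normSq_apply]
      have h1 : (s - (2 + ((n + 1 / 2 : ℝ) : ℂ) * Complex.I)).re = σ₀ + δ - 2 := by
        simp [hsre]
      have h2 : (s - (2 + ((n + 1 / 2 : ℝ) : ℂ) * Complex.I)).im = t - (n + 1 / 2) := by
        simp [hsim]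
      rw [h1, h2]
      have := ht.1
      have := ht.2
      nlinarith
    have hle := hb s hnear (hzero s (by rw [hsre]; linarith))
    rw [← ofReal_norm, ← ENNReal.ofReal_sum_of_nonneg (fun i _ ↦ by positivity),
      ← ENNReal.ofReal_add (by positivity) (by positivity)]
    refine ENNReal.ofReal_le_ofReal (hle.trans ?_)
    gcongr with i hi
    have hre : (ρ i).re ≤ σ₀ := by
      by_contra! hlt
      exact hzero _ hlt (hρ i (mem_range.mp hi))
    rw [Complex.sq_norm, Complex.normSq_apply, Complex.sub_re, Complex.sub_im, hsre, hsim]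
    nlinarith
  calc _ ≤ ∫⁻ t in Set.Ioc (n : ℝ) (n + 1),
        (∑ i ∈ range N, ENNReal.ofReal ((δ ^ 2 + (t - (ρ i).im) ^ 2)⁻¹) +
          ENNReal.ofReal (C * ℓ)) := setLIntegral_mono' measurableSet_Ioc hpt
    _ = ∑ i ∈ range N, (∫⁻ t in Set.Ioc (n : ℝ) (n + 1),
          ENNReal.ofReal ((δ ^ 2 + (t - (ρ i).im) ^ 2)⁻¹)) + ENNReal.ofReal (C * ℓ) := by
        rw [lintegral_add_right _ measurable_const, lintegral_finsetSum _ (fun i _ ↦ by fun_prop)]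
        simp
    _ ≤ ∑ i ∈ range N, ENNReal.ofReal (Real.pi / δ) + ENNReal.ofReal (C * ℓ) := by
        gcongr with i hi
        exact (setLIntegral_le_lintegral _ _).trans (lintegral_inv_sq_add_sq hδ _).le
    _ = ENNReal.ofReal (N * (Real.pi / δ) + C * ℓ) := by
        rw [sum_const, card_range, nsmul_eq_mul, ENNReal.ofReal_add (by positivity)
          (by positivity), ENNReal.ofReal_mul (Nat.cast_nonneg N), ENNReal.ofReal_natCast]
    _ ≤ _ := by
        refine ENNReal.ofReal_le_ofReal ?_
        calc (N : ℝ) * (Real.pi / δ) + C * ℓ ≤ C * ℓ * (4 / δ) + C * ℓ * (1 / δ) := by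
              have h1 : (1 : ℝ) ≤ 1 / δ := by rw [le_div_iff₀ hδ]; linarith
              have h2 : C * ℓ ≤ C * ℓ * (1 / δ) := le_mul_of_one_le_right (by positivity) h1
              have := Real.pi_le_four
              gcongr
          _ = 5 * C * ℓ / δ := by ring
          _ ≤ _ := by gcongr

open MeasureTheory in
/-- Integrability of the Riesz kernel `1 / (s (s + 1))` on vertical lines. -/
lemma integrable_inv_mul_add_one {c : ℝ} (hc : 0 < c) :
    Integrable (fun t : ℝ ↦
      (((c : ℂ) + t * Complex.I) * ((c : ℂ) + t * Complex.I + 1))⁻¹) := by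
  have hre (t : ℝ) : ((c : ℂ) + t * Complex.I).re = c := by simp
  have hne (t : ℝ) : (c : ℂ) + t * Complex.I ≠ 0 := fun h ↦ by
    have := hre t
    rw [h] at this
    exact hc.ne this
  have hne' (t : ℝ) : (c : ℂ) + t * Complex.I + 1 ≠ 0 := fun h ↦ by
    have : ((c : ℂ) + t * Complex.I + 1).re = c + 1 := by simp
    rw [h, Complex.zero_re] at this
    linarith
  refine (integrable_inv_sq_add_sq hc 0).mono'
    (Continuous.aestronglyMeasurable ?_) (.of_forall fun t ↦ ?_)
  · exact Continuous.inv₀ (by fun_prop) fun t ↦ mul_ne_zero (hne t) (hne' t)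
  · have h1 : ‖(c : ℂ) + t * Complex.I‖ ^ 2 = c ^ 2 + (t - 0) ^ 2 := by
      rw [Complex.sq_norm, Complex.normSq_apply]
      simp
      ring
    have h2 : ‖(c : ℂ) + t * Complex.I‖ ≤ ‖(c : ℂ) + t * Complex.I + 1‖ := by
      rw [← sq_le_sq₀ (norm_nonneg _) (norm_nonneg _), Complex.sq_norm, Complex.sq_norm,
        Complex.normSq_apply, Complex.normSq_apply]
      simp
      nlinarith
    rw [norm_inv, norm_mul, ← h1, sq]
    have := norm_pos_iff.mpr (hne t)
    gcongr

open MeasureTheory in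
/-- The Mellin transform of `u ↦ max (1 - u) 0`. -/
lemma hasMellin_max_one_sub {s : ℂ} (hs : 0 < s.re) :
    HasMellin (fun u : ℝ ↦ ((max (1 - u) 0 : ℝ) : ℂ)) s (s * (s + 1))⁻¹ := by
  have h1 := hasMellin_one_Ioc hs
  have h2 := hasMellin_cpow_Ioc 1 (s := s) (by simp; linarith)
  have h := hasMellin_sub h1.1 h2.1
  have hs0 : s ≠ 0 := fun h ↦ by simp [h] at hs
  have hs1 : s + 1 ≠ 0 := fun h ↦ by
    have : (s + 1).re = s.re + 1 := by simp
    rw [h, Complex.zero_re] at this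
    linarith
  have heq : Set.EqOn (fun t : ℝ ↦ (t : ℂ) ^ (s - 1) •
      ((Set.Ioc 0 1).indicator (fun _ : ℝ ↦ (1 : ℂ)) t -
        (Set.Ioc 0 1).indicator (fun t : ℝ ↦ (t : ℂ) ^ (1 : ℂ)) t))
      (fun t : ℝ ↦ (t : ℂ) ^ (s - 1) • ((max (1 - t) 0 : ℝ) : ℂ)) (Set.Ioi 0) := by
    intro t ht
    simp only
    congr 1
    by_cases h1 : t ≤ 1
    · have hmem : t ∈ Set.Ioc (0 : ℝ) 1 := ⟨ht, h1⟩
      rw [Set.indicator_of_mem hmem, Set.indicator_of_mem hmem, max_eq_left (by linarith)]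
      simp
    · have hmem : t ∉ Set.Ioc (0 : ℝ) 1 := fun h ↦ h1 h.2
      rw [Set.indicator_of_notMem hmem, Set.indicator_of_notMem hmem, max_eq_right (by linarith)]
      simp
  refine ⟨h.1.congr_fun heq measurableSet_Ioi, ?_⟩
  have h3 := h.2
  rw [mellin, setIntegral_congr_fun measurableSet_Ioi heq, h1.2, h2.2] at h3
  rw [mellin, h3]
  field_simp
  ring

open MeasureTheory in
/-- The truncated first-degree kernel as a vertical integral. -/
lemma max_one_sub_eq_integral {c : ℝ} (hc : 0 < c) {u : ℝ} (hu : 0 < u) :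
    ((max (1 - u) 0 : ℝ) : ℂ) = (2 * Real.pi : ℂ)⁻¹ * ∫ t : ℝ,
      (u : ℂ) ^ (-((c : ℂ) + t * Complex.I)) *
        (((c : ℂ) + t * Complex.I) * ((c : ℂ) + t * Complex.I + 1))⁻¹ := by
  have hre (t : ℝ) : 0 < ((c : ℂ) + t * Complex.I).re := by simpa using hc
  have hm (t : ℝ) := hasMellin_max_one_sub (hre t)
  have hinv := mellinInv_mellin_eq c (fun u : ℝ ↦ ((max (1 - u) 0 : ℝ) : ℂ)) hu
    (hasMellin_max_one_sub (by simpa using hc)).1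
    ((integrable_inv_mul_add_one hc).congr (.of_forall fun t ↦ (hm t).2.symm))
    (by fun_prop)
  rw [← hinv, mellinInv]
  simp_rw [(hm _).2, smul_eq_mul, Complex.real_smul]
  push_cast
  rw [one_div]

open MeasureTheory in
/-- Perron's formula with the Riesz kernel of order one. -/
lemma hasSum_mul_max_sub {a : ℕ → ℂ} (ha0 : a 0 = 0) {c : ℝ} (hc : 0 < c)
    (ha : LSeriesSummable a c) {X : ℝ} (hX : 0 < X) :
    HasSum (fun n : ℕ ↦ a n * ((max (X - n) 0 : ℝ) : ℂ))
      ((2 * Real.pi : ℂ)⁻¹ * ∫ t : ℝ, LSeries a ((c : ℂ) + t * Complex.I) *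
        ((X : ℂ) ^ ((c : ℂ) + t * Complex.I + 1) *
          (((c : ℂ) + t * Complex.I) * ((c : ℂ) + t * Complex.I + 1))⁻¹)) := by
  have hX0 : (X : ℂ) ≠ 0 := by exact_mod_cast hX.ne'
  set k : ℝ → ℂ := fun t ↦ (X : ℂ) ^ ((c : ℂ) + t * Complex.I + 1) *
    (((c : ℂ) + t * Complex.I) * ((c : ℂ) + t * Complex.I + 1))⁻¹ with hk
  have hkint : Integrable k := by
    refine (integrable_inv_mul_add_one hc).bdd_mul (c := X ^ (c + 1))
      (Continuous.aestronglyMeasurable ?_) (.of_forall fun t ↦ ?_)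
    · exact Continuous.const_cpow (by fun_prop) (Or.inl hX0)
    · rw [Complex.norm_cpow_eq_rpow_re_of_pos hX]
      simp
  have hterm (n : ℕ) (t : ℝ) : ‖LSeries.term a ((c : ℂ) + t * Complex.I) n‖ =
      ‖LSeries.term a c n‖ := by
    simp [LSeries.norm_term_eq]
  have hmeas (n : ℕ) : Continuous fun t : ℝ ↦ LSeries.term a ((c : ℂ) + t * Complex.I) n := by
    rcases eq_or_ne n 0 with rfl | hn
    · simp only [LSeries.term_zero]; fun_prop
    · simp only [LSeries.term_of_ne_zero hn]
      refine continuous_const.div (Continuous.const_cpow (by fun_prop) (Or.inl ?_)) fun t ↦ ?_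
      · exact_mod_cast hn
      · exact (Complex.cpow_ne_zero_iff_of_exponent_ne_zero (fun h ↦ by
          have : ((c : ℂ) + t * Complex.I).re = c := by simp
          rw [h, Complex.zero_re] at this
          exact hc.ne this)).mpr (by exact_mod_cast hn)
  have hinteg (n : ℕ) : Integrable fun t : ℝ ↦
      LSeries.term a ((c : ℂ) + t * Complex.I) n * k t :=
    hkint.bdd_mul (hmeas n).aestronglyMeasurable (.of_forall fun t ↦ (hterm n t).le)
  have hsum : Summable fun n : ℕ ↦
      ∫ t : ℝ, ‖LSeries.term a ((c : ℂ) + t * Complex.I) n * k t‖ := by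
    simp_rw [norm_mul, hterm, integral_const_mul]
    exact (Summable.norm ha).mul_right _
  have h := (hasSum_integral_of_summable_integral_norm hinteg hsum).mul_left (2 * Real.pi : ℂ)⁻¹
  simp_rw [tsum_mul_right] at h
  refine h.congr_fun fun n ↦ ?_
  rcases eq_or_ne n 0 with rfl | hn
  · simp [ha0]
  have hn0 : (0 : ℝ) < n := by positivity
  have hmax : (max (X - n) 0 : ℝ) = X * max (1 - n / X) 0 := by
    rw [mul_max_of_nonneg _ _ hX.le]
    congr 1
    · field_simp
    · simp
  rw [hmax, Complex.ofReal_mul, max_one_sub_eq_integral hc (div_pos hn0 hX),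
    mul_left_comm (X : ℂ), mul_left_comm (a n), ← integral_const_mul, ← integral_const_mul]
  congr 1
  refine integral_congr_ae (.of_forall fun t ↦ ?_)
  simp only
  rw [LSeries.term_of_ne_zero hn, hk]
  have h1 : ((n / X : ℝ) : ℂ) ^ (-((c : ℂ) + t * Complex.I)) =
      (X : ℂ) ^ ((c : ℂ) + t * Complex.I) / (n : ℂ) ^ ((c : ℂ) + t * Complex.I) := by
    rw [div_eq_mul_inv, Complex.ofReal_mul, Complex.mul_cpow_ofReal_nonneg hn0.le (by positivity),
      Complex.ofReal_inv, Complex.inv_cpow _ _ (by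
        rw [Complex.arg_ofReal_of_nonneg hX.le]; exact Real.pi_pos.ne),
      Complex.cpow_neg, Complex.cpow_neg, inv_inv]
    simp; ring
  rw [h1]
  simp only
  rw [Complex.cpow_add _ 1 hX0, Complex.cpow_one]
  ring

open ArithmeticFunction in
/-- The Dirichlet series of `(L'/L)'`. -/
lemma DirichletCharacter.deriv_logDeriv_LFunction_eq_LSeries {m : ℕ} [NeZero m]
    (χ : DirichletCharacter ℂ m) {s : ℂ} (hs : 1 < s.re) :
    LSeriesSummable (fun n : ℕ ↦ Complex.log n * (χ n * vonMangoldt n)) s ∧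
    deriv (logDeriv χ.LFunction) s =
      LSeries (fun n : ℕ ↦ Complex.log n * (χ n * vonMangoldt n)) s := by
  set f : ℕ → ℂ := (fun n : ℕ ↦ χ (n : ZMod m)) * fun n : ℕ ↦ (vonMangoldt n : ℂ) with hf
  have habs : LSeries.abscissaOfAbsConv f < s.re := by
    have hle : LSeries.abscissaOfAbsConv f ≤ (1 : ℝ) :=
      LSeries.abscissaOfAbsConv_le_of_forall_lt_LSeriesSummable' fun y hy ↦
        χ.LSeriesSummable_twist_vonMangoldt (by simpa using EReal.coe_lt_coe_iff.mp hy)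
    exact hle.trans_lt (EReal.coe_lt_coe_iff.mpr hs)
  refine ⟨LSeriesSummable_logMul_of_lt_re habs, ?_⟩
  have heq : logDeriv χ.LFunction =ᶠ[nhds s] fun z ↦ -LSeries f z := by
    filter_upwards [(isOpen_lt continuous_const Complex.continuous_re).mem_nhds hs] with z hz
    rw [χ.LSeries_twist_vonMangoldt_eq hz, logDeriv_apply, χ.LFunction_eq_LSeries hz,
      χ.deriv_LFunction_eq_deriv_LSeries hz, neg_div, neg_neg]
  rw [heq.deriv_eq, deriv.fun_neg, LSeries_deriv habs, neg_neg]
  rfl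

open MeasureTheory Filter Topology in
/-- Shifting a vertical line integral across a strip where the integrand is holomorphic and
decays. -/
lemma integral_vertical_eq_of_differentiableOn {H : ℂ → ℂ} {σ c B : ℝ} (hσc : σ ≤ c)
    (hH : DifferentiableOn ℂ H {s | σ ≤ s.re ∧ s.re ≤ c})
    (hb : ∀ s : ℂ, σ ≤ s.re → s.re ≤ c → ‖H s‖ ≤ B * (1 + |s.im|) ^ (-(3 / 2) : ℝ)) :
    Integrable (fun t : ℝ ↦ H (σ + t * Complex.I)) ∧
      ∫ t : ℝ, H (σ + t * Complex.I) = ∫ t : ℝ, H (c + t * Complex.I) := by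
  have hinteg : ∀ a : ℝ, σ ≤ a → a ≤ c → Integrable (fun t : ℝ ↦ H (a + t * Complex.I)) := by
    intro a h1 h2
    have hdom : Integrable fun t : ℝ ↦ B * (1 + ‖t‖) ^ (-(3 / 2) : ℝ) :=
      (integrable_one_add_norm (by simp; norm_num)).const_mul _
    refine hdom.mono' (Continuous.aestronglyMeasurable ?_) (.of_forall fun t ↦ ?_)
    · exact hH.continuousOn.comp_continuous (by fun_prop) fun t ↦ by simp [h1, h2]
    · simpa using hb (a + t * Complex.I) (by simpa using h1) (by simpa using h2)
  refine ⟨hinteg σ le_rfl hσc, ?_⟩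
  have hlim : ∀ a : ℝ, σ ≤ a → a ≤ c → Tendsto (fun T : ℝ ↦ ∫ t in (-T)..T,
      H (a + t * Complex.I)) atTop (𝓝 (∫ t : ℝ, H (a + t * Complex.I))) := fun a h1 h2 ↦
    intervalIntegral_tendsto_integral (hinteg a h1 h2) tendsto_neg_atTop_atBot tendsto_id
  have hdecay : Tendsto (fun T : ℝ ↦ B * (1 + T) ^ (-(3 / 2) : ℝ) * |c - σ|) atTop (𝓝 0) := by
    have h1 : Tendsto (fun T : ℝ ↦ (1 + T) ^ (-(3 / 2) : ℝ)) atTop (𝓝 0) :=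
      (tendsto_rpow_neg_atTop (by norm_num : (0 : ℝ) < 3 / 2)).comp
        (tendsto_atTop_add_const_left _ 1 tendsto_id)
    simpa using (h1.const_mul B).mul_const |c - σ|
  have hhor : ∀ ε : ℝ, |ε| = 1 → Tendsto (fun T : ℝ ↦ ∫ x in σ..c,
      H (x + ((ε * T : ℝ) : ℂ) * Complex.I)) atTop (𝓝 0) := by
    intro ε hε
    refine squeeze_zero_norm' ?_ hdecay
    filter_upwards [eventually_ge_atTop 0] with T hT
    refine intervalIntegral.norm_integral_le_of_norm_le_const fun x hx ↦ ?_
    rw [Set.uIoc_of_le hσc] at hx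
    have := hb (x + ((ε * T : ℝ) : ℂ) * Complex.I) (by simpa using hx.1.le) (by simpa using hx.2)
    simpa [abs_mul, hε, abs_of_nonneg hT] using this
  have hrect : ∀ T : ℝ,
      ((∫ x in σ..c, H (x + ((-1 * T : ℝ) : ℂ) * Complex.I)) -
        ∫ x in σ..c, H (x + ((1 * T : ℝ) : ℂ) * Complex.I)) +
        Complex.I • (∫ t in (-T)..T, H (c + t * Complex.I)) -
        Complex.I • (∫ t in (-T)..T, H (σ + t * Complex.I)) = 0 := by
    intro T
    have := Complex.integral_boundary_rect_eq_zero_of_differentiableOn H (⟨σ, -T⟩ : ℂ) ⟨c, T⟩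
      (hH.mono fun s hs ↦ by
        rw [Complex.mem_reProdIm, Set.uIcc_of_le hσc] at hs
        exact hs.1)
    simpa using this
  have h0 := (((hhor (-1) (by simp)).sub (hhor 1 (by simp))).add
    ((hlim c hσc le_rfl).const_smul Complex.I)).sub ((hlim σ le_rfl hσc).const_smul Complex.I)
  simp_rw [hrect] at h0
  have h1 := tendsto_nhds_unique h0 tendsto_const_nhds
  rw [sub_zero, zero_add, smul_eq_mul, smul_eq_mul, ← mul_sub] at h1
  exact (sub_eq_zero.mp ((mul_eq_zero.mp h1).resolve_left Complex.I_ne_zero)).symm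

/-- Lower bound for the modulus of a complex number to the right of `1 / 2`. -/
lemma one_add_abs_im_le_three_mul_norm {s : ℂ} (hs : 1 / 2 ≤ s.re) :
    1 + |s.im| ≤ 3 * ‖s‖ := by
  linarith [Complex.re_le_norm s, Complex.abs_im_le_norm s]

/-- Lower bound for the Riesz kernel denominator. -/
lemma one_add_abs_im_sq_le_norm_mul {s : ℂ} (hs : 1 / 2 ≤ s.re) :
    (1 + |s.im|) ^ 2 ≤ 9 * ‖s * (s + 1)‖ := by
  have h1 := one_add_abs_im_le_three_mul_norm hs
  have h2 := one_add_abs_im_le_three_mul_norm (s := s + 1) (by simp; linarith)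
  simp only [Complex.add_im, Complex.one_im, add_zero] at h2
  rw [norm_mul]
  nlinarith [abs_nonneg s.im]

open MeasureTheory ArithmeticFunction in
/-- Perron's formula for `(L'/L)'` on a vertical line to the right of the zeros. -/
lemma DirichletCharacter.hasSum_log_mul_twist_vonMangoldt_mul_max_sub {m : ℕ} [NeZero m]
    {χ : DirichletCharacter ℂ m} (hχ : χ ≠ 1) {σ₀ : ℝ} (hσ₀ : 1 / 2 < σ₀)
    (hzero : ∀ z : ℂ, σ₀ < z.re → χ.LFunction z ≠ 0) {σ : ℝ} (hσ : σ₀ < σ) (hσ2 : σ ≤ 2)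
    {X : ℝ} (hX : 1 ≤ X) :
    Integrable (fun t : ℝ ↦ deriv (logDeriv χ.LFunction) ((σ : ℂ) + t * Complex.I) *
        ((X : ℂ) ^ ((σ : ℂ) + t * Complex.I + 1) *
          (((σ : ℂ) + t * Complex.I) * ((σ : ℂ) + t * Complex.I + 1))⁻¹)) ∧
    HasSum (fun n : ℕ ↦ Complex.log n * (χ n * vonMangoldt n) * ((max (X - n) 0 : ℝ) : ℂ))
      ((2 * Real.pi : ℂ)⁻¹ * ∫ t : ℝ, deriv (logDeriv χ.LFunction) ((σ : ℂ) + t * Complex.I) *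
        ((X : ℂ) ^ ((σ : ℂ) + t * Complex.I + 1) *
          (((σ : ℂ) + t * Complex.I) * ((σ : ℂ) + t * Complex.I + 1))⁻¹)) := by
  have hX0 : 0 < X := by linarith
  have hXc : (X : ℂ) ≠ 0 := by exact_mod_cast hX0.ne'
  obtain ⟨C, hC, hG⟩ := exists_norm_deriv_logDeriv_LFunction_le hχ hσ₀ hzero
  set H : ℂ → ℂ := fun s ↦ deriv (logDeriv χ.LFunction) s *
    ((X : ℂ) ^ (s + 1) * (s * (s + 1))⁻¹) with hHdef
  have hdiff : DifferentiableOn ℂ H {s | σ ≤ s.re ∧ s.re ≤ 2} := by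
    intro s hs
    have hs' : σ₀ < s.re := hσ.trans_le hs.1
    have hL := differentiable_LFunction hχ
    have hopen : IsOpen {z : ℂ | σ₀ < z.re} := isOpen_lt continuous_const Complex.continuous_re
    have hlog : DifferentiableOn ℂ (logDeriv χ.LFunction) {z : ℂ | σ₀ < z.re} := fun z hz ↦
      (((hL.contDiff (n := 2)).differentiable_deriv_two z).div (hL z)
        (hzero z hz)).differentiableWithinAt
    have h1 := (hlog.deriv hopen).differentiableAt (hopen.mem_nhds hs')
    have hs0 : s ≠ 0 := fun h ↦ by simp [h] at hs'; linarith
    have hs1 : s + 1 ≠ 0 := fun h ↦ by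
      have : (s + 1).re = s.re + 1 := by simp
      rw [h, Complex.zero_re] at this
      linarith
    have h2 : DifferentiableAt ℂ (fun s : ℂ ↦ (X : ℂ) ^ (s + 1)) s :=
      DifferentiableAt.const_cpow (by fun_prop) (Or.inl hXc)
    have h3 : DifferentiableAt ℂ (fun s : ℂ ↦ (s * (s + 1))⁻¹) s :=
      DifferentiableAt.inv (by fun_prop) (mul_ne_zero hs0 hs1)
    exact (h1.mul (h2.mul h3)).differentiableWithinAt
  have hbound : ∀ s : ℂ, σ ≤ s.re → s.re ≤ 2 →
      ‖H s‖ ≤ (C * (((σ - σ₀) ^ 2)⁻¹ + 1) * X ^ 3 * 54) * (1 + |s.im|) ^ (-(3 / 2) : ℝ) := by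
    intro s h1 h2
    set u := 1 + |s.im| with hu
    have hu1 : 1 ≤ u := by simp [hu]
    have hlog : Real.log (|s.im| + 3) ≤ 6 * u ^ (1 / 2 : ℝ) := by
      have := Real.log_le_rpow_div (x := |s.im| + 3) (by positivity)
        (by norm_num : (0 : ℝ) < 1 / 2)
      have h3 : (|s.im| + 3) ^ (1 / 2 : ℝ) ≤ (9 * u) ^ (1 / 2 : ℝ) := by
        gcongr
        linarith [abs_nonneg s.im]
      rw [Real.mul_rpow (by norm_num) (by positivity), ← Real.sqrt_eq_rpow 9,
        show (9 : ℝ) = 3 ^ 2 by norm_num, Real.sqrt_sq (by norm_num)] at h3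
      linarith
    have hker : ‖(s * (s + 1))⁻¹‖ ≤ 9 * (u ^ 2)⁻¹ := by
      have h3 := one_add_abs_im_sq_le_norm_mul (s := s) (by linarith)
      rw [norm_inv]
      calc ‖s * (s + 1)‖⁻¹ ≤ (u ^ 2 / 9)⁻¹ := by
            gcongr
            linarith
        _ = _ := by field_simp
    have hpow : ‖(X : ℂ) ^ (s + 1)‖ ≤ X ^ 3 := by
      rw [Complex.norm_cpow_eq_rpow_re_of_pos hX0, ← Real.rpow_natCast]
      refine Real.rpow_le_rpow_of_exponent_le hX ?_
      simp; linarith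
    have hGs : ‖deriv (logDeriv χ.LFunction) s‖ ≤
        C * (6 * u ^ (1 / 2 : ℝ)) * (((σ - σ₀) ^ 2)⁻¹ + 1) := by
      refine (hG s (by linarith) h2).trans ?_
      have : 0 < σ - σ₀ := by linarith
      gcongr
    have hcomb : u ^ (1 / 2 : ℝ) * (u ^ 2)⁻¹ = u ^ (-(3 / 2) : ℝ) := by
      rw [← Real.rpow_natCast, ← Real.rpow_neg (by positivity), ← Real.rpow_add (by positivity)]
      norm_num
    rw [hHdef, norm_mul, norm_mul]
    calc _ ≤ C * (6 * u ^ (1 / 2 : ℝ)) * (((σ - σ₀) ^ 2)⁻¹ + 1) * (X ^ 3 * (9 * (u ^ 2)⁻¹)) := by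
          gcongr
      _ = (C * (((σ - σ₀) ^ 2)⁻¹ + 1) * X ^ 3 * 54) * (u ^ (1 / 2 : ℝ) * (u ^ 2)⁻¹) := by ring
      _ = _ := by rw [hcomb]
  obtain ⟨hinteg, heq⟩ := integral_vertical_eq_of_differentiableOn hσ2 hdiff hbound
  refine ⟨hinteg, ?_⟩
  have hre (t : ℝ) : 1 < (((2 : ℝ) : ℂ) + t * Complex.I).re := by simp
  have hP := hasSum_mul_max_sub (a := fun n : ℕ ↦ Complex.log n * (χ n * vonMangoldt n))
    (by simp) (c := 2) (by norm_num)
    (χ.deriv_logDeriv_LFunction_eq_LSeries (s := ((2 : ℝ) : ℂ)) (by simp)).1 hX0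
  simp_rw [← (χ.deriv_logDeriv_LFunction_eq_LSeries (hre _)).2] at hP
  rw [← heq] at hP
  exact hP

open MeasureTheory Filter Topology in
/-- The integral of `(1 + |u|) ^ (-1 - η)` over the real line. -/
lemma lintegral_one_add_abs_rpow {η : ℝ} (hη : 0 < η) :
    ∫⁻ u : ℝ, ENNReal.ofReal ((1 + |u|) ^ (-1 - η)) = ENNReal.ofReal (2 / η) := by
  have hinteg : Integrable fun u : ℝ ↦ (1 + |u|) ^ (-1 - η) := by
    have := integrable_one_add_norm (E := ℝ) (μ := volume) (r := 1 + η) (by simpa using hη)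
    refine this.congr (.of_forall fun u ↦ ?_)
    simp only [Real.norm_eq_abs]
    ring_nf
  rw [← ofReal_integral_eq_lintegral_ofReal hinteg (.of_forall fun t ↦ by positivity)]
  congr 1
  rw [integral_comp_abs (f := fun u : ℝ ↦ (1 + u) ^ (-1 - η))]
  have hderiv : ∀ x ∈ Set.Ici (0 : ℝ),
      HasDerivAt (fun u : ℝ ↦ -(1 + u) ^ (-η) / η) ((1 + x) ^ (-1 - η)) x := by
    intro x hx
    have hx' : (0 : ℝ) ≤ x := hx
    have h1 : HasDerivAt (fun u : ℝ ↦ 1 + u) 1 x := (hasDerivAt_id x).const_add 1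
    have h2 := ((h1.rpow_const (p := -η) (Or.inl (by positivity))).neg).div_const η
    refine h2.congr_deriv ?_
    rw [show -1 - η = -η - 1 by ring]
    field_simp
  have hlim : Tendsto (fun u : ℝ ↦ -(1 + u) ^ (-η) / η) atTop (𝓝 0) := by
    have h1 : Tendsto (fun u : ℝ ↦ (1 + u) ^ (-η)) atTop (𝓝 0) :=
      (tendsto_rpow_neg_atTop hη).comp (tendsto_atTop_add_const_left _ 1 tendsto_id)
    simpa using h1.neg.div_const η
  rw [integral_Ioi_of_hasDerivAt_of_nonneg' hderiv (fun x hx ↦ by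
    have : (0 : ℝ) < x := hx
    positivity) hlim]
  simp
  ring

open MeasureTheory in
/-- A function with bounded mass on unit intervals is integrable against
`(1 + |t|) ^ (-1 - η)`. -/
lemma lintegral_mul_one_add_abs_rpow_le {g : ℝ → ENNReal} {B : ENNReal}
    (hg : ∀ n : ℤ, ∫⁻ t in Set.Ioc (n : ℝ) (n + 1), g t ≤ B) {η : ℝ} (hη : 0 < η) (hη1 : η ≤ 1) :
    ∫⁻ t : ℝ, ENNReal.ofReal ((1 + |t|) ^ (-1 - η)) * g t ≤ ENNReal.ofReal (8 / η) * B := by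
  set w : ℝ → ENNReal := fun t ↦ ENNReal.ofReal ((1 + |t|) ^ (-1 - η)) with hw
  have hwm : Measurable w := by fun_prop
  have hcomp : ∀ (n : ℤ), ∀ t ∈ Set.Ioc (n : ℝ) (n + 1), ∀ u ∈ Set.Ioc (n : ℝ) (n + 1),
      w t ≤ 4 * w u := by
    intro n t ht u hu
    have h1 : 1 + |u| ≤ 2 * (1 + |t|) := by
      have h2 : |u - t| ≤ 1 := by
        rw [abs_le]
        constructor <;> linarith [ht.1, ht.2, hu.1, hu.2]
      have h3 := abs_add_le t (u - t)
      rw [add_sub_cancel] at h3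
      linarith [abs_nonneg t]
    have h4 : (1 + |t|) ^ (-1 - η) ≤ 4 * (1 + |u|) ^ (-1 - η) := by
      have h5 : (2 * (1 + |t|)) ^ (-1 - η) ≤ (1 + |u|) ^ (-1 - η) :=
        Real.rpow_le_rpow_of_nonpos (by positivity) h1 (by linarith)
      rw [Real.mul_rpow (by norm_num) (by positivity)] at h5
      have h6 : (1 / 4 : ℝ) ≤ 2 ^ (-1 - η) := by
        calc (1 / 4 : ℝ) = 2 ^ (-2 : ℝ) := by
              rw [Real.rpow_neg (by norm_num)]; norm_num
          _ ≤ _ := Real.rpow_le_rpow_of_exponent_le (by norm_num) (by linarith)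
      have h7 : (0 : ℝ) ≤ (1 + |t|) ^ (-1 - η) := by positivity
      nlinarith
    calc w t ≤ ENNReal.ofReal (4 * (1 + |u|) ^ (-1 - η)) := ENNReal.ofReal_le_ofReal h4
      _ = 4 * w u := by rw [ENNReal.ofReal_mul (by norm_num)]; simp [hw]
  have hwin : ∀ n : ℤ, ∫⁻ t in Set.Ioc (n : ℝ) (n + 1), w t * g t ≤
      ∫⁻ u in Set.Ioc (n : ℝ) (n + 1), 4 * w u * B := by
    intro n
    calc ∫⁻ t in Set.Ioc (n : ℝ) (n + 1), w t * g t
        = ∫⁻ _ in Set.Ioc (n : ℝ) (n + 1), ∫⁻ t in Set.Ioc (n : ℝ) (n + 1), w t * g t := by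
          simp
      _ ≤ ∫⁻ u in Set.Ioc (n : ℝ) (n + 1), 4 * w u * B := by
          refine setLIntegral_mono' measurableSet_Ioc fun u hu ↦ ?_
          calc _ ≤ ∫⁻ t in Set.Ioc (n : ℝ) (n + 1), 4 * w u * g t :=
                setLIntegral_mono' measurableSet_Ioc fun t ht ↦ by
                  gcongr
                  exact hcomp n t ht u hu
            _ = 4 * w u * ∫⁻ t in Set.Ioc (n : ℝ) (n + 1), g t :=
                lintegral_const_mul' _ _
                  (ENNReal.mul_ne_top (by simp) ENNReal.ofReal_ne_top)
            _ ≤ _ := by gcongr; exact hg n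
  have hsplit : ∀ f : ℝ → ENNReal,
      ∫⁻ t, f t = ∑' n : ℤ, ∫⁻ t in Set.Ioc (n : ℝ) (n + 1), f t := fun f ↦ by
    rw [← lintegral_iUnion (fun n ↦ measurableSet_Ioc) (Set.pairwise_disjoint_Ioc_intCast ℝ),
      iUnion_Ioc_intCast, setLIntegral_univ]
  calc ∫⁻ t, w t * g t = ∑' n : ℤ, ∫⁻ t in Set.Ioc (n : ℝ) (n + 1), w t * g t := hsplit _
    _ ≤ ∑' n : ℤ, ∫⁻ u in Set.Ioc (n : ℝ) (n + 1), 4 * w u * B := ENNReal.tsum_le_tsum hwin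
    _ = ∫⁻ u, 4 * w u * B := (hsplit _).symm
    _ = 4 * ENNReal.ofReal (2 / η) * B := by
        rw [lintegral_mul_const _ (by fun_prop), lintegral_const_mul _ hwm,
          lintegral_one_add_abs_rpow hη]
    _ = ENNReal.ofReal (8 / η) * B := by
        rw [show (8 / η : ℝ) = 4 * (2 / η) by ring, ENNReal.ofReal_mul (by norm_num)]
        simp

open MeasureTheory in
/-- Weighted mean bound for `(L'/L)'` on a vertical line at distance `δ` from the zeros. -/
lemma DirichletCharacter.exists_lintegral_weighted_deriv_logDeriv_LFunction_le {m : ℕ} [NeZero m]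
    {χ : DirichletCharacter ℂ m} (hχ : χ ≠ 1) {σ₀ : ℝ} (hσ₀ : 1 / 2 < σ₀)
    (hzero : ∀ z : ℂ, σ₀ < z.re → χ.LFunction z ≠ 0) :
    ∃ C : ℝ, 0 < C ∧ ∀ δ : ℝ, 0 < δ → δ ≤ 1 → σ₀ + δ ≤ 2 →
      ∫⁻ t : ℝ, ENNReal.ofReal ((1 + |t|) ^ (-1 - δ)) *
        ‖deriv (logDeriv χ.LFunction) ((σ₀ + δ : ℝ) + t * Complex.I)‖ₑ ≤
        ENNReal.ofReal (C / δ ^ 3) := by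
  obtain ⟨C, hC, h⟩ := exists_lintegral_deriv_logDeriv_LFunction_le hχ hσ₀ hzero
  refine ⟨160 * C, by positivity, fun δ hδ hδ1 hδ2 ↦ ?_⟩
  set G : ℝ → ENNReal := fun t ↦
    ‖deriv (logDeriv χ.LFunction) ((σ₀ + δ : ℝ) + t * Complex.I)‖ₑ with hG
  have hwin : ∀ n : ℤ, ∫⁻ t in Set.Ioc (n : ℝ) (n + 1),
      ENNReal.ofReal ((1 + |t|) ^ (-(δ / 2))) * G t ≤ ENNReal.ofReal (10 * C / δ ^ 2) := by
    intro n
    set ℓ := Real.log (|(n : ℝ)| + 4) with hℓ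
    have hℓ0 : 0 < ℓ := Real.log_pos (by linarith [abs_nonneg (n : ℝ)])
    have hpt : ∀ t ∈ Set.Ioc (n : ℝ) (n + 1), (1 + |t|) ^ (-(δ / 2)) ≤ 10 / (δ * ℓ) := by
      intro t ht
      have h1 : |(n : ℝ)| + 4 ≤ 5 * (1 + |t|) := by
        have h2 : |n - t| ≤ 1 := by
          rw [abs_le]
          constructor <;> linarith [ht.1, ht.2]
        have h3 := abs_add_le t (n - t)
        rw [add_sub_cancel] at h3
        linarith [abs_nonneg t]
      have h4 : ℓ ≤ (|(n : ℝ)| + 4) ^ (δ / 2) / (δ / 2) :=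
        Real.log_le_rpow_div (by positivity) (by positivity)
      have h5 : (|(n : ℝ)| + 4) ^ (δ / 2) ≤ 5 * (1 + |t|) ^ (δ / 2) := by
        calc (|(n : ℝ)| + 4) ^ (δ / 2) ≤ (5 * (1 + |t|)) ^ (δ / 2) := by gcongr
          _ = 5 ^ (δ / 2) * (1 + |t|) ^ (δ / 2) := Real.mul_rpow (by norm_num) (by positivity)
          _ ≤ 5 ^ (1 : ℝ) * (1 + |t|) ^ (δ / 2) := by
              gcongr
              · norm_num
              · linarith
          _ = _ := by rw [Real.rpow_one]
      rw [Real.rpow_neg (by positivity), inv_le_comm₀ (by positivity) (by positivity), inv_div]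
      rw [le_div_iff₀ (by positivity)] at h4
      linarith
    calc _ ≤ ∫⁻ t in Set.Ioc (n : ℝ) (n + 1), ENNReal.ofReal (10 / (δ * ℓ)) * G t :=
          setLIntegral_mono' measurableSet_Ioc fun t ht ↦ by
            gcongr
            exact hpt t ht
      _ = ENNReal.ofReal (10 / (δ * ℓ)) * ∫⁻ t in Set.Ioc (n : ℝ) (n + 1), G t :=
          lintegral_const_mul' _ _ ENNReal.ofReal_ne_top
      _ ≤ ENNReal.ofReal (10 / (δ * ℓ)) * ENNReal.ofReal (C * ℓ / δ) := by
          gcongr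
          exact h δ hδ hδ1 hδ2 n
      _ = _ := by
          rw [← ENNReal.ofReal_mul (by positivity)]
          congr 1
          field_simp
  have hmain := lintegral_mul_one_add_abs_rpow_le hwin (half_pos hδ) (by linarith)
  calc ∫⁻ t : ℝ, ENNReal.ofReal ((1 + |t|) ^ (-1 - δ)) * G t
      = ∫⁻ t : ℝ, ENNReal.ofReal ((1 + |t|) ^ (-1 - δ / 2)) *
          (ENNReal.ofReal ((1 + |t|) ^ (-(δ / 2))) * G t) := by
        congr 1 with t
        rw [← mul_assoc, ← ENNReal.ofReal_mul (by positivity), ← Real.rpow_add (by positivity),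
          show -1 - δ / 2 + -(δ / 2) = -1 - δ by ring]
    _ ≤ ENNReal.ofReal (8 / (δ / 2)) * ENNReal.ofReal (10 * C / δ ^ 2) := hmain
    _ = ENNReal.ofReal (160 * C / δ ^ 3) := by
        rw [← ENNReal.ofReal_mul (by positivity)]
        congr 1
        field_simp
        norm_num

/-- Bound for the smoothed Perron kernel. -/
lemma norm_smoothed_kernel_le {x δ σ : ℝ} (hx : 1 ≤ x) (hδ : 0 ≤ δ) (hδ1 : δ ≤ 1)
    (hσ : 1 / 2 ≤ σ) (hσ2 : σ ≤ 2) (t : ℝ) :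
    ‖(((x + √x : ℝ) : ℂ) ^ ((σ : ℂ) + t * Complex.I + 1) -
        (x : ℂ) ^ ((σ : ℂ) + t * Complex.I + 1)) *
      (((σ : ℂ) + t * Complex.I) * ((σ : ℂ) + t * Complex.I + 1))⁻¹‖ ≤
      √x * (144 * x ^ σ * x ^ (δ / 2) * (1 + |t|) ^ (-1 - δ)) := by
  have hx0 : 0 < x := by linarith
  set h := √x with hh
  have hh0 : 0 < h := Real.sqrt_pos.mpr hx0
  have hsq : h * h = x := Real.mul_self_sqrt hx0.le
  have hhx : h ≤ x := by nlinarith [Real.one_le_sqrt.mpr hx]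
  set s : ℂ := (σ : ℂ) + t * Complex.I with hs
  have hsre : s.re = σ := by simp [hs]
  have hsim : s.im = t := by simp [hs]
  set u := 1 + |t| with hu
  have hu1 : 1 ≤ u := by simp [hu]
  have hu0 : 0 < u := by linarith
  have hs1 : u ≤ 3 * ‖s‖ := by
    simpa [hsim] using one_add_abs_im_le_three_mul_norm (s := s) (by rw [hsre]; exact hσ)
  have hs2 : u ^ 2 ≤ 9 * ‖s * (s + 1)‖ := by
    simpa [hsim] using one_add_abs_im_sq_le_norm_mul (s := s) (by rw [hsre]; exact hσ)
  have hs0 : 0 < ‖s‖ := by linarith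
  have hs10 : 0 < ‖s * (s + 1)‖ := by
    have : 0 < u ^ 2 := by positivity
    linarith
  have h2σ : ∀ y : ℝ, 0 ≤ y → y ≤ 3 → (2 * x) ^ y ≤ 8 * x ^ y := by
    intro y hy hy3
    rw [Real.mul_rpow (by norm_num) hx0.le]
    gcongr
    calc (2 : ℝ) ^ y ≤ 2 ^ (3 : ℝ) := Real.rpow_le_rpow_of_exponent_le (by norm_num) hy3
      _ = 8 := by norm_num
  set K := ‖(((x + h : ℝ) : ℂ) ^ (s + 1) - (x : ℂ) ^ (s + 1)) * (s * (s + 1))⁻¹‖ / h with hK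
  have hK0 : 0 ≤ K := by positivity
  set M := 144 * x ^ σ with hM
  have hKa : K ≤ M * u ^ (-1 : ℝ) := by
    have h1 := norm_ofReal_cpow_sub_cpow_le (a := x) (b := x + h) (w := s + 1) (M := 8 * x ^ σ)
      hx0 (by linarith) (fun y hy ↦ by
        have : (s + 1).re - 1 = σ := by simp [hsre]
        rw [this]
        refine le_trans ?_ (h2σ σ (by linarith) (by linarith))
        exact Real.rpow_le_rpow (hx0.le.trans hy.1) (by linarith [hy.2]) (by linarith))
    rw [add_sub_cancel_left] at h1
    rw [hK, div_le_iff₀ hh0, norm_mul, norm_inv, ← div_eq_mul_inv, div_le_iff₀ hs10, norm_mul,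
      Real.rpow_neg_one]
    refine h1.trans ?_
    have h3 : 1 ≤ 3 * (u⁻¹ * ‖s‖) := by
      rw [← mul_inv_cancel₀ hu0.ne']
      nlinarith [inv_pos.mpr hu0]
    have h4 : 0 < x ^ σ := by positivity
    calc ‖s + 1‖ * (8 * x ^ σ) * h = 8 * (‖s + 1‖ * x ^ σ * h) * 1 := by ring
      _ ≤ 48 * (‖s + 1‖ * x ^ σ * h) * (3 * (u⁻¹ * ‖s‖)) := by gcongr; norm_num
      _ = _ := by rw [hM]; ring
  have hKb : K ≤ M * h * u ^ (-2 : ℝ) := by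
    have h1 : ‖((x + h : ℝ) : ℂ) ^ (s + 1) - (x : ℂ) ^ (s + 1)‖ ≤ 16 * x ^ (σ + 1) := by
      refine (norm_sub_le _ _).trans ?_
      rw [Complex.norm_cpow_eq_rpow_re_of_pos (by linarith),
        Complex.norm_cpow_eq_rpow_re_of_pos hx0]
      have hre : (s + 1).re = σ + 1 := by simp [hsre]
      rw [hre]
      have h3 : (x + h) ^ (σ + 1) ≤ 8 * x ^ (σ + 1) :=
        (Real.rpow_le_rpow (by positivity) (by linarith) (by linarith)).trans
          (h2σ _ (by linarith) (by linarith))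
      have : 0 ≤ x ^ (σ + 1) := by positivity
      linarith
    have hxx : x ^ (σ + 1) = x ^ σ * (h * h) := by rw [hsq, Real.rpow_add_one hx0.ne']
    have hu2 : u ^ (-2 : ℝ) = (u ^ 2)⁻¹ := by
      rw [Real.rpow_neg hu0.le]; norm_cast
    rw [hK, div_le_iff₀ hh0, norm_mul, norm_inv, ← div_eq_mul_inv, div_le_iff₀ hs10, hu2]
    refine h1.trans ?_
    have h3 : 1 ≤ 9 * ((u ^ 2)⁻¹ * ‖s * (s + 1)‖) := by
      have : 0 < u ^ 2 := by positivity
      rw [← mul_inv_cancel₀ this.ne']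
      nlinarith [inv_pos.mpr this]
    calc 16 * x ^ (σ + 1) = 16 * (x ^ σ * (h * h)) * 1 := by rw [hxx]; ring
      _ ≤ 16 * (x ^ σ * (h * h)) * (9 * ((u ^ 2)⁻¹ * ‖s * (s + 1)‖)) := by gcongr
      _ = _ := by rw [hM]; ring
  have hKδ : K ≤ M * x ^ (δ / 2) * u ^ (-1 - δ) := by
    have hM0 : 0 < M := by positivity
    clear_value M
    calc K = K ^ (1 - δ) * K ^ δ := by
          rw [← Real.rpow_add_of_nonneg hK0 (by linarith) hδ]; simp
      _ ≤ (M * u ^ (-1 : ℝ)) ^ (1 - δ) * (M * h * u ^ (-2 : ℝ)) ^ δ := by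
          gcongr
      _ = (M ^ (1 - δ) * M ^ δ) * h ^ δ * (u ^ (-1 * (1 - δ)) * u ^ (-2 * δ)) := by
          rw [Real.mul_rpow hM0.le (by positivity), Real.mul_rpow (by positivity) (by positivity),
            Real.mul_rpow hM0.le (by positivity), ← Real.rpow_mul hu0.le, ← Real.rpow_mul hu0.le]
          ring
      _ = _ := by
          rw [← Real.rpow_add hM0, ← Real.rpow_add hu0, hh, Real.sqrt_eq_rpow,
            ← Real.rpow_mul hx0.le, sub_add_cancel, Real.rpow_one,
            show -1 * (1 - δ) + -2 * δ = -1 - δ by ring, show 1 / 2 * δ = δ / 2 by ring]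
  calc _ = h * K := by rw [hK]; field_simp
    _ ≤ _ := by gcongr

open Finset in
/-- Removing the smoothing from a difference of first-order Riesz means. -/
lemma norm_sum_le_of_hasSum_mul_max_sub {a : ℕ → ℂ} {x h V : ℝ} {S₀ S₁ : ℂ} (hx : 0 ≤ x)
    (hh : 0 < h) (h₁ : HasSum (fun n : ℕ ↦ a n * ((max (x + h - n) 0 : ℝ) : ℂ)) S₁)
    (h₀ : HasSum (fun n : ℕ ↦ a n * ((max (x - n) 0 : ℝ) : ℂ)) S₀)
    (ha : ∀ n : ℕ, (n : ℝ) ≤ x + h → ‖a n‖ ≤ V) :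
    ‖∑ n ∈ Icc 0 ⌊x⌋₊, a n‖ ≤ ‖S₁ - S₀‖ / h + (h + 1) * V := by
  set w : ℕ → ℝ := fun n ↦ (max (x + h - n) 0 - max (x - n) 0) / h with hw
  have hV : 0 ≤ V := (norm_nonneg _).trans (ha 0 (by simp; linarith))
  have hsum : HasSum (fun n ↦ a n * (w n : ℂ)) ((S₁ - S₀) / h) := by
    refine ((h₁.sub h₀).div_const (h : ℂ)).congr_fun fun n ↦ ?_
    simp only [hw]
    push_cast
    ring
  have hw1 : ∀ n ∈ Icc 0 ⌊x⌋₊, w n = 1 := by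
    intro n hn
    have : (n : ℝ) ≤ x := (Nat.le_floor_iff hx).mp (mem_Icc.mp hn).2
    simp only [hw]
    rw [max_eq_left (by linarith), max_eq_left (by linarith)]
    field_simp
    ring
  have hw0 : ∀ n ∉ Icc 0 ⌊x + h⌋₊, a n * (w n : ℂ) = 0 := by
    intro n hn
    have hn' : ⌊x + h⌋₊ < n := by simpa using hn
    have : x + h < n := (Nat.floor_lt (by linarith)).mp hn'
    simp only [hw]
    rw [max_eq_right (by linarith), max_eq_right (by linarith)]
    simp
  have hwle : ∀ n, |w n| ≤ 1 := by
    intro n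
    simp only [hw]
    have h1 : max (x - n) 0 ≤ max (x + h - n) 0 := max_le_max (by linarith) le_rfl
    have h2 : max (x + h - n) 0 ≤ max (x - n) 0 + h :=
      max_le (by linarith [le_max_left (x - n) 0]) (by linarith [le_max_right (x - n) 0])
    rw [abs_le]
    constructor
    · rw [le_div_iff₀ hh]; linarith
    · rw [div_le_iff₀ hh]; linarith
  have htot : ∑ n ∈ Icc 0 ⌊x + h⌋₊, a n * (w n : ℂ) = (S₁ - S₀) / h :=
    (hasSum_sum_of_ne_finset_zero hw0).unique hsum
  have hsub : Icc 0 ⌊x⌋₊ ⊆ Icc 0 ⌊x + h⌋₊ :=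
    Icc_subset_Icc_right (Nat.floor_mono (by linarith))
  rw [← sum_sdiff hsub] at htot
  have hmain : ∑ n ∈ Icc 0 ⌊x⌋₊, a n * (w n : ℂ) = ∑ n ∈ Icc 0 ⌊x⌋₊, a n :=
    sum_congr rfl fun n hn ↦ by rw [hw1 n hn]; simp
  rw [hmain] at htot
  have herr : ‖∑ n ∈ Icc 0 ⌊x + h⌋₊ \ Icc 0 ⌊x⌋₊, a n * (w n : ℂ)‖ ≤ (h + 1) * V := by
    refine (norm_sum_le_of_le (f := fun n ↦ a n * (w n : ℂ)) _ fun n hn ↦ ?_).trans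
      (b := ∑ n ∈ Icc 0 ⌊x + h⌋₊ \ Icc 0 ⌊x⌋₊, V) ?_
    · have hn' : n ≤ ⌊x + h⌋₊ := (mem_Icc.mp (mem_sdiff.mp hn).1).2
      rw [norm_mul, Complex.norm_real, Real.norm_eq_abs]
      exact (mul_le_of_le_one_right (norm_nonneg _) (hwle n)).trans
        (ha n ((Nat.le_floor_iff (by linarith)).mp hn'))
    · rw [sum_const, nsmul_eq_mul]
      gcongr
      rw [card_sdiff_of_subset hsub, Nat.card_Icc, Nat.card_Icc,
        Nat.cast_sub (by have := Nat.floor_mono (show x ≤ x + h by linarith); omega)]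
      push_cast
      linarith [Nat.floor_le (show 0 ≤ x + h by linarith), Nat.lt_floor_add_one x]
  rw [eq_sub_of_add_eq' htot]
  refine (norm_sub_le _ _).trans (add_le_add (le_of_eq ?_) herr)
  rw [norm_div, Complex.norm_real, Real.norm_eq_abs, abs_of_pos hh]

open ArithmeticFunction in
/-- Trivial bound for the coefficients of `(L'/L)'`. -/
lemma DirichletCharacter.norm_log_mul_twist_vonMangoldt_le {m : ℕ} (χ : DirichletCharacter ℂ m)
    {n : ℕ} {y : ℝ} (hn : (n : ℝ) ≤ y) :
    ‖Complex.log n * (χ n * vonMangoldt n)‖ ≤ Real.log y ^ 2 := by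
  rcases Nat.eq_zero_or_pos n with rfl | hn0
  · simpa using sq_nonneg (Real.log y)
  have hn1 : (1 : ℝ) ≤ n := by exact_mod_cast hn0
  have hlog : 0 ≤ Real.log n := Real.log_nonneg hn1
  have hle : Real.log n ≤ Real.log y := Real.log_le_log (by linarith) hn
  rw [norm_mul, norm_mul, ← Complex.natCast_log, Complex.norm_real, Complex.norm_real,
    Real.norm_of_nonneg hlog, Real.norm_of_nonneg vonMangoldt_nonneg, sq]
  refine mul_le_mul hle ?_ (by positivity) (hlog.trans hle)
  calc ‖χ n‖ * vonMangoldt n ≤ 1 * Real.log n :=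
        mul_le_mul (χ.norm_le_one _) vonMangoldt_le_log vonMangoldt_nonneg zero_le_one
    _ ≤ Real.log y := by linarith

open Finset ArithmeticFunction MeasureTheory in
/-- Bound for the partial sums of `log n * χ n * Λ n` under a zero-free half-plane. -/
lemma DirichletCharacter.exists_norm_sum_log_mul_twist_vonMangoldt_le {m : ℕ} [NeZero m]
    {χ : DirichletCharacter ℂ m} (hχ : χ ≠ 1) {σ₀ : ℝ} (hσ₀ : 1 / 2 < σ₀) (hσ₁ : σ₀ < 1)
    (hzero : ∀ z : ℂ, σ₀ < z.re → χ.LFunction z ≠ 0) :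
    ∃ C : ℝ, 0 < C ∧ ∀ x : ℝ, 2 ≤ x →
      ‖∑ n ∈ Icc 0 ⌊x⌋₊, Complex.log n * (χ n * vonMangoldt n)‖ ≤
        C * x ^ σ₀ * Real.log x ^ 3 := by
  obtain ⟨C, hC, hG⟩ := exists_lintegral_weighted_deriv_logDeriv_LFunction_le hχ hσ₀ hzero
  refine ⟨3456 * C + 16, by positivity, fun x hx ↦ ?_⟩
  have hx0 : 0 < x := by linarith
  have hlog2 : (69 / 100 : ℝ) < Real.log x := by
    have := Real.log_le_log (by norm_num) hx
    linarith [Real.log_two_gt_d9]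
  have hlog0 : 0 < Real.log x := by linarith
  set δ := 1 / (2 * Real.log x) with hδdef
  have hδ : 0 < δ := by positivity
  have hδ1 : δ ≤ 1 := by
    rw [hδdef, div_le_one (by positivity)]; linarith
  set h := √x with hh
  have hh1 : 1 ≤ h := Real.one_le_sqrt.mpr (by linarith)
  have hhx : h ≤ x := by nlinarith [Real.mul_self_sqrt hx0.le]
  obtain ⟨hinteg₁, hsum₁⟩ := hasSum_log_mul_twist_vonMangoldt_mul_max_sub hχ hσ₀ hzero
    (σ := σ₀ + δ) (by linarith) (by linarith) (X := x + h) (by linarith)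
  obtain ⟨hinteg₀, hsum₀⟩ := hasSum_log_mul_twist_vonMangoldt_mul_max_sub hχ hσ₀ hzero
    (σ := σ₀ + δ) (by linarith) (by linarith) (X := x) (by linarith)
  have hmain := norm_sum_le_of_hasSum_mul_max_sub hx0.le (by linarith) hsum₁ hsum₀
    (V := Real.log (x + h) ^ 2) fun n hn ↦ χ.norm_log_mul_twist_vonMangoldt_le hn
  rw [← mul_sub, ← integral_sub hinteg₁ hinteg₀] at hmain
  refine hmain.trans ?_
  set A : ℝ := h * (144 * x ^ (σ₀ + δ) * x ^ (δ / 2)) with hA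
  have hA0 : 0 ≤ A := by positivity
  have hAle : A ≤ h * (432 * x ^ σ₀) := by
    have h1 : x ^ (δ + δ / 2) ≤ 3 := by
      rw [Real.rpow_def_of_pos hx0, show Real.log x * (δ + δ / 2) = 3 / 4 by
        rw [hδdef]; field_simp; norm_num]
      refine (Real.exp_le_exp.mpr (by norm_num : (3 / 4 : ℝ) ≤ 1)).trans ?_
      linarith [Real.exp_one_lt_d9]
    have h2 : x ^ (σ₀ + δ) * x ^ (δ / 2) = x ^ σ₀ * x ^ (δ + δ / 2) := by
      rw [← Real.rpow_add hx0, ← Real.rpow_add hx0]; ring_nf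
    calc A = h * (144 * x ^ σ₀ * x ^ (δ + δ / 2)) := by rw [hA, mul_assoc 144, h2, ← mul_assoc 144]
      _ ≤ h * (144 * x ^ σ₀ * 3) := by gcongr
      _ = _ := by ring
  have hbound : ∀ I : ℂ, ‖I‖ₑ ≤ ENNReal.ofReal (A * (C / δ ^ 3)) →
      ‖(2 * Real.pi : ℂ)⁻¹ * I‖ / h ≤ 3456 * C * x ^ σ₀ * Real.log x ^ 3 := by
    intro I hI
    rw [← ofReal_norm, ENNReal.ofReal_le_ofReal_iff (by positivity)] at hI
    have hpi : ‖(2 * Real.pi : ℂ)⁻¹‖ ≤ 1 := by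
      rw [norm_inv, norm_mul, Complex.norm_real, Real.norm_of_nonneg Real.pi_pos.le]
      refine inv_le_one_of_one_le₀ ?_
      simp only [Complex.norm_ofNat]
      linarith [Real.pi_gt_three]
    rw [div_le_iff₀ (by linarith), norm_mul]
    calc ‖(2 * Real.pi : ℂ)⁻¹‖ * ‖I‖ ≤ 1 * (A * (C / δ ^ 3)) := by gcongr
      _ ≤ 1 * (h * (432 * x ^ σ₀) * (C / δ ^ 3)) := by gcongr
      _ = _ := by rw [hδdef]; field_simp; ring
  have herr : (h + 1) * Real.log (x + h) ^ 2 ≤ 16 * x ^ σ₀ * Real.log x ^ 3 := by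
    have h1 : Real.log (x + h) ≤ 2 * Real.log x := by
      rw [← Nat.cast_ofNat, ← Real.log_pow]
      exact Real.log_le_log (by linarith) (by nlinarith)
    have h0 : 0 ≤ Real.log (x + h) := Real.log_nonneg (by linarith)
    have h2 : h ≤ x ^ σ₀ := by
      rw [hh, Real.sqrt_eq_rpow]
      exact Real.rpow_le_rpow_of_exponent_le (by linarith) hσ₀.le
    calc (h + 1) * Real.log (x + h) ^ 2 ≤ (2 * x ^ σ₀) * (2 * Real.log x) ^ 2 := by
          gcongr
          linarith
      _ = 8 * x ^ σ₀ * Real.log x ^ 2 * 1 := by ring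
      _ ≤ 8 * x ^ σ₀ * Real.log x ^ 2 * (2 * Real.log x) := by
          gcongr
          linarith
      _ = _ := by ring
  refine (add_le_add (hbound _ ?_) herr).trans (le_of_eq (by ring))
  refine (enorm_integral_le_lintegral_enorm _).trans ?_
  calc _ ≤ ∫⁻ t : ℝ, ENNReal.ofReal A * (ENNReal.ofReal ((1 + |t|) ^ (-1 - δ)) *
        ‖deriv (logDeriv χ.LFunction) ((σ₀ + δ : ℝ) + t * Complex.I)‖ₑ) := by
        refine lintegral_mono fun t ↦ ?_
        simp only
        rw [← mul_sub, ← sub_mul, enorm_mul, mul_comm, ← mul_assoc,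
          ← ENNReal.ofReal_mul hA0]
        gcongr
        rw [← ofReal_norm]
        refine ENNReal.ofReal_le_ofReal ((norm_smoothed_kernel_le (by linarith) hδ.le hδ1
          (by linarith) (by linarith) t).trans (le_of_eq ?_))
        rw [hA]; ring
    _ = ENNReal.ofReal A * ∫⁻ t : ℝ, ENNReal.ofReal ((1 + |t|) ^ (-1 - δ)) *
        ‖deriv (logDeriv χ.LFunction) ((σ₀ + δ : ℝ) + t * Complex.I)‖ₑ :=
        lintegral_const_mul' _ _ ENNReal.ofReal_ne_top
    _ ≤ ENNReal.ofReal A * ENNReal.ofReal (C / δ ^ 3) := by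
        gcongr
        exact hG δ hδ hδ1 (by linarith)
    _ = _ := (ENNReal.ofReal_mul hA0).symm

open MeasureTheory in
/-- Removing a logarithmic weight by partial summation. -/
lemma norm_sum_le_of_norm_sum_log_mul_le {b : ℕ → ℂ} {C σ : ℝ} (hσ : 1 / 2 ≤ σ)
    (hb0 : b 0 = 0) (hb1 : b 1 = 0)
    (hb : ∀ x : ℝ, 2 ≤ x →
      ‖∑ n ∈ Finset.Icc 0 ⌊x⌋₊, Complex.log n * b n‖ ≤ C * x ^ σ * Real.log x ^ 3)
    {x : ℝ} (hx : 2 ≤ x) :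
    ‖∑ n ∈ Finset.Icc 0 ⌊x⌋₊, b n‖ ≤ 5 * C * x ^ σ * Real.log x ^ 2 := by
  have hx0 : 0 < x := by linarith
  have hlog : ∀ t : ℝ, 2 ≤ t → (1 / 2 : ℝ) < Real.log t := fun t ht ↦ by
    have := Real.log_le_log (by norm_num) ht
    linarith [Real.log_two_gt_d9]
  have hlogx := hlog x hx
  have hC : 0 ≤ C := by
    have h1 : 0 < x ^ σ * Real.log x ^ 3 := by positivity
    have h2 := (norm_nonneg _).trans (hb x hx)
    rw [mul_assoc] at h2
    exact nonneg_of_mul_nonneg_left h2 h1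
  set f : ℝ → ℂ := fun t ↦ (((Real.log t)⁻¹ : ℝ) : ℂ) with hf
  have hderiv : ∀ t : ℝ, 2 ≤ t →
      HasDerivAt f ((-t⁻¹ / Real.log t ^ 2 : ℝ) : ℂ) t := fun t ht ↦
    ((Real.hasDerivAt_log (by linarith)).inv (by linarith [hlog t ht])).ofReal_comp
  have hderivint : IntegrableOn (deriv f) (Set.Icc 2 x) := by
    have hcont : ContinuousOn (fun t : ℝ ↦ ((-t⁻¹ / Real.log t ^ 2 : ℝ) : ℂ)) (Set.Icc 2 x) := by
      refine Complex.continuous_ofReal.comp_continuousOn (ContinuousOn.div ?_ ?_ ?_)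
      · exact (continuousOn_inv₀.mono fun t ht ↦ by
          have : (2 : ℝ) ≤ t := ht.1
          simp; linarith).neg
      · exact (Real.continuousOn_log.mono fun t ht ↦ by
          have : (2 : ℝ) ≤ t := ht.1
          simp; linarith).pow 2
      · exact fun t ht ↦ pow_ne_zero 2 (by linarith [hlog t ht.1])
    exact (hcont.integrableOn_compact isCompact_Icc).congr_fun
      (fun t ht ↦ (hderiv t ht.1).deriv.symm) measurableSet_Icc
  have habel := sum_mul_eq_sub_integral_mul₁ (fun n ↦ Complex.log n * b n) (f := f)
    (by simp) (by simp) x (fun t ht ↦ (hderiv t ht.1).differentiableAt) hderivint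
  have hleft : ∑ n ∈ Finset.Icc 0 ⌊x⌋₊, f n * (Complex.log n * b n) =
      ∑ n ∈ Finset.Icc 0 ⌊x⌋₊, b n := by
    refine Finset.sum_congr rfl fun n _ ↦ ?_
    rcases Nat.lt_or_ge n 2 with hn | hn
    · interval_cases n <;> simp [hb0, hb1]
    · have h1 := hlog n (by exact_mod_cast hn)
      have h2 : ((Real.log n : ℝ) : ℂ) ≠ 0 := by
        exact_mod_cast (by linarith : Real.log n ≠ 0)
      simp only [hf]
      rw [← Complex.natCast_log, ← mul_assoc, Complex.ofReal_inv, inv_mul_cancel₀ h2, one_mul]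
  rw [hleft] at habel
  rw [habel]
  have hfirst : ‖f x * ∑ n ∈ Finset.Icc 0 ⌊x⌋₊, Complex.log n * b n‖ ≤
      C * x ^ σ * Real.log x ^ 2 := by
    rw [norm_mul, hf, Complex.norm_real, Real.norm_of_nonneg (by positivity)]
    calc _ ≤ (Real.log x)⁻¹ * (C * x ^ σ * Real.log x ^ 3) := by
          gcongr
          exact hb x hx
      _ = _ := by field_simp
  have hsecond : ‖∫ t in Set.Ioc 2 x, deriv f t *
      ∑ n ∈ Finset.Icc 0 ⌊t⌋₊, Complex.log n * b n‖ ≤ 4 * C * x ^ σ * Real.log x ^ 2 := by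
    have hrpow : IntervalIntegrable (fun t : ℝ ↦ t ^ (σ - 1)) volume 2 x :=
      intervalIntegral.intervalIntegrable_rpow' (by linarith)
    have hdom : IntegrableOn (fun t : ℝ ↦ C * Real.log x * t ^ (σ - 1)) (Set.Ioc 2 x) :=
      ((intervalIntegrable_iff_integrableOn_Ioc_of_le hx).mp hrpow).const_mul _
    refine (norm_integral_le_of_norm_le hdom ((ae_restrict_mem measurableSet_Ioc).mono
      fun t ht ↦ ?_)).trans ?_
    · have ht2 : 2 ≤ t := ht.1.le
      have ht0 : 0 < t := by linarith
      have hlogt := hlog t ht2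
      have hlogle : Real.log t ≤ Real.log x := Real.log_le_log ht0 ht.2
      rw [(hderiv t ht2).deriv, norm_mul, Complex.norm_real, norm_div, norm_neg,
        Real.norm_of_nonneg (by positivity), Real.norm_of_nonneg (by positivity),
        Real.rpow_sub_one ht0.ne']
      calc _ ≤ t⁻¹ / Real.log t ^ 2 * (C * t ^ σ * Real.log t ^ 3) := by
            gcongr
            exact hb t ht2
        _ = C * Real.log t * (t ^ σ / t) := by field_simp
        _ ≤ _ := by gcongr
    · rw [integral_const_mul, ← intervalIntegral.integral_of_le hx,
        integral_rpow (Or.inl (by linarith)), sub_add_cancel]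
      have h1 : (x ^ σ - 2 ^ σ) / σ ≤ 2 * x ^ σ := by
        rw [div_le_iff₀ (by linarith)]
        have h3 : 0 < x ^ σ := by positivity
        have h4 : (0 : ℝ) < 2 ^ σ := by positivity
        nlinarith
      calc C * Real.log x * ((x ^ σ - 2 ^ σ) / σ) ≤ C * Real.log x * (2 * x ^ σ) := by gcongr
        _ = 2 * C * x ^ σ * Real.log x * 1 := by ring
        _ ≤ 2 * C * x ^ σ * Real.log x * (2 * Real.log x) := by
            gcongr
            linarith
        _ = _ := by ring
  refine (norm_sub_le _ _).trans ((add_le_add hfirst hsecond).trans (le_of_eq (by ring)))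

open Finset ArithmeticFunction in
/-- If `χ` is a non-trivial primitive Dirichlet character mod `m` whose `L`-function has no
zeros with `Re(s) > σ₀` for some `σ₀ ∈ (1/2, 1)`, then
`ψ(x, χ) = Σ_{n ≤ x} Λ(n) χ(n)` satisfies `|ψ(x, χ)| ≤ C · x^σ₀ · (log(m·x))²`
for all `x ≥ 2`. -/
theorem psi_bound_of_zero_free (m : ℕ) [NeZero m] (χ : DirichletCharacter ℂ m)
    (hχ : χ ≠ 1) (hprim : χ.IsPrimitive)
    (σ₀ : ℝ) (hσ₀ : 1 / 2 < σ₀ ∧ σ₀ < 1)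
    (hzero : ∀ z : ℂ, σ₀ < z.re → χ.LFunction z ≠ 0) :
    ∃ C : ℝ, 0 < C ∧ ∀ x : ℝ, 2 ≤ x →
      ‖∑ n ∈ range (⌊x⌋₊ + 1), (Λ n : ℂ) * χ (n : ZMod m)‖ ≤
        C * x ^ σ₀ * (Real.log (m * x)) ^ 2 := by
  obtain ⟨C, hC, h⟩ :=
    DirichletCharacter.exists_norm_sum_log_mul_twist_vonMangoldt_le hχ hσ₀.1 hσ₀.2 hzero
  refine ⟨5 * C, by positivity, fun x hx ↦ ?_⟩
  have hmain := norm_sum_le_of_norm_sum_log_mul_le (b := fun n ↦ χ n * vonMangoldt n) hσ₀.1.le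
    (by simp) (by simp) h hx
  have hm : (1 : ℝ) ≤ m := by exact_mod_cast NeZero.one_le
  have hlog : Real.log x ≤ Real.log (m * x) :=
    Real.log_le_log (by linarith) (le_mul_of_one_le_left (by linarith) hm)
  have hlog0 : 0 ≤ Real.log x := Real.log_nonneg (by linarith)
  simp_rw [range_eq_Ico, mul_comm (Λ _ : ℂ)]
  refine hmain.trans ?_
  gcongr
end
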